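/- Let m, n ≥ 2. For every real ω with m/n ≤ ω ≤ m there exists a totally irrational matrix ξ ∈ ℝ^{n×m} that satisfies both Property (B) and Property (C), is not badly approximable (not Property (A)), and has ordinary exponent ω(ξ) = ω. -/

import Mathlib

open Filter

/-- The sup-norm of the `i`-th integer vector `x i`, viewed in `ℝ^m`. -/
noncomputable def Xval {m : ℕ} (x : ℕ → Fin m → ℤ) (i : ℕ) : ℝ :=
  ‖(fun j => (x i j : ℝ))‖

/-- The sup-norm of the remainder `ξ 𝒙ᵢ − 𝒚ᵢ`. -/
noncomputable def Lval {m n : ℕ} (ξ : Matrix (Fin n) (Fin m) ℝ)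
    (x : ℕ → Fin m → ℤ) (y : ℕ → Fin n → ℤ) (i : ℕ) : ℝ :=
  ‖(ξ.mulVec (fun j => (x i j : ℝ)) - (fun k => (y i k : ℝ)))‖

/-- `ξ` is totally irrational: `‖ξ𝒙 − 𝒚‖ > 0` for every nonzero integer pair `(𝒙,𝒚)`. -/
def TotallyIrrational {m n : ℕ} (ξ : Matrix (Fin n) (Fin m) ℝ) : Prop :=
  ∀ (u : Fin m → ℤ) (v : Fin n → ℤ), (u, v) ≠ 0 →
    0 < ‖(ξ.mulVec (fun j => (u j : ℝ)) - (fun k => (v k : ℝ)))‖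

/-- `(𝒙ᵢ, 𝒚ᵢ)_{i}` is a sequence of best approximation vectors for `ξ`
(with respect to the sup norms). -/
structure IsBestApproxSeq {m n : ℕ} (ξ : Matrix (Fin n) (Fin m) ℝ)
    (x : ℕ → Fin m → ℤ) (y : ℕ → Fin n → ℤ) : Prop where
  nonzero : ∀ i, x i ≠ 0
  first : Xval x 0 = 1
  xStrictMono : StrictMono (Xval x)
  lStrictAnti : StrictAnti (Lval ξ x y)
  best : ∀ (i : ℕ) (u : Fin m → ℤ) (v : Fin n → ℤ), u ≠ 0 →
    ‖(fun j => (u j : ℝ))‖ < Xval x (i + 1) →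
    Lval ξ x y i ≤ ‖(ξ.mulVec (fun j => (u j : ℝ)) - (fun k => (v k : ℝ)))‖

/-- Property (A): `ξ` is badly approximable. -/
def PropA {m n : ℕ} (ξ : Matrix (Fin n) (Fin m) ℝ) : Prop :=
  ∃ c : ℝ, 0 < c ∧ ∀ (u : Fin m → ℤ) (v : Fin n → ℤ), u ≠ 0 →
    c ≤ ‖(fun j => (u j : ℝ))‖ ^ m *
        ‖(ξ.mulVec (fun j => (u j : ℝ)) - (fun k => (v k : ℝ)))‖ ^ n

/-- Property (B): the ratios `X_{i+1}/X_i` are bounded. -/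
def PropB {m : ℕ} (x : ℕ → Fin m → ℤ) : Prop :=
  ∃ M : ℝ, ∀ i : ℕ, Xval x (i + 1) / Xval x i ≤ M

/-- Property (C): the ratios `L_i/L_{i+1}` are bounded. -/
def PropC {m n : ℕ} (ξ : Matrix (Fin n) (Fin m) ℝ)
    (x : ℕ → Fin m → ℤ) (y : ℕ → Fin n → ℤ) : Prop :=
  ∃ M : ℝ, ∀ i : ℕ, Lval ξ x y i / Lval ξ x y (i + 1) ≤ M

/-- The ordinary exponent `ω(ξ) = limsup (−log Lᵢ)/(log Xᵢ)`, as a value in `[0,+∞]`. -/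
noncomputable def ordExp {m n : ℕ} (ξ : Matrix (Fin n) (Fin m) ℝ)
    (x : ℕ → Fin m → ℤ) (y : ℕ → Fin n → ℤ) : EReal :=
  limsup (fun i => ((-Real.log (Lval ξ x y i) / Real.log (Xval x i) : ℝ) : EReal)) atTop

/-- The uniform exponent `ω̂(ξ) = liminf (−log Lᵢ)/(log X_{i+1})`, as a value in `[0,+∞]`. -/
noncomputable def unifExp {m n : ℕ} (ξ : Matrix (Fin n) (Fin m) ℝ)
    (x : ℕ → Fin m → ℤ) (y : ℕ → Fin n → ℤ) : EReal :=
  liminf (fun i => ((-Real.log (Lval ξ x y i) / Real.log (Xval x (i + 1)) : ℝ) : EReal)) atTop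

namespace LatticePath

open MeasureTheory Module Matrix

section Lattice

variable {I : Type*} [Fintype I] [DecidableEq I]

/-- The real vector underlying an integer vector. -/
def toReal {I : Type*} (z : I → ℤ) : I → ℝ := fun i => (z i : ℝ)

@[simp] lemma toReal_apply {I : Type*} (z : I → ℤ) (i : I) : toReal z i = (z i : ℝ) := rfl

lemma toReal_sub {I : Type*} (z w : I → ℤ) : toReal (z - w) = toReal z - toReal w := by
  ext i; simp [toReal]

/-- Minkowski's theorem on linear forms. -/
lemma exists_forall_abs_mulVec_lt (M : Matrix I I ℝ) (hdet : M.det ≠ 0) (c : I → ℝ)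
    (hc : ∀ i, 0 < c i) (h : |M.det| < ∏ i, c i) :
    ∃ z : I → ℤ, z ≠ 0 ∧ ∀ i, |(M *ᵥ toReal z) i| < c i := by
  classical
  set box : Set (I → ℝ) := Set.pi Set.univ fun i => Set.Ioo (-c i) (c i) with hbox
  have hf : LinearMap.det (Matrix.toLin' M) = M.det := LinearMap.det_toLin' M
  have hfund := ZSpan.isAddFundamentalDomain' (Pi.basisFun ℝ I) (volume : Measure (I → ℝ))
  have hvol : volume (ZSpan.fundamentalDomain (Pi.basisFun ℝ I)) = 1 := by
    rw [ZSpan.fundamentalDomain_pi_basisFun, volume_pi, Measure.pi_pi]; simp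
  have : Countable (Submodule.span ℤ (Set.range (Pi.basisFun ℝ I))).toAddSubgroup :=
    inferInstanceAs (Countable (Submodule.span ℤ (Set.range (Pi.basisFun ℝ I))))
  have hsym : ∀ v ∈ (Matrix.toLin' M) ⁻¹' box, -v ∈ (Matrix.toLin' M) ⁻¹' box := by
    intro v hv i hi
    have := hv i hi
    simp only [Matrix.toLin'_apply, Matrix.mulVec_neg, Pi.neg_apply, Set.mem_Ioo] at this ⊢
    constructor <;> linarith [this.1, this.2]
  have hconv : Convex ℝ ((Matrix.toLin' M) ⁻¹' box) :=
    (convex_pi fun i _ => convex_Ioo _ _).linear_preimage _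
  have hlt : volume (ZSpan.fundamentalDomain (Pi.basisFun ℝ I)) * 2 ^ finrank ℝ (I → ℝ) <
      volume ((Matrix.toLin' M) ⁻¹' box) := by
    rw [hvol, one_mul, Measure.addHaar_preimage_linearMap _ (by rwa [hf]), hf, hbox,
      Real.volume_pi_Ioo, ← ENNReal.ofReal_prod_of_nonneg (fun i _ => by linarith [hc i]),
      ← ENNReal.ofReal_mul (abs_nonneg _)]
    have h2 : (2 : ENNReal) ^ finrank ℝ (I → ℝ) = ENNReal.ofReal (2 ^ Fintype.card I) := by
      rw [ENNReal.ofReal_pow (by norm_num)]; simp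
    rw [h2]
    have hpos : 0 < |M.det| := abs_pos.mpr hdet
    have h3 : ∏ i, (c i - -c i) = 2 ^ Fintype.card I * ∏ i, c i := by
      rw [← Finset.card_univ, ← Finset.prod_const, ← Finset.prod_mul_distrib]
      exact Finset.prod_congr rfl fun i _ => by ring
    refine (ENNReal.ofReal_lt_ofReal_iff ?_).mpr ?_
    · rw [h3]
      have := Finset.prod_pos fun i (_ : i ∈ Finset.univ) => hc i
      rw [abs_inv]; positivity
    · rw [h3, abs_inv, lt_inv_mul_iff₀ hpos, mul_comm]
      exact mul_lt_mul_of_pos_left h (by positivity)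
  obtain ⟨x, hx0, hx⟩ :=
    exists_ne_zero_mem_lattice_of_measure_mul_two_pow_lt_measure hfund hsym hconv hlt
  have hmem := ((Pi.basisFun ℝ I).mem_span_iff_repr_mem ℤ (x : I → ℝ)).mp x.2
  choose z hz using hmem
  have hzx : toReal z = (x : I → ℝ) := by
    ext i; simpa using hz i
  refine ⟨z, ?_, fun i => ?_⟩
  · rintro rfl
    exact hx0 (by ext i; simpa using (congrFun hzx i).symm)
  · have := hx i (Set.mem_univ i)
    rw [hzx, abs_lt]
    simpa using this

/-- A separated finite set in a ball of an `r`-dimensional subspace is small. -/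
lemma card_le_of_separated {E : Type*} [NormedAddCommGroup E] [NormedSpace ℝ E]
    [FiniteDimensional ℝ E] (s : Finset E) {ρ δ : ℝ} (hδ : 0 < δ) (hρ : 0 ≤ ρ)
    (hs : ∀ c ∈ s, ‖c‖ ≤ ρ) (hsep : ∀ c ∈ s, ∀ d ∈ s, c ≠ d → δ ≤ ‖c - d‖) :
    (s.card : ℝ) ≤ (1 + 2 * ρ / δ) ^ finrank ℝ E := by
  borelize E
  let μ : Measure E := Measure.addHaar
  have hδ2 : 0 < δ / 2 := by positivity
  set A : Set E := ⋃ c ∈ s, Metric.ball c (δ / 2)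
  have D : Set.Pairwise (s : Set E) (Function.onFun Disjoint fun c => Metric.ball c (δ / 2)) := by
    rintro c hc d hd hcd
    apply Metric.ball_disjoint_ball
    rw [dist_eq_norm]
    linarith [hsep c hc d hd hcd]
  have hA : A ⊆ Metric.ball 0 (ρ + δ / 2) := by
    refine Set.iUnion₂_subset fun x hx => Metric.ball_subset_ball' ?_
    rw [dist_zero_right]
    linarith [hs x hx]
  have hI : (s.card : ENNReal) * ENNReal.ofReal ((δ / 2) ^ finrank ℝ E) * μ (Metric.ball 0 1) ≤
      ENNReal.ofReal ((ρ + δ / 2) ^ finrank ℝ E) * μ (Metric.ball 0 1) :=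
    calc
      _ = μ A := by
        rw [measure_biUnion_finset D fun c _ => measurableSet_ball]
        simp only [μ.addHaar_ball_of_pos _ hδ2]
        simp only [Finset.sum_const, nsmul_eq_mul, mul_assoc]
      _ ≤ μ (Metric.ball 0 (ρ + δ / 2)) := measure_mono hA
      _ = _ := by simp only [μ.addHaar_ball_of_pos _ (show 0 < ρ + δ / 2 by positivity)]
  have hJ := (ENNReal.mul_le_mul_iff_left (Metric.measure_ball_pos μ (0 : E) zero_lt_one).ne'
    measure_ball_lt_top.ne).1 hI
  have hK := ENNReal.toReal_le_of_le_ofReal (by positivity) hJ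
  rw [ENNReal.toReal_mul, ENNReal.toReal_natCast, ENNReal.toReal_ofReal (by positivity)] at hK
  rw [← le_div_iff₀ (by positivity), ← div_pow] at hK
  convert! hK using 2
  field_simp
  ring

/-- Version of `card_le_of_separated` for subsets of a larger space. -/
lemma card_le_of_separated_of_finrank_span_le {E : Type*} [NormedAddCommGroup E] [NormedSpace ℝ E]
    [FiniteDimensional ℝ E] (s : Finset E) {ρ δ : ℝ} {r : ℕ} (hδ : 0 < δ) (hρ : 0 ≤ ρ)
    (hs : ∀ c ∈ s, ‖c‖ ≤ ρ) (hsep : ∀ c ∈ s, ∀ d ∈ s, c ≠ d → δ ≤ ‖c - d‖)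
    (hr : finrank ℝ (Submodule.span ℝ (s : Set E)) ≤ r) :
    (s.card : ℝ) ≤ (1 + 2 * ρ / δ) ^ r := by
  classical
  let f : s → Submodule.span ℝ (s : Set E) := fun c => ⟨c.1, Submodule.subset_span c.2⟩
  have hf : Function.Injective f := fun a b h => Subtype.ext (Subtype.mk.inj h)
  have := card_le_of_separated (Finset.univ.image f) hδ hρ ?_ ?_
  · rw [Finset.card_image_of_injective _ hf, Finset.card_univ, Fintype.card_coe] at this
    refine this.trans (pow_le_pow_right₀ ?_ hr)
    have : 0 ≤ 2 * ρ / δ := by positivity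
    linarith
  · intro c hc
    obtain ⟨a, -, rfl⟩ := Finset.mem_image.mp hc
    exact hs a a.2
  · intro c hc d hd hcd
    obtain ⟨a, -, rfl⟩ := Finset.mem_image.mp hc
    obtain ⟨b, -, rfl⟩ := Finset.mem_image.mp hd
    exact hsep a a.2 b b.2 fun h => hcd (congrArg f (Subtype.ext h))

lemma toReal_mulVec_det {P : Type*} [Fintype P] [DecidableEq P] {G : Matrix P P ℝ}
    (Z : Matrix P P ℤ) (M : Matrix P P ℝ) (hM : ∀ i j, M i j = (G *ᵥ toReal fun l => Z l j) i) :
    M.det = G.det * (Z.det : ℝ) := by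
  have : M = G * Z.map (Int.cast : ℤ → ℝ) := by
    ext i j
    rw [hM, Matrix.mul_apply]; rfl
  rw [this, Matrix.det_mul]
  congr 1
  exact (RingHom.map_det (Int.castRingHom ℝ) Z).symm

lemma abs_det_le {P : Type*} [Fintype P] [DecidableEq P] (M : Matrix P P ℝ) {x : ℝ}
    (h : ∀ i j, |M i j| ≤ x) : |M.det| ≤ (Fintype.card P).factorial * x ^ Fintype.card P := by
  have := Matrix.det_le (A := M) (abv := AbsoluteValue.abs) h
  simpa using this

/-- Short lattice vectors of a unimodular lattice do not span. -/
lemma finrank_span_short_le (G : Matrix I I ℝ) (hG : |G.det| = 1) (S : Set (I → ℤ)) {ρ : ℝ}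
    (hS : ∀ z ∈ S, ‖G *ᵥ toReal z‖ ≤ ρ)
    (hρ : (Fintype.card I).factorial * ρ ^ Fintype.card I < 1) :
    finrank ℝ (Submodule.span ℝ ((fun z => G *ᵥ toReal z) '' S)) ≤ Fintype.card I - 1 := by
  by_contra! hlt
  obtain ⟨f, hfS, -, hf⟩ :=
    Submodule.exists_fun_fin_finrank_span_eq ℝ ((fun z => G *ᵥ toReal z) '' S)
  have hcard : Fintype.card I ≤ Fintype.card (Fin (finrank ℝ
      (Submodule.span ℝ ((fun z => G *ᵥ toReal z) '' S)))) := by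
    rw [Fintype.card_fin]; omega
  obtain ⟨e⟩ := Function.Embedding.nonempty_of_card_le hcard
  choose z hzS hz using fun i : I => hfS (e i)
  have hli : LinearIndependent ℝ (fun i => f (e i)) := hf.comp e e.injective
  let M : Matrix I I ℝ := Matrix.of fun i j => (G *ᵥ toReal (z j)) i
  have hM : M.det = G.det * ((Matrix.of fun l j => z j l).det : ℝ) :=
    toReal_mulVec_det _ M fun i j => rfl
  have hne : M.det ≠ 0 := by
    rw [← isUnit_iff_ne_zero, ← Matrix.isUnit_iff_isUnit_det,
      ← Matrix.linearIndependent_cols_iff_isUnit]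
    have hcol : M.col = fun i => f (e i) := by
      funext j; rw [← hz]; rfl
    rwa [hcol]
  have h1 : 1 ≤ |M.det| := by
    rw [hM, abs_mul, hG, one_mul]
    have : (Matrix.of fun l j => z j l).det ≠ 0 := by
      intro h0; rw [hM, h0] at hne; simp at hne
    exact_mod_cast Int.one_le_abs this
  have h2 := abs_det_le M (x := ρ) fun i j =>
    (norm_le_pi_norm (G *ᵥ toReal (z j)) i).trans (hS _ (hzS j))
  linarith

/-- A small integral functional on a unimodular lattice kills a short vector. -/
lemma exists_short_of_functional (G : Matrix I I ℝ) (hG : |G.det| = 1) (w : I → ℤ) (v : I → ℝ)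
    (hv : toReal w = v ᵥ* G) (hv0 : v ≠ 0) {ρ : ℝ} (hρ0 : 0 < ρ)
    (hρ : ‖v‖ < ρ ^ (Fintype.card I - 1)) :
    ∃ z : I → ℤ, z ≠ 0 ∧ w ⬝ᵥ z = 0 ∧ ‖G *ᵥ toReal z‖ ≤ Fintype.card I * ρ := by
  have : Nonempty I := by
    by_contra h
    rw [not_nonempty_iff] at h
    exact hv0 (Subsingleton.elim _ _)
  obtain ⟨i₀, hi₀⟩ : ∃ i₀, ‖v‖ = |v i₀| := by
    obtain ⟨i, hi⟩ := Finite.exists_max fun i => ‖v i‖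
    exact ⟨i, le_antisymm ((pi_norm_le_iff_of_nonneg (norm_nonneg _)).mpr hi) (norm_le_pi_norm v i)⟩
  have hvpos : 0 < |v i₀| := hi₀ ▸ norm_pos_iff.mpr hv0
  have hrow : (∑ k, v k • G k) = toReal w := by
    rw [hv]; ext j; simp [Matrix.vecMul, dotProduct, Finset.sum_apply]
  set M := G.updateRow i₀ (toReal w) with hM
  have hdet : M.det = v i₀ * G.det := by
    rw [hM, ← hrow, Matrix.det_updateRow_sum, smul_eq_mul]
  have hdet' : |M.det| = |v i₀| := by rw [hdet, abs_mul, hG, mul_one]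
  obtain ⟨z, hz0, hz⟩ := exists_forall_abs_mulVec_lt M
    (abs_pos.mp (hdet' ▸ hvpos)) (fun i => if i = i₀ then 1 else ρ)
    (fun i => by split_ifs <;> positivity) (by
      rw [hdet', ← hi₀, Finset.prod_ite]
      simpa [Finset.filter_eq', Finset.filter_ne', Finset.card_erase_of_mem] using hρ)
  have hdot : ∀ u : I → ℤ, ((w ⬝ᵥ u : ℤ) : ℝ) = ∑ i, v i * (G *ᵥ toReal u) i := by
    intro u
    have : ((w ⬝ᵥ u : ℤ) : ℝ) = toReal w ⬝ᵥ toReal u := by simp [dotProduct]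
    rw [this, hv, ← Matrix.dotProduct_mulVec]; rfl
  have hw0 : w ⬝ᵥ z = 0 := by
    have := hz i₀
    simp only [hM, Matrix.mulVec, Matrix.updateRow_self, if_pos] at this
    have h2 : |((w ⬝ᵥ z : ℤ) : ℝ)| < 1 := by
      have h3 : ((w ⬝ᵥ z : ℤ) : ℝ) = toReal w ⬝ᵥ toReal z := by simp [dotProduct]
      rw [h3]; exact this
    have h3 : |w ⬝ᵥ z| < 1 := by exact_mod_cast h2
    exact Int.abs_lt_one_iff.mp h3
  have hz' : ∀ i, i ≠ i₀ → |(G *ᵥ toReal z) i| ≤ ρ := by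
    intro i hi
    have := hz i
    simp only [hM, Matrix.mulVec, Matrix.updateRow_ne hi, if_neg hi] at this
    exact this.le
  have hcard1 : (1 : ℝ) ≤ Fintype.card I := by
    exact_mod_cast Fintype.card_pos
  refine ⟨z, hz0, hw0, (pi_norm_le_iff_of_nonneg (by positivity)).mpr fun i => ?_⟩
  by_cases hi : i = i₀
  · subst hi
    have h0 := hdot z
    rw [hw0, ← Finset.add_sum_erase _ _ (Finset.mem_univ i)] at h0
    have h1 : |v i| * |(G *ᵥ toReal z) i| ≤ |v i| * (Fintype.card I * ρ) := by
      have : v i * (G *ᵥ toReal z) i = -∑ k ∈ Finset.univ.erase i, v k * (G *ᵥ toReal z) k := by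
        push_cast at h0; linarith
      rw [← abs_mul, this, abs_neg]
      calc _ ≤ ∑ k ∈ Finset.univ.erase i, |v k * (G *ᵥ toReal z) k| :=
            Finset.abs_sum_le_sum_abs _ _
        _ ≤ ∑ k ∈ Finset.univ.erase i, |v i| * ρ := by
            refine Finset.sum_le_sum fun k hk => ?_
            rw [abs_mul]
            exact mul_le_mul (hi₀ ▸ norm_le_pi_norm v k) (hz' k (Finset.ne_of_mem_erase hk))
              (abs_nonneg _) (abs_nonneg _)
        _ ≤ ∑ k : I, |v i| * ρ :=
            Finset.sum_le_sum_of_subset_of_nonneg (Finset.erase_subset _ _)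
              fun _ _ _ => by positivity
        _ = _ := by simp; ring
    exact le_of_mul_le_mul_left h1 hvpos
  · exact (hz' i hi).trans (by nlinarith)

/-- Short lattice vectors in the kernel of a large primitive functional do not span the kernel. -/
lemma finrank_span_ker_short_le (G : Matrix I I ℝ) (hG : |G.det| = 1) (w z₀ : I → ℤ) (v : I → ℝ)
    (hv : toReal w = v ᵥ* G) (hz₀ : w ⬝ᵥ z₀ = 1) (S : Set (I → ℤ)) {ρ : ℝ} (hρ0 : 0 ≤ ρ)
    (hS : ∀ z ∈ S, ‖G *ᵥ toReal z‖ ≤ ρ) (hSw : ∀ z ∈ S, w ⬝ᵥ z = 0)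
    (hρ : (Fintype.card I).factorial * ρ ^ (Fintype.card I - 1) < ‖v‖) :
    finrank ℝ (Submodule.span ℝ ((fun z => G *ᵥ toReal z) '' S)) ≤ Fintype.card I - 2 := by
  have hv0 : v ≠ 0 := by
    rintro rfl
    have : 0 ≤ (Fintype.card I).factorial * ρ ^ (Fintype.card I - 1) := by positivity
    simp at hρ; linarith
  have : Nonempty I := by
    by_contra h
    rw [not_nonempty_iff] at h
    exact hv0 (Subsingleton.elim _ _)
  obtain ⟨i₀, hi₀⟩ : ∃ i₀, ‖v‖ = |v i₀| := by
    obtain ⟨i, hi⟩ := Finite.exists_max fun i => ‖v i‖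
    exact ⟨i, le_antisymm ((pi_norm_le_iff_of_nonneg (norm_nonneg _)).mpr hi) (norm_le_pi_norm v i)⟩
  have hrow : (∑ k, v k • G k) = toReal w := by
    rw [hv]; ext j; simp [Matrix.vecMul, dotProduct, Finset.sum_apply]
  have hdotr : ∀ u : I → ℤ, ((w ⬝ᵥ u : ℤ) : ℝ) = toReal w ⬝ᵥ toReal u := by
    intro u; simp [dotProduct]
  by_contra! hlt
  obtain ⟨f, hfS, -, hf⟩ :=
    Submodule.exists_fun_fin_finrank_span_eq ℝ ((fun z => G *ᵥ toReal z) '' S)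
  have hcard : Fintype.card {i // i ≠ i₀} ≤ Fintype.card (Fin (finrank ℝ
      (Submodule.span ℝ ((fun z => G *ᵥ toReal z) '' S)))) := by
    rw [Fintype.card_fin]
    simp only [ne_eq, Fintype.card_subtype_compl, Fintype.card_unique]
    omega
  obtain ⟨e⟩ := Function.Embedding.nonempty_of_card_le hcard
  choose y hyS hy using fun i : {i // i ≠ i₀} => hfS (e i)
  have hli : LinearIndependent ℝ (fun i => f (e i)) := hf.comp e e.injective
  let z : I → I → ℤ := fun j => if h : j = i₀ then z₀ else y ⟨j, h⟩
  have hzi₀ : z i₀ = z₀ := by simp [z]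
  have hzi : ∀ j (h : j ≠ i₀), z j = y ⟨j, h⟩ := fun j h => by simp [z, h]
  -- the integer matrix with columns `z j` is nonsingular
  have hdetZ : (Matrix.of fun l j => z j l).det ≠ 0 := by
    intro h0
    have h0' : (Matrix.of fun l j => (G *ᵥ toReal (z j)) l).det = 0 := by
      have := toReal_mulVec_det (G := G) (Matrix.of fun l j => z j l)
        (Matrix.of fun l j => (G *ᵥ toReal (z j)) l) fun i j => rfl
      rw [this, h0]; simp
    obtain ⟨g, hg0, hg⟩ := Matrix.exists_mulVec_eq_zero_iff.mpr h0'
    have hsum : ∑ j, g j • (G *ᵥ toReal (z j)) = 0 := by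
      rw [← hg]; ext i; simp [Matrix.mulVec, dotProduct, Finset.sum_apply, mul_comm]
    have hgi₀ : g i₀ = 0 := by
      have h1 : ∑ j, g j * (v ⬝ᵥ (G *ᵥ toReal (z j))) = 0 := by
        have := congrArg (fun t => v ⬝ᵥ t) hsum
        simpa [dotProduct_sum] using this
      have h2 : ∀ j, v ⬝ᵥ (G *ᵥ toReal (z j)) = ((w ⬝ᵥ z j : ℤ) : ℝ) := fun j => by
        rw [hdotr, hv, Matrix.dotProduct_mulVec]
      rw [Finset.sum_eq_single i₀] at h1
      · rw [h2, hzi₀, hz₀] at h1; simpa using h1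
      · intro j _ hj
        rw [h2, hzi j hj, hSw _ (hyS _)]; simp
      · simp
    have hall : ∀ i : {i // i ≠ i₀}, g i = 0 := by
      refine Fintype.linearIndependent_iff.mp hli (fun i => g i) ?_
      rw [← hsum, ← Finset.add_sum_erase Finset.univ _ (Finset.mem_univ i₀), hgi₀, zero_smul,
        zero_add, Finset.sum_subtype (p := fun i => i ≠ i₀) (Finset.univ.erase i₀) (by simp)
          (fun j => g j • (G *ᵥ toReal (z j)))]
      refine Finset.sum_congr rfl fun i _ => ?_
      rw [hzi i i.2, ← hy]
    refine hg0 (funext fun i => ?_)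
    by_cases h : i = i₀
    · subst h; exact hgi₀
    · exact hall ⟨i, h⟩
  set G' := G.updateRow i₀ (toReal w) with hG'
  have hdetG' : |G'.det| = ‖v‖ := by
    rw [hG', ← hrow, Matrix.det_updateRow_sum, smul_eq_mul, abs_mul, hG, mul_one, hi₀]
  let M : Matrix I I ℝ := Matrix.of fun i j => (G' *ᵥ toReal (z j)) i
  have hM : M.det = G'.det * ((Matrix.of fun l j => z j l).det : ℝ) :=
    toReal_mulVec_det _ M fun i j => rfl
  have h1 : ‖v‖ ≤ |M.det| := by
    rw [hM, abs_mul, hdetG']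
    have : (1 : ℝ) ≤ |((Matrix.of fun l j => z j l).det : ℝ)| := by
      exact_mod_cast Int.one_le_abs hdetZ
    nlinarith [norm_nonneg v]
  have hMi₀ : ∀ j, M i₀ j = ((w ⬝ᵥ z j : ℤ) : ℝ) := fun j => by
    rw [hdotr]; simp only [M, hG', Matrix.mulVec, Matrix.of_apply, Matrix.updateRow_self]
  have hMi₀0 : ∀ j, j ≠ i₀ → M i₀ j = 0 := fun j hj => by
    rw [hMi₀, hzi j hj, hSw _ (hyS _)]; simp
  have hMij : ∀ i j, i ≠ i₀ → j ≠ i₀ → |M i j| ≤ ρ := fun i j hi hj => by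
    have : M i j = (G *ᵥ toReal (z j)) i := by
      simp [M, hG', Matrix.mulVec, Matrix.updateRow_ne hi]
    rw [this, hzi j hj]
    exact (norm_le_pi_norm (G *ᵥ toReal (y ⟨j, hj⟩)) i).trans (hS _ (hyS _))
  have h2 : |M.det| ≤ (Fintype.card I).factorial * ρ ^ (Fintype.card I - 1) := by
    rw [Matrix.det_apply]
    calc _ ≤ ∑ σ : Equiv.Perm I, |Equiv.Perm.sign σ • ∏ i, M (σ i) i| :=
          Finset.abs_sum_le_sum_abs _ _
      _ ≤ ∑ σ : Equiv.Perm I, ρ ^ (Fintype.card I - 1) := by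
          refine Finset.sum_le_sum fun σ _ => ?_
          have habs : |Equiv.Perm.sign σ • ∏ i, M (σ i) i| = ∏ i, |M (σ i) i| := by
            rw [← Finset.abs_prod]
            rcases Int.units_eq_one_or (Equiv.Perm.sign σ) with h | h <;> simp [h]
          rw [habs]
          by_cases hσ : σ i₀ = i₀
          · rw [← Finset.mul_prod_erase _ _ (Finset.mem_univ i₀), hσ, hMi₀, hzi₀, hz₀]
            simp only [Int.cast_one, abs_one, one_mul]
            calc _ ≤ ∏ i ∈ Finset.univ.erase i₀, ρ := by
                  refine Finset.prod_le_prod (fun _ _ => abs_nonneg _) fun i hi => ?_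
                  have hi' := Finset.ne_of_mem_erase hi
                  exact hMij _ _ (fun h => hi' (σ.injective (h.trans hσ.symm))) hi'
              _ = _ := by simp [Finset.card_erase_of_mem]
          · rw [Finset.prod_eq_zero (Finset.mem_univ (σ.symm i₀))]
            · positivity
            · rw [Equiv.apply_symm_apply, hMi₀0, abs_zero]
              intro h
              exact hσ (by rw [← h, Equiv.apply_symm_apply, h])
      _ = _ := by simp [Fintype.card_perm]
  linarith

end Lattice

section Flow

variable {m k : ℕ}

/-- The first block of coordinates of an integer vector. -/
def xpart (z : Fin m ⊕ Fin k → ℤ) : Fin m → ℝ := fun j => (z (Sum.inl j) : ℝ)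

/-- The remainder `ξ x - y` of the integer vector `z = (x, y)`. -/
def rem (ξ : Matrix (Fin k) (Fin m) ℝ) (z : Fin m ⊕ Fin k → ℤ) : Fin k → ℝ :=
  ξ *ᵥ xpart z - fun i => (z (Sum.inr i) : ℝ)

/-- The matrix of the linear map `(x, y) ↦ (a x, b (ξ x - y))`. -/
def flow (a b : ℝ) (ξ : Matrix (Fin k) (Fin m) ℝ) : Matrix (Fin m ⊕ Fin k) (Fin m ⊕ Fin k) ℝ :=
  Matrix.fromBlocks (a • 1) 0 (b • ξ) ((-b) • 1)

/-- The norm of the image of an integer vector under `flow a b ξ`. -/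
noncomputable def hgt (a b : ℝ) (ξ : Matrix (Fin k) (Fin m) ℝ) (z : Fin m ⊕ Fin k → ℤ) : ℝ :=
  max (a * ‖xpart z‖) (b * ‖rem ξ z‖)

lemma flow_mulVec (a b : ℝ) (ξ : Matrix (Fin k) (Fin m) ℝ) (z : Fin m ⊕ Fin k → ℤ) :
    flow a b ξ *ᵥ toReal z = Sum.elim (a • xpart z) (b • rem ξ z) := by
  have : toReal z = Sum.elim (xpart z) (fun i => (z (Sum.inr i) : ℝ)) := by
    ext i; rcases i with i | i <;> simp [toReal, xpart]
  rw [this, flow, Matrix.fromBlocks_mulVec]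
  congr 1
  · ext i; simp [Matrix.smul_mulVec]
  · ext i; simp [Matrix.smul_mulVec, rem, Matrix.neg_mulVec]; ring

lemma norm_sumElim {α β : Type*} [Fintype α] [Fintype β] (f : α → ℝ) (g : β → ℝ) :
    ‖Sum.elim f g‖ = max ‖f‖ ‖g‖ := by
  refine le_antisymm ((pi_norm_le_iff_of_nonneg (by positivity)).mpr ?_) (max_le ?_ ?_)
  · rintro (i | i)
    · exact (norm_le_pi_norm f i).trans (le_max_left _ _)
    · exact (norm_le_pi_norm g i).trans (le_max_right _ _)
  · exact (pi_norm_le_iff_of_nonneg (norm_nonneg _)).mpr fun i =>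
      norm_le_pi_norm (Sum.elim f g) (Sum.inl i)
  · exact (pi_norm_le_iff_of_nonneg (norm_nonneg _)).mpr fun i =>
      norm_le_pi_norm (Sum.elim f g) (Sum.inr i)

lemma norm_flow_mulVec {a b : ℝ} (ha : 0 ≤ a) (hb : 0 ≤ b) (ξ : Matrix (Fin k) (Fin m) ℝ)
    (z : Fin m ⊕ Fin k → ℤ) : ‖flow a b ξ *ᵥ toReal z‖ = hgt a b ξ z := by
  rw [flow_mulVec, norm_sumElim, norm_smul, norm_smul, Real.norm_of_nonneg ha,
    Real.norm_of_nonneg hb, hgt]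

lemma abs_det_flow {a b : ℝ} (ha : 0 ≤ a) (hb : 0 ≤ b) (ξ : Matrix (Fin k) (Fin m) ℝ) :
    |(flow a b ξ).det| = a ^ m * b ^ k := by
  rw [flow, Matrix.det_fromBlocks_zero₁₂, abs_mul, Matrix.det_smul, Matrix.det_smul]
  simp [abs_pow, abs_of_nonneg ha, abs_of_nonneg hb]

lemma norm_mulVec_le (U : Matrix (Fin k) (Fin m) ℝ) (x : Fin m → ℝ) {ε : ℝ} (hε : 0 ≤ ε)
    (hU : ∀ i j, |U i j| ≤ ε) : ‖U *ᵥ x‖ ≤ m * ε * ‖x‖ := by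
  refine (pi_norm_le_iff_of_nonneg (by positivity)).mpr fun i => ?_
  calc ‖(U *ᵥ x) i‖ ≤ ∑ j, ‖U i j * x j‖ := norm_sum_le Finset.univ fun j => U i j * x j
    _ ≤ ∑ _j : Fin m, ε * ‖x‖ := by
        refine Finset.sum_le_sum fun j _ => ?_
        rw [norm_mul]
        exact mul_le_mul (hU i j) (norm_le_pi_norm x j) (norm_nonneg _) hε
    _ = _ := by simp; ring

lemma rem_add (ξ U : Matrix (Fin k) (Fin m) ℝ) (z : Fin m ⊕ Fin k → ℤ) :
    rem (ξ + U) z = rem ξ z + U *ᵥ xpart z := by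
  rw [rem, rem, Matrix.add_mulVec]; abel

lemma hgt_perturb {a b ε : ℝ} (ha : 0 < a) (hb : 0 ≤ b) (hε : 0 ≤ ε)
    {ξ ξ' : Matrix (Fin k) (Fin m) ℝ} (h : ∀ i j, |ξ' i j - ξ i j| ≤ ε * (a / b))
    (z : Fin m ⊕ Fin k → ℤ) : hgt a b ξ' z ≤ (1 + m * ε) * hgt a b ξ z := by
  have h1 : a * ‖xpart z‖ ≤ hgt a b ξ z := le_max_left _ _
  have h2 : b * ‖rem ξ z‖ ≤ hgt a b ξ z := le_max_right _ _
  have h0 : 0 ≤ hgt a b ξ z := le_trans (by positivity) h1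
  have hmε : 0 ≤ m * ε := by positivity
  refine max_le (by nlinarith) ?_
  have h3 : rem ξ' z = rem ξ z + (ξ' - ξ) *ᵥ xpart z := by
    rw [← rem_add]; simp
  rw [h3]
  have h4 := norm_mulVec_le (ξ' - ξ) (xpart z) (ε := ε * (a / b)) (by positivity) h
  have h5 : b * (a / b) ≤ a := by
    rcases hb.eq_or_lt with rfl | hb
    · simpa using ha.le
    · exact (mul_div_cancel₀ a hb.ne').le
  calc b * ‖rem ξ z + (ξ' - ξ) *ᵥ xpart z‖
      ≤ b * (‖rem ξ z‖ + m * (ε * (a / b)) * ‖xpart z‖) :=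
        mul_le_mul_of_nonneg_left ((norm_add_le _ _).trans (by linarith)) hb
    _ = b * ‖rem ξ z‖ + m * ε * ((b * (a / b)) * ‖xpart z‖) := by ring
    _ ≤ hgt a b ξ z + m * ε * (a * ‖xpart z‖) := by gcongr
    _ ≤ hgt a b ξ z + m * ε * hgt a b ξ z := by gcongr
    _ = _ := by ring

lemma card_nat_le_of_abs_sub_le {s : Finset ℕ} {D : ℝ} (hD : 0 ≤ D)
    (h : ∀ p ∈ s, ∀ q ∈ s, |(p : ℝ) - q| ≤ D) : (s.card : ℝ) ≤ D + 1 := by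
  rcases s.eq_empty_or_nonempty with rfl | hs
  · simp; linarith
  · have hsub : s ⊆ Finset.Icc (s.min' hs) (s.max' hs) := fun p hp =>
      Finset.mem_Icc.mpr ⟨s.min'_le p hp, s.le_max' p hp⟩
    have h1 := Finset.card_le_card hsub
    have h2 := (abs_le.mp (h _ (s.max'_mem hs) _ (s.min'_mem hs))).2
    have h3 : s.min' hs ≤ s.max' hs := s.min'_le _ (s.max'_mem hs)
    rw [Nat.card_Icc] at h1
    have h4 : (s.card : ℝ) ≤ ((s.max' hs + 1 - s.min' hs : ℕ) : ℝ) := by exact_mod_cast h1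
    rw [Nat.cast_sub (by omega)] at h4
    push_cast at h4
    linarith

lemma card_row_le (q : ℕ) (hq : 0 < q) (x : Fin m → ℝ) (hx : 0 < ‖x‖) (c : ℝ) {a τ : ℝ}
    (ha : 0 < a) (hτ : 0 < τ) (hle : a * ‖x‖ ≤ 2 * τ * q) :
    ((Finset.univ.filter fun t : Fin m → Fin q =>
      |c + a * ∑ j, ((t j : ℕ) : ℝ) / q * x j| < τ).card : ℝ) ≤
      (q : ℝ) ^ m * (4 * τ / (a * ‖x‖)) := by
  classical
  have : Nonempty (Fin m) := by
    by_contra h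
    rw [not_nonempty_iff] at h
    rw [Subsingleton.elim x 0, norm_zero] at hx
    exact lt_irrefl _ hx
  obtain ⟨l, hl⟩ : ∃ l, ‖x‖ = |x l| := by
    obtain ⟨i, hi⟩ := Finite.exists_max fun i => ‖x i‖
    exact ⟨i, le_antisymm ((pi_norm_le_iff_of_nonneg (norm_nonneg _)).mpr hi) (norm_le_pi_norm x i)⟩
  set s := Finset.univ.filter fun t : Fin m → Fin q =>
      |c + a * ∑ j, ((t j : ℕ) : ℝ) / q * x j| < τ with hs
  have hq' : (0 : ℝ) < q := by exact_mod_cast hq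
  set D : ℝ := 2 * τ * q / (a * ‖x‖) with hD
  have hax : 0 < a * ‖x‖ := by positivity
  have hD1 : 1 ≤ D := by rw [hD, le_div_iff₀ hax]; linarith
  let f : (Fin m → Fin q) → ({j // j ≠ l} → Fin q) := fun t j => t j
  have hcard := Finset.card_le_mul_card_image (f := f) s ⌊D + 1⌋₊ (by
    intro e he
    refine Nat.le_floor ?_
    have hinj : Set.InjOn (fun t : Fin m → Fin q => (t l : ℕ)) (s.filter fun t => f t = e) := by
      intro t ht t' ht' hh
      simp only [Finset.coe_filter, Set.mem_ofPred_eq] at ht ht'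
      funext j
      by_cases hj : j = l
      · subst hj; exact Fin.ext hh
      · exact congrFun (ht.2.trans ht'.2.symm) ⟨j, hj⟩
    rw [← Finset.card_image_of_injOn hinj]
    refine card_nat_le_of_abs_sub_le (by positivity) ?_
    intro p hp p' hp'
    obtain ⟨t, ht, rfl⟩ := Finset.mem_image.mp hp
    obtain ⟨t', ht', rfl⟩ := Finset.mem_image.mp hp'
    rw [Finset.mem_filter] at ht ht'
    have h1 := (Finset.mem_filter.mp ht.1).2
    have h2 := (Finset.mem_filter.mp ht'.1).2
    have hrest : ∑ j ∈ Finset.univ.erase l, ((t j : ℕ) : ℝ) / q * x j =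
        ∑ j ∈ Finset.univ.erase l, ((t' j : ℕ) : ℝ) / q * x j := by
      refine Finset.sum_congr rfl fun j hj => ?_
      have : t j = t' j := congrFun (ht.2.trans ht'.2.symm) ⟨j, Finset.ne_of_mem_erase hj⟩
      rw [this]
    rw [← Finset.add_sum_erase _ _ (Finset.mem_univ l), hrest] at h1
    rw [← Finset.add_sum_erase _ _ (Finset.mem_univ l)] at h2
    have h4 : |(((t l : ℕ) : ℝ) - (t' l : ℕ)) * (a * x l / q)| ≤ 2 * τ := by
      have : (((t l : ℕ) : ℝ) - (t' l : ℕ)) * (a * x l / q) =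
        (c + a * (((t l : ℕ) : ℝ) / q * x l +
          ∑ j ∈ Finset.univ.erase l, ((t' j : ℕ) : ℝ) / q * x j)) -
        (c + a * (((t' l : ℕ) : ℝ) / q * x l +
          ∑ j ∈ Finset.univ.erase l, ((t' j : ℕ) : ℝ) / q * x j)) := by ring
      rw [this]
      have := abs_sub (c + a * (((t l : ℕ) : ℝ) / q * x l +
          ∑ j ∈ Finset.univ.erase l, ((t' j : ℕ) : ℝ) / q * x j))
        (c + a * (((t' l : ℕ) : ℝ) / q * x l +
          ∑ j ∈ Finset.univ.erase l, ((t' j : ℕ) : ℝ) / q * x j))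
      linarith
    rw [abs_mul, abs_div, abs_mul, abs_of_pos ha, abs_of_pos hq', ← hl] at h4
    rw [hD, le_div_iff₀ hax]
    calc _ = |((t l : ℕ) : ℝ) - (t' l : ℕ)| * (a * ‖x‖ / q) * q := by field_simp
      _ ≤ _ := by gcongr)
  have himg : (s.image f).card ≤ q ^ (m - 1) := by
    refine (Finset.card_le_univ _).trans ?_
    rw [Fintype.card_fun, Fintype.card_fin, Fintype.card_subtype_compl, Fintype.card_fin,
      Fintype.card_unique]
  have hm : m = (m - 1) + 1 := by
    have := Fin.pos l
    omega
  calc (s.card : ℝ) ≤ ((⌊D + 1⌋₊ * (s.image f).card : ℕ) : ℝ) := by exact_mod_cast hcard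
    _ ≤ (D + 1) * (q : ℝ) ^ (m - 1) := by
        rw [Nat.cast_mul]
        exact mul_le_mul (Nat.floor_le (by positivity)) (by exact_mod_cast himg)
          (Nat.cast_nonneg _) (by positivity)
    _ ≤ (2 * D) * (q : ℝ) ^ (m - 1) := by gcongr; linarith
    _ = _ := by
        have hqm : (q : ℝ) ^ m = q ^ (m - 1) * q := by rw [← pow_succ, ← hm]
        rw [hD, hqm]; field_simp; ring

set_option maxHeartbeats 1000000 in
/-- One step of the construction: given a lower bound `lam` for the heights of the nonzero
elements of `Γ`, a perturbation of `ξ` at the current scale keeps a lower bound at the next one. -/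
lemma exists_grid_step (hm : 0 < m) (hk : 0 < k) {a b A B g lam ρ₁ : ℝ} (ha : 0 < a) (hb : 0 < b)
    (hA : 1 ≤ A) (hB : 0 < B) (hg : 0 < g) (hlam : 0 < lam) (hgB : 2 * g ≤ B)
    (ξ : Matrix (Fin k) (Fin m) ℝ) (Γ : AddSubgroup (Fin m ⊕ Fin k → ℤ))
    (hΓ : ∀ z ∈ Γ, z ≠ 0 → lam ≤ hgt a b ξ z) (r T : ℕ) (J : Finset (Fin k)) (hJr : J.card ≤ r)
    (ext : (Fin k → Fin m → ℝ) → Matrix (Fin k) (Fin m) ℝ)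
    (hext : ∀ u : Fin k → Fin m → ℝ, (∀ i j, 0 ≤ u i j ∧ u i j ≤ 1) →
      (∀ i ∈ J, ∀ j, ext u i j = u i j) ∧ ∀ i j, |ext u i j| ≤ k)
    (hρ : 2 * m * k * A * g * lam ≤ ρ₁)
    (hrank : finrank ℝ (Submodule.span ℝ ((fun z => flow a b ξ *ᵥ toReal z) ''
      {z | z ∈ Γ ∧ hgt a b ξ z ≤ ρ₁})) ≤ r)
    (hT : 2 * m * k * A * g ≤ 2 ^ T)
    (hsum : T * (5 ^ r * (8 * m * k * g / B) ^ J.card * (2 * m * k * A * g) ^ (r - J.card)) < 1) :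
    ∃ u : Fin k → Fin m → ℝ, (∀ i j, 0 ≤ u i j ∧ u i j ≤ 1) ∧
      ∀ z ∈ Γ, z ≠ 0 → g * lam ≤ hgt (a / A) (b * B) (ξ + (a / b) • ext u) z := by
  classical
  have hmR : (1 : ℝ) ≤ m := by exact_mod_cast hm
  have hkR : (1 : ℝ) ≤ k := by exact_mod_cast hk
  have hmk : (1 : ℝ) ≤ m * k := by nlinarith
  set κ : ℝ := 2 * m * k with hκ
  have hκ2 : 2 ≤ κ := by rw [hκ]; linarith
  set τ : ℝ := g * lam / B with hτ
  have hτ0 : 0 < τ := by positivity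
  have hτlam : τ ≤ lam / 2 := by
    rw [hτ, div_le_iff₀ hB]; nlinarith
  set μ : ℝ := lam / κ with hμ
  have hμ0 : 0 < μ := by positivity
  have hκμ : κ * μ = lam := by rw [hμ]; field_simp
  set q : ℕ := ⌈A * B⌉₊ with hq
  have hqAB : A * B ≤ q := Nat.le_ceil _
  have hq0 : 0 < q := by
    have : (0 : ℝ) < q := lt_of_lt_of_le (by positivity) hqAB
    exact_mod_cast this
  have hq0' : (0 : ℝ) < q := by exact_mod_cast hq0
  by_contra! hcon
  let grid : (Fin k → Fin m → Fin q) → (Fin k → Fin m → ℝ) := fun t i j => ((t i j : ℕ) : ℝ) / q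
  have hgrid : ∀ t, ∀ i j, 0 ≤ grid t i j ∧ grid t i j ≤ 1 := fun t i j => by
    refine ⟨by positivity, (div_le_one hq0').mpr ?_⟩
    exact_mod_cast (t i j).2.le
  choose zz hzΓ hz0 hzlt using fun t => hcon (grid t) (hgrid t)
  -- consequences of being dangerous
  have hdan : ∀ t, a * ‖xpart (zz t)‖ < A * g * lam ∧ μ ≤ a * ‖xpart (zz t)‖ ∧
      hgt a b ξ (zz t) ≤ κ * (a * ‖xpart (zz t)‖) ∧
      ∀ i ∈ J, |b * rem ξ (zz t) i + a * ∑ j, ((t i j : ℕ) : ℝ) / q * xpart (zz t) j| < τ := by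
    intro t
    obtain ⟨he1, he2⟩ := hext (grid t) (hgrid t)
    obtain ⟨h1, h2⟩ := max_lt_iff.mp (hzlt t)
    have h1' : a * ‖xpart (zz t)‖ < A * g * lam := by
      rw [div_mul_eq_mul_div, div_lt_iff₀ (by linarith)] at h1; linarith
    have h2' : b * ‖rem (ξ + (a / b) • ext (grid t)) (zz t)‖ < τ := by
      rw [hτ, lt_div_iff₀ hB]; linarith
    have hrem : b • rem (ξ + (a / b) • ext (grid t)) (zz t) =
        b • rem ξ (zz t) + a • (ext (grid t) *ᵥ xpart (zz t)) := by
      rw [rem_add, smul_add, Matrix.smul_mulVec, smul_smul, mul_div_cancel₀ a hb.ne']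
    have h4 : b * ‖rem ξ (zz t)‖ ≤ τ + m * k * (a * ‖xpart (zz t)‖) := by
      have h5 := norm_mulVec_le (ext (grid t)) (xpart (zz t)) (by positivity) he2
      have h6 : b • rem ξ (zz t) = b • rem (ξ + (a / b) • ext (grid t)) (zz t) -
          a • (ext (grid t) *ᵥ xpart (zz t)) := by rw [hrem]; abel
      have h7 := norm_sub_le (b • rem (ξ + (a / b) • ext (grid t)) (zz t))
        (a • (ext (grid t) *ᵥ xpart (zz t)))
      rw [← h6, norm_smul, norm_smul, norm_smul, Real.norm_of_nonneg ha.le,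
        Real.norm_of_nonneg hb.le] at h7
      nlinarith
    have hσ0 : 0 ≤ a * ‖xpart (zz t)‖ := by positivity
    have hμσ : μ ≤ a * ‖xpart (zz t)‖ := by
      rw [hμ, div_le_iff₀ (by linarith)]
      rcases le_max_iff.mp (hΓ _ (hzΓ t) (hz0 t)) with h | h
      · nlinarith
      · rw [hκ]; linarith
    refine ⟨h1', hμσ, max_le (by nlinarith) ?_, ?_⟩
    · have : lam / 2 ≤ m * k * (a * ‖xpart (zz t)‖) := by
        rw [← hκμ, hκ]
        have := mul_le_mul_of_nonneg_left hμσ (show (0 : ℝ) ≤ m * k by positivity)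
        linarith
      rw [hκ]; linarith
    · intro i hi
      have h8 := (norm_le_pi_norm (b • rem (ξ + (a / b) • ext (grid t)) (zz t)) i)
      rw [norm_smul, Real.norm_of_nonneg hb.le, hrem] at h8
      have h9 : (b • rem ξ (zz t) + a • (ext (grid t) *ᵥ xpart (zz t))) i =
          b * rem ξ (zz t) i + a * ∑ j, ((t i j : ℕ) : ℝ) / q * xpart (zz t) j := by
        simp only [Pi.add_apply, Pi.smul_apply, smul_eq_mul, Matrix.mulVec, dotProduct]
        congr 2
        exact Finset.sum_congr rfl fun j _ => by rw [he1 i hi j]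
      rw [h9] at h8
      exact lt_of_le_of_lt h8 h2'
  set Z := Finset.univ.image zz with hZ
  have hZdan : ∀ z ∈ Z, z ∈ Γ ∧ a * ‖xpart z‖ < A * g * lam ∧ μ ≤ a * ‖xpart z‖ ∧
      hgt a b ξ z ≤ κ * (a * ‖xpart z‖) := by
    intro z hz
    obtain ⟨t, -, rfl⟩ := Finset.mem_image.mp hz
    exact ⟨hzΓ t, (hdan t).1, (hdan t).2.1, (hdan t).2.2.1⟩
  -- each dangerous vector spoils few grid points
  have hbad : ∀ z ∈ Z, ((Finset.univ.filter fun t => zz t = z).card : ℝ) ≤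
      (q : ℝ) ^ (m * k) * (4 * τ / (a * ‖xpart z‖)) ^ J.card := by
    intro z hz
    obtain ⟨-, hlt, hμσ, -⟩ := hZdan z hz
    have hσ0 : 0 < a * ‖xpart z‖ := hμ0.trans_le hμσ
    have hx0 : 0 < ‖xpart z‖ := by
      by_contra h
      have : ‖xpart z‖ = 0 := le_antisymm (not_lt.mp h) (norm_nonneg _)
      rw [this, mul_zero] at hσ0
      exact lt_irrefl _ hσ0
    let row : Fin k → Finset (Fin m → Fin q) := fun i => if i ∈ J then
      Finset.univ.filter fun t : Fin m → Fin q =>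
        |b * rem ξ z i + a * ∑ j, ((t j : ℕ) : ℝ) / q * xpart z j| < τ else Finset.univ
    have hsub : (Finset.univ.filter fun t => zz t = z) ⊆ Fintype.piFinset row := by
      intro t ht
      rw [Finset.mem_filter] at ht
      rw [Fintype.mem_piFinset]
      intro i
      by_cases hi : i ∈ J
      · have := (hdan t).2.2.2 i hi
        rw [ht.2] at this
        simpa [row, hi] using this
      · simp [row, hi]
    have hle : a * ‖xpart z‖ ≤ 2 * τ * q := by
      have : A * g * lam = A * B * τ := by rw [hτ]; field_simp
      nlinarith
    have hrow : ∀ i, ((row i).card : ℝ) ≤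
        (q : ℝ) ^ m * (if i ∈ J then 4 * τ / (a * ‖xpart z‖) else 1) := by
      intro i
      by_cases hi : i ∈ J
      · simp only [row, hi, if_true]
        exact card_row_le q hq0 (xpart z) hx0 _ ha hτ0 hle
      · simp [row, hi]
    calc ((Finset.univ.filter fun t => zz t = z).card : ℝ)
        ≤ ((Fintype.piFinset row).card : ℝ) := by exact_mod_cast Finset.card_le_card hsub
      _ = ∏ i, ((row i).card : ℝ) := by rw [Fintype.card_piFinset, Nat.cast_prod]
      _ ≤ ∏ i, ((q : ℝ) ^ m * (if i ∈ J then 4 * τ / (a * ‖xpart z‖) else 1)) :=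
          Finset.prod_le_prod (fun _ _ => Nat.cast_nonneg _) fun i _ => hrow i
      _ = _ := by
          rw [Finset.prod_mul_distrib, Finset.prod_ite_mem]
          simp [pow_mul, div_pow]
  -- dyadic layers
  let lay : (Fin m ⊕ Fin k → ℤ) → ℕ := fun z => Nat.log 2 ⌊a * ‖xpart z‖ / μ⌋₊
  have hlay : ∀ z ∈ Z, (2 : ℝ) ^ lay z * μ ≤ a * ‖xpart z‖ ∧
      a * ‖xpart z‖ < (2 : ℝ) ^ (lay z + 1) * μ := by
    intro z hz
    obtain ⟨-, hlt, hμσ, -⟩ := hZdan z hz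
    have h1 : 1 ≤ a * ‖xpart z‖ / μ := by rwa [le_div_iff₀ hμ0, one_mul]
    have hfl : ⌊a * ‖xpart z‖ / μ⌋₊ ≠ 0 := by
      have := Nat.le_floor (n := 1) (a := a * ‖xpart z‖ / μ) (by simpa using h1)
      omega
    constructor
    · rw [← le_div_iff₀ hμ0]
      have h2 := Nat.pow_log_le_self 2 hfl
      calc (2 : ℝ) ^ lay z ≤ (⌊a * ‖xpart z‖ / μ⌋₊ : ℝ) := by exact_mod_cast h2
        _ ≤ _ := Nat.floor_le (by linarith)
    · rw [← div_lt_iff₀ hμ0]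
      have h2 := Nat.lt_pow_succ_log_self (b := 2) (by norm_num) ⌊a * ‖xpart z‖ / μ⌋₊
      have h3 : (⌊a * ‖xpart z‖ / μ⌋₊ : ℝ) + 1 ≤ (2 : ℝ) ^ (lay z + 1) := by exact_mod_cast h2
      exact (Nat.lt_floor_add_one _).trans_le h3
  have hlayA : ∀ z ∈ Z, (2 : ℝ) ^ lay z < κ * A * g := by
    intro z hz
    obtain ⟨-, hlt, -, -⟩ := hZdan z hz
    have h1 := (hlay z hz).1.trans_lt hlt
    rw [← hκμ] at h1
    have : A * g * (κ * μ) = κ * A * g * μ := by ring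
    rw [this] at h1
    exact lt_of_mul_lt_mul_right h1 hμ0.le
  have hlayT : ∀ z ∈ Z, lay z ∈ Finset.range T := by
    intro z hz
    have := (hlayA z hz).trans_le hT
    rw [Finset.mem_range]
    exact (pow_lt_pow_iff_right₀ (by norm_num)).mp this
  set M : ℝ := 5 ^ r * (8 * m * k * g / B) ^ J.card * (κ * A * g) ^ (r - J.card) with hM
  have hM0 : 0 ≤ M := by positivity
  have hfib : ∀ l ∈ Finset.range T, ∑ z ∈ Z with lay z = l,
      (4 * τ / (a * ‖xpart z‖)) ^ J.card ≤ M := by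
    intro l _
    rcases (Z.filter fun z => lay z = l).eq_empty_or_nonempty with he | ⟨z₁, hz₁⟩
    · rw [he]; simpa using hM0
    have hlA : (2 : ℝ) ^ l < κ * A * g := by
      obtain ⟨h1, h2⟩ := Finset.mem_filter.mp hz₁
      rw [← h2]; exact hlayA z₁ h1
    set S := Z.filter fun z => lay z = l with hS
    set F : (Fin m ⊕ Fin k → ℤ) → (Fin m ⊕ Fin k → ℝ) := fun z => flow a b ξ *ᵥ toReal z with hF
    have hFsub : ∀ z w, ‖F z - F w‖ = hgt a b ξ (z - w) := by
      intro z w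
      rw [hF, ← norm_flow_mulVec ha.le hb.le, toReal_sub, Matrix.mulVec_sub]
    have hsep : ∀ z ∈ S, ∀ w ∈ S, z ≠ w → lam ≤ ‖F z - F w‖ := by
      intro z hz w hw hne
      rw [hFsub]
      exact hΓ _ (Γ.sub_mem (hZdan z (Finset.mem_filter.mp hz).1).1
        (hZdan w (Finset.mem_filter.mp hw).1).1) (sub_ne_zero.mpr hne)
    have hinj : Set.InjOn F S := by
      intro z hz w hw h
      by_contra hne
      have := hsep z hz w hw hne
      rw [h, sub_self, norm_zero] at this
      linarith
    have hcard : (S.card : ℝ) ≤ (5 * 2 ^ l) ^ r := by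
      rw [← Finset.card_image_of_injOn hinj]
      refine (card_le_of_separated_of_finrank_span_le (S.image F) (ρ := 2 ^ (l + 1) * lam)
        (r := r) hlam (by positivity) ?_ ?_ ?_).trans ?_
      · intro c hc
        obtain ⟨z, hz, rfl⟩ := Finset.mem_image.mp hc
        obtain ⟨hzZ, hzl⟩ := Finset.mem_filter.mp hz
        rw [hF, norm_flow_mulVec ha.le hb.le]
        refine (hZdan z hzZ).2.2.2.trans ?_
        have := (hlay z hzZ).2
        rw [hzl] at this
        rw [← hκμ]
        nlinarith
      · intro c hc e he hne
        obtain ⟨z, hz, rfl⟩ := Finset.mem_image.mp hc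
        obtain ⟨w, hw, rfl⟩ := Finset.mem_image.mp he
        exact hsep z hz w hw fun h => hne (by rw [h])
      · refine (Submodule.finrank_mono (Submodule.span_mono ?_)).trans hrank
        intro c hc
        obtain ⟨z, hz, rfl⟩ := Finset.mem_image.mp (Finset.mem_coe.mp hc)
        obtain ⟨h1, h2, h3, h4⟩ := hZdan z (Finset.mem_filter.mp hz).1
        refine ⟨z, ⟨h1, h4.trans (le_trans ?_ hρ)⟩, rfl⟩
        have := mul_le_mul_of_nonneg_left h2.le (show 0 ≤ κ by linarith)
        linarith
      · refine pow_le_pow_left₀ (by positivity) ?_ r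
        have h1 : (1 : ℝ) ≤ 2 ^ l := one_le_pow₀ (by norm_num)
        have h2 : 2 * (2 ^ (l + 1) * lam) / lam = 4 * 2 ^ l := by field_simp; ring
        rw [h2]; linarith
    have hterm : ∀ z ∈ S, (4 * τ / (a * ‖xpart z‖)) ^ J.card ≤
        ((8 * m * k * g / B) / 2 ^ l) ^ J.card := by
      intro z hz
      obtain ⟨hzZ, hzl⟩ := Finset.mem_filter.mp hz
      have h1 := (hlay z hzZ).1
      rw [hzl] at h1
      refine pow_le_pow_left₀ (by positivity) ?_ _
      calc 4 * τ / (a * ‖xpart z‖) ≤ 4 * τ / (2 ^ l * μ) := by gcongr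
        _ = _ := by
          have : τ = g * (κ * μ) / B := by rw [hκμ]
          rw [this, hκ]; field_simp; ring
    calc ∑ z ∈ S, (4 * τ / (a * ‖xpart z‖)) ^ J.card
        ≤ S.card • ((8 * m * k * g / B) / 2 ^ l) ^ J.card := Finset.sum_le_card_nsmul _ _ _ hterm
      _ ≤ (5 * 2 ^ l) ^ r * ((8 * m * k * g / B) / 2 ^ l) ^ J.card := by
          rw [nsmul_eq_mul]; gcongr
      _ = 5 ^ r * (8 * m * k * g / B) ^ J.card * (2 ^ l) ^ (r - J.card) := by
          rw [mul_pow, div_pow]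
          have : ((2 : ℝ) ^ l) ^ r = (2 ^ l) ^ (r - J.card) * (2 ^ l) ^ J.card := by
            rw [← pow_add]; congr 1; omega
          rw [this]; field_simp
      _ ≤ M := by rw [hM]; gcongr
  have htot : ((q : ℝ) ^ (m * k)) ≤ (q : ℝ) ^ (m * k) * (T * M) := by
    calc (q : ℝ) ^ (m * k) = ((Finset.univ : Finset (Fin k → Fin m → Fin q)).card : ℝ) := by
          rw [Finset.card_univ]; simp [pow_mul]
      _ = ∑ z ∈ Z, ((Finset.univ.filter fun t => zz t = z).card : ℝ) := by
          rw [Finset.card_eq_sum_card_image zz, Nat.cast_sum]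
      _ ≤ ∑ z ∈ Z, (q : ℝ) ^ (m * k) * (4 * τ / (a * ‖xpart z‖)) ^ J.card :=
          Finset.sum_le_sum hbad
      _ = (q : ℝ) ^ (m * k) * ∑ z ∈ Z, (4 * τ / (a * ‖xpart z‖)) ^ J.card := by
          rw [Finset.mul_sum]
      _ ≤ _ := by
          gcongr
          rw [← Finset.sum_fiberwise_of_maps_to hlayT]
          refine (Finset.sum_le_card_nsmul _ _ M hfib).trans ?_
          simp
  have : (q : ℝ) ^ (m * k) * (T * M) < (q : ℝ) ^ (m * k) * 1 := by
    gcongr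
  linarith

end Flow

section Scales

/-- Contraction factor of the first block. -/
noncomputable def sA (m k : ℕ) (H : ℝ) : ℝ := H ^ (k * (m + k - 1))

/-- Expansion factor of the second block. -/
noncomputable def sB (m k : ℕ) (H : ℝ) : ℝ := H ^ (m * (m + k - 1))

/-- The scale `H` is so large that each of the three kinds of steps is possible. -/
structure Admissible (m k : ℕ) (H : ℝ) : Prop where
  two_le_m : 2 ≤ m
  two_le_k : 2 ≤ k
  two_le_H : 2 ≤ H
  generic : ∃ T : ℕ, 2 * m * k * sA m k H * 2 ≤ 2 ^ T ∧
    T * (5 ^ (m + k - 1) * (8 * m * k * 2 / sB m k H) ^ k *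
      (2 * m * k * sA m k H * 2) ^ (m - 1)) < 1
  descend : ∃ T : ℕ, 2 * m * k * sA m k H * (H ^ m)⁻¹ ≤ 2 ^ T ∧
    T * (5 ^ (m + k - 2) * (8 * m * k * (H ^ m)⁻¹ / sB m k H) ^ (k - 1) *
      (2 * m * k * sA m k H * (H ^ m)⁻¹) ^ (m - 1)) < 1
  ascend : ∃ T : ℕ, 2 * m * k * sA m k H * H ^ k ≤ 2 ^ T ∧
    T * (5 ^ (m + k - 2) * (8 * m * k * H ^ k / sB m k H) ^ k *
      (2 * m * k * sA m k H * H ^ k) ^ (m - 2)) < 1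

lemma sum_bound_lt_one {m k r s e T d : ℕ} {A B g H c C : ℝ} (hm : 1 ≤ m) (hk : 1 ≤ k)
    (hA : 0 < A) (hB : 0 < B) (hg : 0 < g) (hH : 0 < H) (hr : r ≤ d) (hs : s ≤ d) (he : e ≤ d)
    (hT : (T : ℝ) ≤ C * H) (hc : 0 ≤ c) (hmain : g ^ s * (A * g) ^ e * H ^ 2 ≤ c * B ^ s)
    (hH' : C * (5 ^ d * (8 * m * k) ^ d * (8 * m * k) ^ d * c) < H) :
    T * (5 ^ r * (8 * m * k * g / B) ^ s * (2 * m * k * A * g) ^ e) < 1 := by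
  have hmk : (1 : ℝ) ≤ m * k := by
    have h1 : (1 : ℝ) ≤ m := by exact_mod_cast hm
    have h2 : (1 : ℝ) ≤ k := by exact_mod_cast hk
    nlinarith
  have h8 : (1 : ℝ) ≤ 8 * m * k := by linarith
  have h0 : g ^ s * (A * g) ^ e / B ^ s ≤ c / H ^ 2 := by
    rw [div_le_div_iff₀ (by positivity) (by positivity)]; exact hmain
  have hcc : 0 ≤ c / H ^ 2 := by positivity
  have h1 : (8 * m * k * g / B) ^ s * (2 * m * k * A * g) ^ e =
      (8 * m * k) ^ s * (2 * m * k) ^ e * (g ^ s * (A * g) ^ e / B ^ s) := by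
    rw [div_pow, mul_pow (8 * (m : ℝ) * k), mul_assoc (2 * (m : ℝ) * k), mul_pow (2 * (m : ℝ) * k)]
    ring
  have hCH : 0 ≤ C * H := (Nat.cast_nonneg T).trans hT
  calc (T : ℝ) * (5 ^ r * (8 * m * k * g / B) ^ s * (2 * m * k * A * g) ^ e)
      = T * (5 ^ r * ((8 * m * k) ^ s * (2 * m * k) ^ e * (g ^ s * (A * g) ^ e / B ^ s))) := by
        rw [← h1]; ring
    _ ≤ (C * H) * (5 ^ d * ((8 * m * k) ^ d * (8 * m * k) ^ d * (c / H ^ 2))) := by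
        have h3 : (2 * (m : ℝ) * k) ^ e ≤ (8 * m * k) ^ d :=
          (pow_le_pow_left₀ (by positivity) (by nlinarith) e).trans (pow_le_pow_right₀ h8 he)
        gcongr
        · norm_num
    _ = C * (5 ^ d * (8 * m * k) ^ d * (8 * m * k) ^ d * c) / H := by field_simp
    _ < 1 := by rwa [div_lt_one hH]

lemma exists_admissible {m k : ℕ} (hm : 2 ≤ m) (hk : 2 ≤ k) : ∃ H : ℕ, Admissible m k H := by
  set d := m + k with hd
  set C : ℝ := 4 * m * k + k * d with hC
  obtain ⟨H, hH⟩ := exists_nat_gt (max 2 (C * (5 ^ d * (8 * m * k) ^ d * (8 * m * k) ^ d *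
    (2 ^ d * 2 ^ d))))
  have hH2 : (2 : ℝ) ≤ H := (le_max_left _ _).trans hH.le
  have hHC := (le_max_right _ _).trans_lt hH
  have hH1 : (1 : ℝ) ≤ H := by linarith
  have hA1 : 1 ≤ sA m k H := one_le_pow₀ hH1
  have hB1 : 1 ≤ sB m k H := one_le_pow₀ hH1
  obtain ⟨m, rfl⟩ := Nat.exists_eq_add_of_le' hm
  obtain ⟨k, rfl⟩ := Nat.exists_eq_add_of_le' hk
  set T : ℕ := 4 * (m + 2) * (k + 2) + (k + 2) * d * H with hT
  have hTC : (T : ℝ) ≤ C * H := by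
    rw [hT, hC]; push_cast
    have : (0 : ℝ) ≤ 4 * (m + 2) * (k + 2) := by positivity
    nlinarith
  have hT2 : ∀ g : ℝ, 0 < g → g ≤ 2 * (H : ℝ) ^ (k + 2) →
      2 * ((m + 2 : ℕ) : ℝ) * ((k + 2 : ℕ) : ℝ) * sA (m + 2) (k + 2) H * g ≤ 2 ^ T := by
    intro g hg0 hg
    have h1 : 4 * (m + 2) * (k + 2) ≤ 2 ^ (4 * (m + 2) * (k + 2)) := Nat.lt_two_pow_self.le
    have h2 : (H : ℝ) ≤ 2 ^ H := by exact_mod_cast Nat.lt_two_pow_self.le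
    have h1' : (4 * (m + 2) * (k + 2) : ℝ) ≤ 2 ^ (4 * (m + 2) * (k + 2)) := by exact_mod_cast h1
    calc 2 * ((m + 2 : ℕ) : ℝ) * ((k + 2 : ℕ) : ℝ) * sA (m + 2) (k + 2) H * g
        ≤ 2 * ((m + 2 : ℕ) : ℝ) * ((k + 2 : ℕ) : ℝ) * sA (m + 2) (k + 2) H *
          (2 * (H : ℝ) ^ (k + 2)) := by gcongr
      _ = (4 * (m + 2) * (k + 2)) * (H : ℝ) ^ ((k + 2) * d) := by
          have : (k + 2) * d = (k + 2) * (m + 2 + (k + 2) - 1) + (k + 2) := by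
            rw [hd]
            have : m + 2 + (k + 2) - 1 = m + k + 3 := by omega
            rw [this]; ring
          rw [sA, this, pow_add (H : ℝ)]; push_cast; ring
      _ ≤ 2 ^ (4 * (m + 2) * (k + 2)) * (2 ^ H) ^ ((k + 2) * d) := by gcongr
      _ = 2 ^ T := by rw [hT, pow_add, ← pow_mul]; congr 2; ring
  have hHk : (1 : ℝ) ≤ (H : ℝ) ^ (k + 2) := one_le_pow₀ hH1
  have hm1 : 1 ≤ m + 2 := by omega
  have hk1 : 1 ≤ k + 2 := by omega
  have hcpos : (1 : ℝ) ≤ 2 ^ d * 2 ^ d := by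
    have : (1 : ℝ) ≤ 2 ^ d := one_le_pow₀ (by norm_num)
    nlinarith
  have hexp : m + 2 + (k + 2) - 1 = m + k + 3 := by omega
  refine ⟨H, hm, hk, hH2, ⟨T, hT2 2 (by norm_num) (by linarith), ?_⟩, ⟨T, hT2 _ (by positivity) ?_,
    ?_⟩, ⟨T, hT2 _ (by positivity) (by linarith), ?_⟩⟩
  · refine sum_bound_lt_one hm1 hk1 (by positivity) (by positivity) (by norm_num) (by linarith)
      (d := d) (by omega) (by omega) (by omega) hTC (by positivity) ?_ hHC
    have h1 : (2 : ℝ) ^ (k + 2) ≤ 2 ^ d := pow_le_pow_right₀ (by norm_num) (by omega)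
    have h2 : (2 : ℝ) ^ (m + 2 - 1) ≤ 2 ^ d := pow_le_pow_right₀ (by norm_num) (by omega)
    have h3 : sA (m + 2) (k + 2) H ^ (m + 2 - 1) * (H : ℝ) ^ 2 ≤
        sB (m + 2) (k + 2) H ^ (k + 2) := by
      rw [sA, sB, ← pow_mul, ← pow_mul, ← pow_add, hexp]
      refine pow_le_pow_right₀ hH1 ?_
      have : m + 2 - 1 = m + 1 := by omega
      rw [this]; nlinarith
    calc (2 : ℝ) ^ (k + 2) * (sA (m + 2) (k + 2) H * 2) ^ (m + 2 - 1) * (H : ℝ) ^ 2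
        = 2 ^ (k + 2) * 2 ^ (m + 2 - 1) * (sA (m + 2) (k + 2) H ^ (m + 2 - 1) * (H : ℝ) ^ 2) := by
          rw [mul_pow]; ring
      _ ≤ _ := by gcongr
  · have : ((H : ℝ) ^ (m + 2))⁻¹ ≤ 1 := inv_le_one_of_one_le₀ (one_le_pow₀ hH1)
    linarith
  · refine sum_bound_lt_one hm1 hk1 (by positivity) (by positivity) (by positivity) (by linarith)
      (d := d) (by omega) (by omega) (by omega) hTC (by positivity) ?_ hHC
    have h3 : sA (m + 2) (k + 2) H ^ (m + 1) * (H : ℝ) ^ 2 ≤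
        sB (m + 2) (k + 2) H ^ (k + 1) * (H ^ (m + 2)) ^ (k + 1) * (H ^ (m + 2)) ^ (m + 1) := by
      rw [sA, sB, ← pow_mul, ← pow_mul, ← pow_mul, ← pow_mul, ← pow_add, ← pow_add, ← pow_add, hexp]
      refine pow_le_pow_right₀ hH1 ?_
      nlinarith
    have e1 : m + 2 - 1 = m + 1 := by omega
    have e2 : k + 2 - 1 = k + 1 := by omega
    rw [e1, e2]
    calc (((H : ℝ) ^ (m + 2))⁻¹) ^ (k + 1) *
            (sA (m + 2) (k + 2) H * ((H : ℝ) ^ (m + 2))⁻¹) ^ (m + 1)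
          * (H : ℝ) ^ 2
        = (sA (m + 2) (k + 2) H ^ (m + 1) * (H : ℝ) ^ 2) /
          ((H ^ (m + 2)) ^ (k + 1) * (H ^ (m + 2)) ^ (m + 1)) := by
          rw [mul_pow, inv_pow, inv_pow]; field_simp
      _ ≤ sB (m + 2) (k + 2) H ^ (k + 1) := by
          rw [div_le_iff₀ (by positivity)]; linarith
      _ ≤ _ := by
          have : 0 ≤ sB (m + 2) (k + 2) H ^ (k + 1) := by positivity
          nlinarith
  · refine sum_bound_lt_one hm1 hk1 (by positivity) (by positivity) (by positivity) (by linarith)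
      (d := d) (by omega) (by omega) (by omega) hTC (by positivity) ?_ hHC
    have e1 : m + 2 - 2 = m := by omega
    have h3 : ((H : ℝ) ^ (k + 2)) ^ (k + 2) * (sA (m + 2) (k + 2) H * (H : ℝ) ^ (k + 2)) ^ m
        * (H : ℝ) ^ 2 ≤ sB (m + 2) (k + 2) H ^ (k + 2) := by
      rw [sA, sB, mul_pow, ← pow_mul, ← pow_mul, ← pow_mul, ← pow_mul, ← pow_add, ← pow_add,
        ← pow_add, hexp]
      refine pow_le_pow_right₀ hH1 ?_
      nlinarith
    rw [e1]
    have : 0 ≤ sB (m + 2) (k + 2) H ^ (k + 2) := by positivity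
    nlinarith

end Scales

section Dual

variable {m k : ℕ}

/-- The second block of coordinates of an integer vector. -/
def ypart (w : Fin m ⊕ Fin k → ℤ) : Fin k → ℝ := fun i => (w (Sum.inr i) : ℝ)

/-- The first block of coefficients of the integer functional `w` in the coordinates
`(x, ξ x - y)`. -/
def dualW (ξ : Matrix (Fin k) (Fin m) ℝ) (w : Fin m ⊕ Fin k → ℤ) : Fin m → ℝ :=
  xpart w + ypart w ᵥ* ξ

/-- The coordinates of the integer functional `w` with respect to `flow a b ξ`. -/
noncomputable def dualv (a b : ℝ) (ξ : Matrix (Fin k) (Fin m) ℝ) (w : Fin m ⊕ Fin k → ℤ) :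
    Fin m ⊕ Fin k → ℝ := Sum.elim (a⁻¹ • dualW ξ w) ((-b⁻¹) • ypart w)

/-- The norm of the integer functional `w` with respect to `flow a b ξ`. -/
noncomputable def dht (a b : ℝ) (ξ : Matrix (Fin k) (Fin m) ℝ) (w : Fin m ⊕ Fin k → ℤ) : ℝ :=
  max (a⁻¹ * ‖dualW ξ w‖) (b⁻¹ * ‖ypart w‖)

lemma norm_dualv {a b : ℝ} (ha : 0 ≤ a) (hb : 0 ≤ b) (ξ : Matrix (Fin k) (Fin m) ℝ)
    (w : Fin m ⊕ Fin k → ℤ) : ‖dualv a b ξ w‖ = dht a b ξ w := by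
  rw [dualv, norm_sumElim, norm_smul, norm_smul, norm_neg, Real.norm_of_nonneg (inv_nonneg.mpr ha),
    Real.norm_of_nonneg (inv_nonneg.mpr hb), dht]

lemma toReal_eq_sumElim (w : Fin m ⊕ Fin k → ℤ) : toReal w = Sum.elim (xpart w) (ypart w) := by
  ext i; rcases i with i | i <;> simp [toReal, xpart, ypart]

lemma dualv_vecMul_flow {a b : ℝ} (ha : a ≠ 0) (hb : b ≠ 0) (ξ : Matrix (Fin k) (Fin m) ℝ)
    (w : Fin m ⊕ Fin k → ℤ) : toReal w = dualv a b ξ w ᵥ* flow a b ξ := by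
  rw [toReal_eq_sumElim, flow, dualv, Matrix.vecMul_fromBlocks]
  congr 1
  · ext i
    simp [Matrix.vecMul_smul, Matrix.smul_vecMul, Matrix.neg_vecMul, dualW, hb, ha]
  · ext i
    simp [Matrix.vecMul_smul, hb, Matrix.vecMul_neg]

lemma dualv_ne_zero {a b : ℝ} (ha : a ≠ 0) (hb : b ≠ 0) (ξ : Matrix (Fin k) (Fin m) ℝ)
    {w : Fin m ⊕ Fin k → ℤ} (hw : w ≠ 0) : dualv a b ξ w ≠ 0 := by
  intro h
  have := dualv_vecMul_flow ha hb ξ w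
  rw [h, Matrix.zero_vecMul] at this
  exact hw (funext fun i => by simpa [toReal] using congrFun this i)

lemma abs_dotProduct_le {a b : ℝ} (ha : 0 < a) (hb : 0 < b) (ξ : Matrix (Fin k) (Fin m) ℝ)
    (w z : Fin m ⊕ Fin k → ℤ) :
    |((w ⬝ᵥ z : ℤ) : ℝ)| ≤ (m + k) * (dht a b ξ w * hgt a b ξ z) := by
  have h1 : ((w ⬝ᵥ z : ℤ) : ℝ) = dualv a b ξ w ⬝ᵥ (flow a b ξ *ᵥ toReal z) := by
    rw [Matrix.dotProduct_mulVec, ← dualv_vecMul_flow ha.ne' hb.ne']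
    simp [dotProduct, toReal]
  rw [h1, ← norm_dualv ha.le hb.le, ← norm_flow_mulVec ha.le hb.le]
  calc |dualv a b ξ w ⬝ᵥ (flow a b ξ *ᵥ toReal z)|
      ≤ ∑ i, |dualv a b ξ w i * (flow a b ξ *ᵥ toReal z) i| := Finset.abs_sum_le_sum_abs _ _
    _ ≤ ∑ _i : Fin m ⊕ Fin k, ‖dualv a b ξ w‖ * ‖flow a b ξ *ᵥ toReal z‖ := by
        refine Finset.sum_le_sum fun i _ => ?_
        rw [abs_mul]
        exact mul_le_mul (norm_le_pi_norm (dualv a b ξ w) i)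
          (norm_le_pi_norm (flow a b ξ *ᵥ toReal z) i) (abs_nonneg _) (norm_nonneg _)
    _ = _ := by simp

lemma abs_det_flow_eq_one {a b : ℝ} (ha : 0 ≤ a) (hb : 0 ≤ b) (hab : a ^ m * b ^ k = 1)
    (ξ : Matrix (Fin k) (Fin m) ℝ) : |(flow a b ξ).det| = 1 := by
  rw [abs_det_flow ha hb, hab]

/-- A short functional forces a short integer vector. -/
lemma exists_hgt_le_of_dht_lt {a b ρ : ℝ} (ha : 0 < a) (hb : 0 < b) (hab : a ^ m * b ^ k = 1)
    (ξ : Matrix (Fin k) (Fin m) ℝ) {w : Fin m ⊕ Fin k → ℤ} (hw : w ≠ 0) (hρ0 : 0 < ρ)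
    (hρ : dht a b ξ w < ρ ^ (m + k - 1)) : ∃ z ≠ 0, w ⬝ᵥ z = 0 ∧ hgt a b ξ z ≤ (m + k) * ρ := by
  obtain ⟨z, hz, hwz, hz'⟩ := exists_short_of_functional (flow a b ξ)
    (abs_det_flow_eq_one ha.le hb.le hab ξ) w _ (dualv_vecMul_flow ha.ne' hb.ne' ξ w)
    (dualv_ne_zero ha.ne' hb.ne' ξ hw) hρ0 (by simpa [norm_dualv ha.le hb.le] using hρ)
  refine ⟨z, hz, hwz, ?_⟩
  rw [norm_flow_mulVec ha.le hb.le] at hz'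
  simpa using hz'

lemma le_dht_of_forall_le_hgt {a b c : ℝ} (ha : 0 < a) (hb : 0 < b) (hab : a ^ m * b ^ k = 1)
    (ξ : Matrix (Fin k) (Fin m) ℝ) (hmk : 0 < m + k) (hc : 0 < c)
    (h : ∀ z, z ≠ 0 → c ≤ hgt a b ξ z) {w : Fin m ⊕ Fin k → ℤ} (hw : w ≠ 0) :
    (c / (2 * (m + k))) ^ (m + k - 1) ≤ dht a b ξ w := by
  have hmk' : (0 : ℝ) < m + k := by exact_mod_cast hmk
  by_contra hlt
  push Not at hlt
  obtain ⟨z, hz, -, hz'⟩ := exists_hgt_le_of_dht_lt ha hb hab ξ hw (by positivity) hlt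
  have := h z hz
  have h2 : (m + k : ℝ) * (c / (2 * (m + k))) = c / 2 := by field_simp
  linarith

lemma exists_primitive {I : Type*} [Fintype I] (w : I → ℤ) (hw : w ≠ 0) :
    ∃ (g : ℤ) (w' z₀ : I → ℤ), g ≠ 0 ∧ w = g • w' ∧ w' ⬝ᵥ z₀ = 1 := by
  classical
  set φ : (I → ℤ) →ₗ[ℤ] ℤ :=
    { toFun := fun z => w ⬝ᵥ z
      map_add' := fun x y => dotProduct_add _ _ _
      map_smul' := fun c x => dotProduct_smul _ _ _ } with hφ
  obtain ⟨g, hg⟩ := (IsPrincipalIdealRing.principal (LinearMap.range φ : Ideal ℤ)).principal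
  have hdvd : ∀ i, g ∣ w i := fun i => by
    have : w i ∈ LinearMap.range φ := ⟨Pi.single i 1, by simp [hφ]⟩
    rw [hg] at this
    exact Ideal.mem_span_singleton.mp this
  choose w' hw' using hdvd
  have hww : w = g • w' := funext fun i => by simpa using hw' i
  have hg0 : g ≠ 0 := by
    rintro rfl
    exact hw (by simpa using hww)
  obtain ⟨z₀, hz₀⟩ : g ∈ LinearMap.range φ := by
    rw [hg]; exact Submodule.mem_span_singleton_self g
  refine ⟨g, w', z₀, hg0, hww, ?_⟩
  have : w ⬝ᵥ z₀ = g := hz₀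
  rw [hww, smul_dotProduct, smul_eq_mul] at this
  exact mul_left_cancel₀ hg0 (by rw [this, mul_one])

lemma dualW_smul (ξ : Matrix (Fin k) (Fin m) ℝ) (g : ℤ) (w : Fin m ⊕ Fin k → ℤ) :
    dualW ξ (g • w) = (g : ℝ) • dualW ξ w := by
  have h1 : ypart (g • w) = (g : ℝ) • ypart w := by ext; simp [ypart]
  have h2 : xpart (g • w) = (g : ℝ) • xpart w := by ext; simp [xpart]
  rw [dualW, h1, h2, Matrix.smul_vecMul, dualW, smul_add]

lemma dualW_add (ξ U : Matrix (Fin k) (Fin m) ℝ) (w : Fin m ⊕ Fin k → ℤ) :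
    dualW (ξ + U) w = dualW ξ w + ypart w ᵥ* U := by
  rw [dualW, dualW, Matrix.vecMul_add, add_assoc]

/-- Minkowski's theorem for functionals. -/
lemma exists_dual_lt {a b s t : ℝ} (hab : a ^ m * b ^ k = 1)
    (ξ : Matrix (Fin k) (Fin m) ℝ) (hs : 0 < s) (ht : 0 < t) (hst : 1 < s ^ m * t ^ k) :
    ∃ w : Fin m ⊕ Fin k → ℤ, w ≠ 0 ∧ (∀ j, |a⁻¹ * dualW ξ w j| < s) ∧
      ∀ i, |b⁻¹ * ypart w i| < t := by
  set M : Matrix (Fin m ⊕ Fin k) (Fin m ⊕ Fin k) ℝ :=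
    Matrix.fromBlocks (a⁻¹ • 1) (a⁻¹ • ξᵀ) 0 (b⁻¹ • 1) with hM
  have hdet : M.det = 1 := by
    rw [hM, Matrix.det_fromBlocks_zero₂₁, Matrix.det_smul, Matrix.det_smul]
    simp only [Fintype.card_fin, det_one, mul_one, inv_pow]
    rw [← mul_inv, hab, inv_one]
  obtain ⟨w, hw, hlt⟩ := exists_forall_abs_mulVec_lt M (by rw [hdet]; exact one_ne_zero)
    (Sum.elim (fun _ => s) fun _ => t) (by rintro (i | i) <;> simpa)
    (by rw [hdet]; simpa [Fintype.prod_sum_type] using hst)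
  have hMw : M *ᵥ toReal w = Sum.elim (a⁻¹ • dualW ξ w) (b⁻¹ • ypart w) := by
    rw [toReal_eq_sumElim, hM, Matrix.fromBlocks_mulVec]
    congr 1
    · rw [dualW, Matrix.smul_mulVec, Matrix.smul_mulVec, Matrix.one_mulVec, Matrix.mulVec_transpose,
        smul_add]
      rfl
    · rw [Matrix.zero_mulVec, zero_add, Matrix.smul_mulVec, Matrix.one_mulVec]
      rfl
  rw [hMw] at hlt
  exact ⟨w, hw, fun j => by simpa using hlt (Sum.inl j), fun i => by simpa using hlt (Sum.inr i)⟩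

lemma exists_abs_eq_norm (hk : 0 < k) (v : Fin k → ℝ) : ∃ i, |v i| = ‖v‖ := by
  have : Nonempty (Fin k) := ⟨⟨0, hk⟩⟩
  obtain ⟨i, hi⟩ := Finite.exists_max fun i => ‖v i‖
  exact ⟨i, le_antisymm (norm_le_pi_norm v i) ((pi_norm_le_iff_of_nonneg (norm_nonneg _)).mpr hi)⟩

/-- If all integer vectors are long, some matrix close to `ξ` satisfies a rational linear relation
whose coefficients are comparable to `b`. -/
lemma exists_relation {a b c v : ℝ} (hm : 0 < m) (hk : 2 ≤ k) (ha : 0 < a) (hb : 0 < b)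
    (hab : a ^ m * b ^ k = 1)
    (ξ : Matrix (Fin k) (Fin m) ℝ) (hc : 0 < c) (hc1 : c ≤ 1)
    (h : ∀ z, z ≠ 0 → c ≤ hgt a b ξ z) (hv : v = (c / (2 * (m + k))) ^ (m + k - 1)) :
    ∃ (w z₀ : Fin m ⊕ Fin k → ℤ) (i₀ : Fin k) (U : Matrix (Fin k) (Fin m) ℝ),
      w ⬝ᵥ z₀ = 1 ∧ |ypart w i₀| = ‖ypart w‖ ∧ 0 < ‖ypart w‖ ∧ dualW (ξ + U) w = 0 ∧
      (∀ i j, |U i j| ≤ a / b) ∧ v ≤ b⁻¹ * ‖ypart w‖ ∧ b⁻¹ * ‖ypart w‖ ≤ (v ^ m)⁻¹ := by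
  classical
  have hmk' : (2 : ℝ) ≤ m + k := by
    have : 2 ≤ m + k := by omega
    exact_mod_cast this
  have hq0 : 0 < c / (2 * (m + k)) := by positivity
  have hq1 : c / (2 * (m + k)) < 1 := by rw [div_lt_one (by positivity)]; linarith
  have hv0 : 0 < v := by rw [hv]; positivity
  have hv1 : v < 1 := by rw [hv]; exact pow_lt_one₀ hq0.le hq1 (by omega)
  have hst : 1 < v ^ m * ((v ^ m)⁻¹) ^ k := by
    have h1 : 1 < (v ^ m)⁻¹ := (one_lt_inv₀ (by positivity)).mpr (pow_lt_one₀ hv0.le hv1 hm.ne')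
    obtain ⟨k, rfl⟩ := Nat.exists_eq_add_of_le' hk
    rw [pow_succ' _ (k + 1), ← mul_assoc, mul_inv_cancel₀ (by positivity), one_mul]
    exact one_lt_pow₀ h1 (by omega)
  obtain ⟨w', hw'0, hwx, hwy⟩ := exists_dual_lt hab ξ hv0 (by positivity) hst
  obtain ⟨g, w, z₀, hg, rfl, hz₀⟩ := exists_primitive w' hw'0
  have hw0 : w ≠ 0 := by rintro rfl; simp at hz₀
  have hg1 : (1 : ℝ) ≤ |(g : ℝ)| := by exact_mod_cast Int.one_le_abs hg
  have hx : ∀ j, |a⁻¹ * dualW ξ w j| < v := fun j => by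
    have := hwx j
    rw [dualW_smul, Pi.smul_apply, smul_eq_mul, mul_left_comm, abs_mul] at this
    nlinarith [abs_nonneg (a⁻¹ * dualW ξ w j)]
  have hy : ∀ i, |b⁻¹ * ypart w i| < (v ^ m)⁻¹ := fun i => by
    have := hwy i
    have h1 : ypart (g • w) i = (g : ℝ) * ypart w i := by simp [ypart]
    rw [h1, mul_left_comm, abs_mul] at this
    nlinarith [abs_nonneg (b⁻¹ * ypart w i)]
  have hle := le_dht_of_forall_le_hgt ha hb hab ξ (by omega) hc h hw0
  rw [← hv] at hle
  have hWlt : a⁻¹ * ‖dualW ξ w‖ < v := by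
    obtain ⟨j, hj⟩ := exists_abs_eq_norm hm (dualW ξ w)
    have := hx j
    rwa [abs_mul, abs_of_pos (inv_pos.mpr ha), hj] at this
  have hyv : v ≤ b⁻¹ * ‖ypart w‖ := (le_max_iff.mp hle).resolve_left (not_le.mpr hWlt)
  obtain ⟨i₀, hi₀⟩ := exists_abs_eq_norm (by omega) (ypart w)
  have hypos : 0 < ‖ypart w‖ := by
    by_contra hcon
    have : ‖ypart w‖ = 0 := le_antisymm (not_lt.mp hcon) (norm_nonneg _)
    rw [this] at hyv; linarith
  have hyi : ypart w i₀ ≠ 0 := by rw [← abs_pos, hi₀]; exact hypos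
  refine ⟨w, z₀, i₀, Matrix.of fun i j => if i = i₀ then -(dualW ξ w j / ypart w i₀) else 0,
    hz₀, hi₀, hypos,
    ?_, ?_, hyv, ?_⟩
  · rw [dualW_add]
    ext j
    simp [Matrix.vecMul, dotProduct]
    field_simp
    ring
  · intro i j
    rw [Matrix.of_apply]
    split_ifs with hi
    · rw [abs_neg, abs_div, hi₀, div_le_div_iff₀ hypos hb]
      have h1 : a⁻¹ * |dualW ξ w j| < v := by
        simpa [abs_mul, abs_of_pos (inv_pos.mpr ha)] using hx j
      rw [inv_mul_lt_iff₀ ha] at h1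
      rw [le_inv_mul_iff₀ hb] at hyv
      nlinarith
    · simp; positivity
  · have := hy i₀
    rw [abs_mul, abs_of_pos (inv_pos.mpr hb), hi₀] at this
    exact this.le

end Dual

section Levels

variable {m k : ℕ} {H : ℝ}

/-- The height of an integer vector at level `j`. -/
noncomputable def lvl (H : ℝ) (j : ℕ) (ξ : Matrix (Fin k) (Fin m) ℝ) (z : Fin m ⊕ Fin k → ℤ) : ℝ :=
  hgt (sA m k H ^ j)⁻¹ (sB m k H ^ j) ξ z

/-- The height of an integer functional at level `j`. -/
noncomputable def ldht (H : ℝ) (j : ℕ) (ξ : Matrix (Fin k) (Fin m) ℝ)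
    (w : Fin m ⊕ Fin k → ℤ) : ℝ :=
  dht (sA m k H ^ j)⁻¹ (sB m k H ^ j) ξ w

/-- The natural size of perturbations at level `j`. -/
noncomputable def mesh (m k : ℕ) (H : ℝ) (j : ℕ) : ℝ := (sA m k H ^ j)⁻¹ / sB m k H ^ j

namespace Admissible

lemma H_pos (h : Admissible m k H) : 0 < H := by linarith [h.two_le_H]

lemma one_le_H (h : Admissible m k H) : 1 ≤ H := by linarith [h.two_le_H]

lemma sA_pos (h : Admissible m k H) : 0 < sA m k H := pow_pos h.H_pos _

lemma sB_pos (h : Admissible m k H) : 0 < sB m k H := pow_pos h.H_pos _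

lemma one_le_sA (h : Admissible m k H) : 1 ≤ sA m k H := one_le_pow₀ h.one_le_H

lemma one_le_sB (h : Admissible m k H) : 1 ≤ sB m k H := one_le_pow₀ h.one_le_H

lemma two_le_pow (h : Admissible m k H) {n : ℕ} (hn : n ≠ 0) : 2 ≤ H ^ n :=
  h.two_le_H.trans (le_self_pow₀ h.one_le_H hn)

lemma two_le_sA (h : Admissible m k H) : 2 ≤ sA m k H := by
  have h1 := h.two_le_k
  have h2 := h.two_le_m
  refine h.two_le_pow (Nat.mul_ne_zero (by omega) (by omega))

lemma two_mul_pow_le_sB (h : Admissible m k H) : 2 * H ^ k ≤ sB m k H := by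
  have h1 := h.two_le_k
  have h2 := h.two_le_m
  calc 2 * H ^ k ≤ H * H ^ k := by have := h.two_le_H; have := h.H_pos; gcongr
    _ = H ^ (k + 1) := by ring
    _ ≤ _ := pow_le_pow_right₀ h.one_le_H (by nlinarith [show m + k - 1 ≥ k + 1 by omega])

lemma four_le_sB (h : Admissible m k H) : 4 ≤ sB m k H := by
  have := h.two_mul_pow_le_sB
  have := h.two_le_pow (n := k) (by have := h.two_le_k; omega)
  linarith

lemma vol (h : Admissible m k H) (j : ℕ) : ((sA m k H ^ j)⁻¹) ^ m * (sB m k H ^ j) ^ k = 1 := by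
  have : (sB m k H ^ j) ^ k = (sA m k H ^ j) ^ m := by
    rw [sA, sB, ← pow_mul, ← pow_mul, ← pow_mul, ← pow_mul]; congr 1; ring
  rw [this, inv_pow, inv_mul_cancel₀]
  exact pow_ne_zero _ (pow_ne_zero _ h.sA_pos.ne')

lemma mesh_pos (h : Admissible m k H) (j : ℕ) : 0 < mesh m k H j :=
  div_pos (inv_pos.mpr (pow_pos h.sA_pos _)) (pow_pos h.sB_pos _)

lemma mesh_succ (h : Admissible m k H) (j : ℕ) : 2 * mesh m k H (j + 1) ≤ mesh m k H j := by
  have h1 := h.two_le_sA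
  have h2 := h.one_le_sB
  have h3 := h.mesh_pos j
  have : mesh m k H j = sA m k H * sB m k H * mesh m k H (j + 1) := by
    have := h.sA_pos
    have := h.sB_pos
    rw [mesh, mesh, pow_succ, pow_succ]; field_simp
  have h4 := h.mesh_pos (j + 1)
  rw [this]
  have : 2 ≤ sA m k H * sB m k H := by nlinarith
  nlinarith

lemma mesh_zero : mesh m k H 0 = 1 := by simp [mesh]

lemma mesh_le (h : Admissible m k H) (j : ℕ) : mesh m k H j ≤ (1 / 2) ^ j := by
  induction j with
  | zero => simp [mesh_zero]
  | succ j ih => have := h.mesh_succ j; rw [pow_succ]; linarith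

lemma lvl_pos_le (h : Admissible m k H) {ε : ℝ} (hε : 0 ≤ ε) {j : ℕ}
    {ξ ξ' : Matrix (Fin k) (Fin m) ℝ} (hξ : ∀ i l, |ξ' i l - ξ i l| ≤ ε * mesh m k H j)
    (z : Fin m ⊕ Fin k → ℤ) : lvl H j ξ' z ≤ (1 + m * ε) * lvl H j ξ z :=
  hgt_perturb (inv_pos.mpr (pow_pos h.sA_pos _)) (pow_pos h.sB_pos _).le hε hξ z

lemma exists_lvl_lt_two (h : Admissible m k H) (j : ℕ) (ξ : Matrix (Fin k) (Fin m) ℝ) :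
    ∃ z : Fin m ⊕ Fin k → ℤ, z ≠ 0 ∧ lvl H j ξ z ≤ 2 := by
  have ha : 0 < (sA m k H ^ j)⁻¹ := inv_pos.mpr (pow_pos h.sA_pos _)
  have hb : 0 < sB m k H ^ j := pow_pos h.sB_pos _
  have hdet := abs_det_flow_eq_one ha.le hb.le (h.vol j) ξ
  obtain ⟨z, hz, hlt⟩ := exists_forall_abs_mulVec_lt
    (flow (sA m k H ^ j)⁻¹ (sB m k H ^ j) ξ) (by rw [← abs_pos, hdet]; exact one_pos)
    (fun _ => 2) (fun _ => by norm_num) (by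
      rw [hdet, Finset.prod_const]
      refine one_lt_pow₀ (by norm_num) ?_
      have := h.two_le_m
      simp; omega)
  refine ⟨z, hz, ?_⟩
  rw [lvl, ← norm_flow_mulVec ha.le hb.le]
  exact (pi_norm_le_iff_of_nonneg (by norm_num)).mpr fun i => (hlt i).le

end Admissible

/-- Entrywise closeness of matrices. -/
def Close (ε : ℝ) (ξ ξ' : Matrix (Fin k) (Fin m) ℝ) : Prop := ∀ i l, |ξ' i l - ξ i l| ≤ ε

lemma Close.trans {ε ε' : ℝ} {ξ ξ' ξ'' : Matrix (Fin k) (Fin m) ℝ} (h : Close ε ξ ξ')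
    (h' : Close ε' ξ' ξ'') : Close (ε + ε') ξ ξ'' := fun i l => by
  have h1 := h i l
  have h2 := h' i l
  rw [abs_le] at *
  constructor <;> linarith [h1.1, h1.2, h2.1, h2.2]

lemma Close.symm {ε : ℝ} {ξ ξ' : Matrix (Fin k) (Fin m) ℝ} (h : Close ε ξ ξ') : Close ε ξ' ξ :=
  fun i l => by rw [abs_sub_comm]; exact h i l

lemma Close.mono {ε ε' : ℝ} {ξ ξ' : Matrix (Fin k) (Fin m) ℝ} (h : Close ε ξ ξ') (hε : ε ≤ ε') :
    Close ε' ξ ξ' := fun i l => (h i l).trans hε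

lemma Close.refl {ε : ℝ} (hε : 0 ≤ ε) (ξ : Matrix (Fin k) (Fin m) ℝ) : Close ε ξ ξ :=
  fun i l => by simpa using hε

/-- At level `j` the first minimum is of order `H ^ (-e)`. -/
def Bd (H c C : ℝ) (e j : ℕ) (ξ : Matrix (Fin k) (Fin m) ℝ) : Prop :=
  (∀ z : Fin m ⊕ Fin k → ℤ, z ≠ 0 → c * (H ^ e)⁻¹ ≤ lvl H j ξ z) ∧
    ∃ z : Fin m ⊕ Fin k → ℤ, z ≠ 0 ∧ lvl H j ξ z ≤ C * (H ^ e)⁻¹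

lemma Bd.mono (hH : 0 < H) {c C c' C' : ℝ} {e j : ℕ} {ξ : Matrix (Fin k) (Fin m) ℝ}
    (h : Bd H c C e j ξ) (hc : c' ≤ c) (hC : C ≤ C') : Bd H c' C' e j ξ := by
  refine ⟨fun z hz => le_trans ?_ (h.1 z hz), ?_⟩
  · gcongr
  · obtain ⟨z, hz, hz'⟩ := h.2
    exact ⟨z, hz, hz'.trans (by gcongr)⟩

lemma Bd.perturb (hA : Admissible m k H) {c C ε : ℝ} {e j : ℕ} {ξ ξ' : Matrix (Fin k) (Fin m) ℝ}
    (hε : 0 ≤ ε) (h : Bd H c C e j ξ) (hξ : Close (ε * mesh m k H j) ξ ξ') :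
    Bd H (c / (1 + m * ε)) (C * (1 + m * ε)) e j ξ' := by
  have h1 : 0 < 1 + m * ε := by positivity
  refine ⟨fun z hz => ?_, ?_⟩
  · have h2 := h.1 z hz
    have h3 := hA.lvl_pos_le hε hξ.symm z
    rw [div_mul_eq_mul_div, div_le_iff₀ h1]
    linarith
  · obtain ⟨z, hz, hz'⟩ := h.2
    refine ⟨z, hz, (hA.lvl_pos_le hε hξ z).trans ?_⟩
    nlinarith

/-- The factor lost when passing from a level to the limit. -/
noncomputable def loss (m k : ℕ) : ℝ := 1 + m * (40 * k)

lemma loss_pos : 0 < loss m k := by rw [loss]; positivity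

/-- All matrices close to `ξ'` at level `J'` are close to `ξ` at level `J` and have controlled
first minima between these levels. -/
def Path (H c C : ℝ) (E : ℕ → ℕ) (J J' : ℕ) (ξ ξ' : Matrix (Fin k) (Fin m) ℝ) : Prop :=
  ∀ ξ'', Close (40 * k * mesh m k H J') ξ' ξ'' → Close (40 * k * mesh m k H J) ξ ξ'' ∧
    ∀ j, J ≤ j → j < J' → Bd H (c / loss m k) (C * loss m k) (E j) j ξ''

lemma Path.refl {c C : ℝ} {E : ℕ → ℕ} (J : ℕ) (ξ : Matrix (Fin k) (Fin m) ℝ) :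
    Path H c C E J J ξ ξ := fun _ h => ⟨h, fun _ h1 h2 => absurd h1 (not_le.mpr h2)⟩

lemma Path.trans {c C : ℝ} {E : ℕ → ℕ} {J J' J'' : ℕ} {ξ ξ' ξ'' : Matrix (Fin k) (Fin m) ℝ}
    (h : Path H c C E J J' ξ ξ') (h' : Path H c C E J' J'' ξ' ξ'') : Path H c C E J J'' ξ ξ'' := by
  intro η hη
  obtain ⟨h1, h2⟩ := h' η hη
  obtain ⟨h3, h4⟩ := h η h1
  exact ⟨h3, fun j hj hj' => (lt_or_ge j J').elim (h4 j hj) fun hge => h2 j hge hj'⟩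

lemma Path.congr {c C : ℝ} {E E' : ℕ → ℕ} {J J' : ℕ} {ξ ξ' : Matrix (Fin k) (Fin m) ℝ}
    (h : Path H c C E J J' ξ ξ') (hE : ∀ j, J ≤ j → j < J' → E j = E' j) :
    Path H c C E' J J' ξ ξ' := fun η hη =>
  ⟨(h η hη).1, fun j hj hj' => hE j hj hj' ▸ (h η hη).2 j hj hj'⟩

lemma Path.single (hA : Admissible m k H) {c C : ℝ} {E : ℕ → ℕ} {J : ℕ}
    {ξ ξ' η : Matrix (Fin k) (Fin m) ℝ} (h : Close (20 * k * mesh m k H J) ξ ξ')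
    (h' : Close (20 * k * mesh m k H J) η ξ') (hη : Bd H c C (E J) J η) :
    Path H c C E J (J + 1) ξ ξ' := by
  intro ξ'' hξ''
  have h1 : 40 * k * mesh m k H (J + 1) ≤ 20 * k * mesh m k H J := by
    have := hA.mesh_succ J
    have hk : (0 : ℝ) ≤ k := Nat.cast_nonneg k
    nlinarith
  have h2 := hξ''.mono h1
  refine ⟨(h.trans h2).mono (by linarith), fun j hj hj' => ?_⟩
  obtain rfl : j = J := by omega
  exact hη.perturb hA (by positivity) ((h'.trans h2).mono (by linarith))

/-- Steps of a state machine assemble to a path. -/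
lemma exists_path_of_step (hA : Admissible m k H) {c C R : ℝ} {E : ℕ → ℕ} {J : ℕ} (hR0 : 0 ≤ R)
    (hR : R ≤ 19 * k) (State : ℕ → Matrix (Fin k) (Fin m) ℝ → Prop) (l : ℕ)
    (hstep : ∀ i < l, ∀ η, State i η → Bd H c C (E (J + i)) (J + i) η ∧
      ∃ ξ', Close (k * mesh m k H (J + i)) η ξ' ∧ State (i + 1) ξ')
    {ξ η : Matrix (Fin k) (Fin m) ℝ} (hη : Close (R * mesh m k H J) ξ η) (h0 : State 0 η) :
    ∃ ξ' η', Path H c C E J (J + l) ξ ξ' ∧ Close (R * mesh m k H (J + l)) ξ' η' ∧ State l η' ∧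
      (l ≠ 0 → ξ' = η') := by
  induction l with
  | zero => exact ⟨ξ, η, Path.refl _ _, hη, h0, fun h => absurd rfl h⟩
  | succ l ih =>
    obtain ⟨ξ₁, η₁, hp, hc, hs, -⟩ := ih fun i hi => hstep i (by omega)
    obtain ⟨hb, ξ', hξ', hs'⟩ := hstep l (by omega) η₁ hs
    have hm := hA.mesh_pos (J + l)
    have hk : (0 : ℝ) ≤ k := Nat.cast_nonneg k
    refine ⟨ξ', ξ', hp.trans (Path.single hA ((hc.trans hξ').mono ?_) (hξ'.mono ?_) hb),
      Close.refl (mul_nonneg hR0 (hA.mesh_pos _).le) _, hs', fun _ => rfl⟩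
    · nlinarith
    · nlinarith

end Levels

section Steps

variable {m k : ℕ} {H : ℝ}

/-- Lower bound for the heights on the kernel of `w`. -/
def KerLow (H lam : ℝ) (j : ℕ) (ξ : Matrix (Fin k) (Fin m) ℝ) (w : Fin m ⊕ Fin k → ℤ) : Prop :=
  ∀ z : Fin m ⊕ Fin k → ℤ, z ≠ 0 → w ⬝ᵥ z = 0 → lam ≤ lvl H j ξ z

lemma exists_level_step (hA : Admissible m k H) {g lam ρ₁ : ℝ} (hg : 0 < g) (hlam : 0 < lam)
    (hgB : 2 * g ≤ sB m k H) (j : ℕ) (ξ : Matrix (Fin k) (Fin m) ℝ)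
    (Γ : AddSubgroup (Fin m ⊕ Fin k → ℤ))
    (hΓ : ∀ z ∈ Γ, z ≠ 0 → lam ≤ lvl H j ξ z) (r : ℕ) (J : Finset (Fin k)) (hJr : J.card ≤ r)
    (ext : (Fin k → Fin m → ℝ) → Matrix (Fin k) (Fin m) ℝ)
    (hext : ∀ u : Fin k → Fin m → ℝ, (∀ i j, 0 ≤ u i j ∧ u i j ≤ 1) →
      (∀ i ∈ J, ∀ j, ext u i j = u i j) ∧ ∀ i j, |ext u i j| ≤ k)
    (hρ : 2 * m * k * sA m k H * g * lam ≤ ρ₁)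
    (hrank : finrank ℝ (Submodule.span ℝ ((fun z => flow (sA m k H ^ j)⁻¹ (sB m k H ^ j) ξ *ᵥ
      toReal z) '' {z | z ∈ Γ ∧ lvl H j ξ z ≤ ρ₁})) ≤ r)
    (hsum : ∃ T : ℕ, 2 * m * k * sA m k H * g ≤ 2 ^ T ∧ T * (5 ^ r * (8 * m * k * g / sB m k H) ^
      J.card * (2 * m * k * sA m k H * g) ^ (r - J.card)) < 1) :
    ∃ u : Fin k → Fin m → ℝ, (∀ i j, 0 ≤ u i j ∧ u i j ≤ 1) ∧
      ∀ z ∈ Γ, z ≠ 0 → g * lam ≤ lvl H (j + 1) (ξ + mesh m k H j • ext u) z := by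
  obtain ⟨T, hT, hT'⟩ := hsum
  have h1 := hA.two_le_k
  have h2 := hA.two_le_m
  obtain ⟨u, hu, hu'⟩ := exists_grid_step (by omega) (by omega)
    (inv_pos.mpr (pow_pos hA.sA_pos j)) (pow_pos hA.sB_pos j) hA.one_le_sA hA.sB_pos hg hlam hgB ξ Γ
    hΓ r T J hJr ext hext hρ hrank hT hT'
  refine ⟨u, hu, fun z hz hz0 => ?_⟩
  have h3 : (sA m k H ^ (j + 1))⁻¹ = (sA m k H ^ j)⁻¹ / sA m k H := by
    rw [pow_succ, mul_inv, div_eq_mul_inv]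
  rw [lvl, h3, pow_succ]
  exact hu' z hz hz0

/-- The kernel of an integer functional. -/
def kerSub (w : Fin m ⊕ Fin k → ℤ) : AddSubgroup (Fin m ⊕ Fin k → ℤ) where
  carrier := {z | w ⬝ᵥ z = 0}
  add_mem' := fun {x y} (hx : w ⬝ᵥ x = 0) (hy : w ⬝ᵥ y = 0) => by
    simp [dotProduct_add, hx, hy]
  zero_mem' := by simp
  neg_mem' := fun {x} (hx : w ⬝ᵥ x = 0) => by simp [hx]

lemma finrank_kerSub_short_le (hA : Admissible m k H) {ρ₁ : ℝ} (j : ℕ)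
    (ξ : Matrix (Fin k) (Fin m) ℝ) (w z₀ : Fin m ⊕ Fin k → ℤ) (hz₀ : w ⬝ᵥ z₀ = 1) (hρ0 : 0 ≤ ρ₁)
    (hρ : (m + k).factorial * ρ₁ ^ (m + k - 1) < ldht H j ξ w) :
    finrank ℝ (Submodule.span ℝ ((fun z => flow (sA m k H ^ j)⁻¹ (sB m k H ^ j) ξ *ᵥ
      toReal z) '' {z | z ∈ kerSub w ∧ lvl H j ξ z ≤ ρ₁})) ≤ m + k - 2 := by
  have ha : 0 < (sA m k H ^ j)⁻¹ := inv_pos.mpr (pow_pos hA.sA_pos j)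
  have hb : 0 < sB m k H ^ j := pow_pos hA.sB_pos j
  have := finrank_span_ker_short_le _ (abs_det_flow_eq_one ha.le hb.le (hA.vol j) ξ) w z₀ _
    (dualv_vecMul_flow ha.ne' hb.ne' ξ w) hz₀ {z | z ∈ kerSub w ∧ lvl H j ξ z ≤ ρ₁} hρ0
    (fun z hz => by rw [norm_flow_mulVec ha.le hb.le]; exact hz.2) (fun z hz => hz.1)
    (by rw [ldht] at hρ; simpa [norm_dualv ha.le hb.le] using hρ)
  simpa using this

lemma abs_mesh_smul_le {c : ℝ} (hA : Admissible m k H) (j : ℕ)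
    (ξ U : Matrix (Fin k) (Fin m) ℝ) (hU : ∀ i l, |U i l| ≤ c) :
    Close (c * mesh m k H j) ξ (ξ + mesh m k H j • U) := fun i l => by
  have := hA.mesh_pos j
  simp only [Matrix.add_apply, Matrix.smul_apply, smul_eq_mul, add_sub_cancel_left, abs_mul,
    abs_of_pos this]
  rw [mul_comm]
  exact mul_le_mul_of_nonneg_right (hU i l) this.le

lemma abs_le_card_of_mem_unit (hk : 0 < k) {x : ℝ} (hx : 0 ≤ x ∧ x ≤ 1) : |x| ≤ k := by
  rw [abs_of_nonneg hx.1]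
  exact hx.2.trans (by exact_mod_cast hk)

/-- A step during which the relation `w` is kept. -/
lemma exists_descend_step (hA : Admissible m k H) {lam ρ₁ : ℝ} (hlam : 0 < lam) (j : ℕ)
    (ξ : Matrix (Fin k) (Fin m) ℝ) (w z₀ : Fin m ⊕ Fin k → ℤ) (hz₀ : w ⬝ᵥ z₀ = 1) (i₀ : Fin k)
    (hi₀ : |ypart w i₀| = ‖ypart w‖) (hy : 0 < ‖ypart w‖)
    (hlow : KerLow H lam j ξ w) (hρ : 2 * m * k * sA m k H * (H ^ m)⁻¹ * lam ≤ ρ₁)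
    (hdht : (m + k).factorial * ρ₁ ^ (m + k - 1) < ldht H j ξ w) :
    ∃ ξ' : Matrix (Fin k) (Fin m) ℝ, Close (k * mesh m k H j) ξ ξ' ∧ dualW ξ' w = dualW ξ w ∧
      KerLow H ((H ^ m)⁻¹ * lam) (j + 1) ξ' w := by
  classical
  have h1 := hA.two_le_k
  have h2 := hA.two_le_m
  have hH := hA.H_pos
  have hρ0 : 0 ≤ ρ₁ := le_trans (by have := hA.sA_pos; positivity) hρ
  have hyi : ypart w i₀ ≠ 0 := by rw [← abs_pos, hi₀]; exact hy
  have hg1 : (H ^ m)⁻¹ ≤ 1 := inv_le_one_of_one_le₀ (one_le_pow₀ hA.one_le_H)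
  set ext : (Fin k → Fin m → ℝ) → Matrix (Fin k) (Fin m) ℝ := fun u => Matrix.of fun i l =>
    if i = i₀ then -∑ i' ∈ Finset.univ.erase i₀, ypart w i' / ypart w i₀ * u i' l else u i l
    with hext
  have hcard : (Finset.univ.erase i₀ : Finset (Fin k)).card = k - 1 := by simp
  have hextb : ∀ u : Fin k → Fin m → ℝ, (∀ i j, 0 ≤ u i j ∧ u i j ≤ 1) →
      (∀ i ∈ (Finset.univ.erase i₀ : Finset (Fin k)), ∀ j, ext u i j = u i j) ∧
        ∀ i j, |ext u i j| ≤ k := by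
    intro u hu
    refine ⟨fun i hi l => by simp [hext, Finset.ne_of_mem_erase hi], fun i l => ?_⟩
    simp only [hext, Matrix.of_apply]
    split_ifs with hi
    · rw [abs_neg]
      calc |∑ i' ∈ Finset.univ.erase i₀, ypart w i' / ypart w i₀ * u i' l|
          ≤ ∑ i' ∈ Finset.univ.erase i₀, |ypart w i' / ypart w i₀ * u i' l| :=
            Finset.abs_sum_le_sum_abs _ _
        _ ≤ ∑ _i' ∈ Finset.univ.erase i₀, (1 : ℝ) := by
            refine Finset.sum_le_sum fun i' _ => ?_
            rw [abs_mul, abs_div, hi₀, abs_of_nonneg (hu i' l).1]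
            exact mul_le_one₀ (div_le_one_of_le₀ (norm_le_pi_norm (ypart w) i') hy.le)
              (hu i' l).1 (hu i' l).2
        _ ≤ k := by
            rw [Finset.sum_const, hcard, nsmul_eq_mul, mul_one]
            exact_mod_cast Nat.sub_le k 1
    · exact abs_le_card_of_mem_unit (by omega) (hu i l)
  obtain ⟨u, hu, hu'⟩ := exists_level_step hA (g := (H ^ m)⁻¹) (by positivity) hlam
    (by linarith [hA.four_le_sB]) j ξ (kerSub w) (fun z hz hz0 => hlow z hz0 hz) (m + k - 2)
    (Finset.univ.erase i₀) (by rw [hcard]; omega) ext hextb hρ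
    (finrank_kerSub_short_le hA j ξ w z₀ hz₀ hρ0 hdht)
    (by
      rw [hcard]
      have : m + k - 2 - (k - 1) = m - 1 := by omega
      rw [this]
      exact hA.descend)
  refine ⟨_, abs_mesh_smul_le hA j ξ (ext u) (hextb u hu).2, ?_, fun z hz hwz => hu' z hwz hz⟩
  rw [dualW_add, Matrix.vecMul_smul]
  have : ypart w ᵥ* ext u = 0 := by
    ext l
    simp only [Matrix.vecMul, dotProduct, Pi.zero_apply]
    rw [← Finset.add_sum_erase _ _ (Finset.mem_univ i₀)]
    have h3 : ∀ i' ∈ Finset.univ.erase i₀, ypart w i' * ext u i' l = ypart w i' * u i' l :=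
      fun i' hi' => by simp [hext, Finset.ne_of_mem_erase hi']
    rw [Finset.sum_congr rfl h3]
    simp only [hext, Matrix.of_apply, if_true, mul_neg, Finset.mul_sum]
    rw [neg_add_eq_zero]
    refine Finset.sum_congr rfl fun i' _ => ?_
    field_simp
  rw [this, smul_zero, add_zero]

/-- A step during which the first minimum recovers. -/
lemma exists_ascend_step (hA : Admissible m k H) {lam ρ₁ : ℝ} (hlam : 0 < lam) (j : ℕ)
    (ξ : Matrix (Fin k) (Fin m) ℝ) (w z₀ : Fin m ⊕ Fin k → ℤ) (hz₀ : w ⬝ᵥ z₀ = 1)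
    (hlow : KerLow H lam j ξ w) (hρ : 2 * m * k * sA m k H * H ^ k * lam ≤ ρ₁)
    (hdht : (m + k).factorial * ρ₁ ^ (m + k - 1) < ldht H j ξ w) :
    ∃ ξ' : Matrix (Fin k) (Fin m) ℝ, Close (mesh m k H j) ξ ξ' ∧
      KerLow H (H ^ k * lam) (j + 1) ξ' w := by
  have h1 := hA.two_le_k
  have h2 := hA.two_le_m
  have hH := hA.H_pos
  have hρ0 : 0 ≤ ρ₁ := le_trans (by have := hA.sA_pos; positivity) hρ
  obtain ⟨u, hu, hu'⟩ := exists_level_step hA (g := H ^ k) (by positivity) hlam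
    (hA.two_mul_pow_le_sB) j ξ (kerSub w) (fun z hz hz0 => hlow z hz0 hz) (m + k - 2)
    Finset.univ (by simp; omega) Matrix.of
    (fun u hu => ⟨fun _ _ _ => rfl, fun i l => abs_le_card_of_mem_unit (by omega) (hu i l)⟩) hρ
    (finrank_kerSub_short_le hA j ξ w z₀ hz₀ hρ0 hdht)
    (by
      have : m + k - 2 - k = m - 2 := by omega
      rw [Finset.card_fin, this]
      exact hA.ascend)
  refine ⟨_, (abs_mesh_smul_le (c := 1) hA j ξ (Matrix.of u) fun i l => ?_).mono (by simp),
    fun z hz hwz => hu' z hwz hz⟩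
  rw [Matrix.of_apply, abs_of_nonneg (hu i l).1]
  exact (hu i l).2

/-- The first minimum a generic step can preserve. -/
noncomputable def genericLow (m k : ℕ) (H : ℝ) : ℝ :=
  ((m + k).factorial + 1 : ℝ)⁻¹ / (4 * m * k * sA m k H)

lemma genericLow_pos (hA : Admissible m k H) : 0 < genericLow m k H := by
  have h1 : (0 : ℝ) < k := by have := hA.two_le_k; exact_mod_cast (by omega : 0 < k)
  have h2 : (0 : ℝ) < m := by have := hA.two_le_m; exact_mod_cast (by omega : 0 < m)
  have := hA.sA_pos
  rw [genericLow]; positivity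

lemma genericLow_le_one (hA : Admissible m k H) : genericLow m k H ≤ 1 := by
  have h1 : (1 : ℝ) ≤ k := by have := hA.two_le_k; exact_mod_cast (by omega : 1 ≤ k)
  have h2 : (1 : ℝ) ≤ m := by have := hA.two_le_m; exact_mod_cast (by omega : 1 ≤ m)
  have h3 := hA.one_le_sA
  have h4 : (0 : ℝ) ≤ (m + k).factorial := Nat.cast_nonneg _
  have h5 : 1 ≤ 4 * m * k * sA m k H := by
    have : (1 : ℝ) ≤ m * k := by nlinarith
    nlinarith
  rw [genericLow, div_le_one (by linarith)]
  exact (inv_le_one_of_one_le₀ (by linarith)).trans h5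

/-- A step without relation. -/
lemma exists_generic_step (hA : Admissible m k H) {lam : ℝ} (hlam : 0 < lam)
    (hlam' : lam ≤ genericLow m k H) (j : ℕ) (ξ : Matrix (Fin k) (Fin m) ℝ)
    (hlow : ∀ z : Fin m ⊕ Fin k → ℤ, z ≠ 0 → lam ≤ lvl H j ξ z) :
    ∃ ξ' : Matrix (Fin k) (Fin m) ℝ, Close (mesh m k H j) ξ ξ' ∧
      ∀ z : Fin m ⊕ Fin k → ℤ, z ≠ 0 → 2 * lam ≤ lvl H (j + 1) ξ' z := by
  have h1 := hA.two_le_k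
  have h2 := hA.two_le_m
  have hk : (0 : ℝ) < k := by exact_mod_cast (by omega : 0 < k)
  have hm : (0 : ℝ) < m := by exact_mod_cast (by omega : 0 < m)
  have hs := hA.sA_pos
  have ha : 0 < (sA m k H ^ j)⁻¹ := inv_pos.mpr (pow_pos hA.sA_pos j)
  have hb : 0 < sB m k H ^ j := pow_pos hA.sB_pos j
  have hf : (0 : ℝ) < (m + k).factorial + 1 := by positivity
  have hrank := finrank_span_short_le _ (abs_det_flow_eq_one ha.le hb.le (hA.vol j) ξ)
    {z | z ∈ (⊤ : AddSubgroup (Fin m ⊕ Fin k → ℤ)) ∧ lvl H j ξ z ≤ ((m + k).factorial + 1 : ℝ)⁻¹}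
    (ρ := ((m + k).factorial + 1 : ℝ)⁻¹)
    (fun z hz => by rw [norm_flow_mulVec ha.le hb.le]; exact hz.2) (by
      rw [Fintype.card_sum, Fintype.card_fin, Fintype.card_fin]
      calc ((m + k).factorial : ℝ) * ((m + k).factorial + 1 : ℝ)⁻¹ ^ (m + k)
          ≤ (m + k).factorial * ((m + k).factorial + 1 : ℝ)⁻¹ := by
            gcongr
            refine pow_le_of_le_one (by positivity) (inv_le_one_of_one_le₀ ?_) (by omega)
            linarith [Nat.cast_nonneg (α := ℝ) (m + k).factorial]
        _ < 1 := by rw [← div_eq_mul_inv, div_lt_one hf]; linarith)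
  rw [Fintype.card_sum, Fintype.card_fin, Fintype.card_fin] at hrank
  obtain ⟨u, hu, hu'⟩ := exists_level_step hA (g := 2) (by norm_num) hlam
    (by linarith [hA.four_le_sB]) j ξ ⊤ (fun z _ hz0 => hlow z hz0) (m + k - 1)
    Finset.univ (by simp; omega) Matrix.of
    (fun u hu => ⟨fun _ _ _ => rfl, fun i l => abs_le_card_of_mem_unit (by omega) (hu i l)⟩)
    (by
      rw [genericLow, le_div_iff₀ (by positivity)] at hlam'
      linarith) hrank
    (by
      have : m + k - 1 - k = m - 1 := by omega
      rw [Finset.card_fin, this]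
      exact hA.generic)
  refine ⟨_, (abs_mesh_smul_le (c := 1) hA j ξ (Matrix.of u) fun i l => ?_).mono (by simp),
    fun z hz => hu' z trivial hz⟩
  rw [Matrix.of_apply, abs_of_nonneg (hu i l).1]
  exact (hu i l).2

end Steps

section Block

variable {m k : ℕ} {H : ℝ}

/-- The functional `w` has height of order `H ^ (-e (m + k - 1))` and the integer vectors in its
kernel have height at least of order `H ^ (-e)`. -/
def RelState (H v C₁ c₂ : ℝ) (e j : ℕ) (ξ : Matrix (Fin k) (Fin m) ℝ)
    (w : Fin m ⊕ Fin k → ℤ) : Prop :=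
  v * (H ^ (e * (m + k - 1)))⁻¹ ≤ ldht H j ξ w ∧ ldht H j ξ w ≤ C₁ * (H ^ (e * (m + k - 1)))⁻¹ ∧
    KerLow H (c₂ * (H ^ e)⁻¹) j ξ w

lemma RelState.bd (hA : Admissible m k H) {v C₁ c₂ c : ℝ} {e j : ℕ} {ξ : Matrix (Fin k) (Fin m) ℝ}
    {w : Fin m ⊕ Fin k → ℤ} (h : RelState H v C₁ c₂ e j ξ w) (hC : 0 < C₁) (hw : w ≠ 0)
    (hc : c ≤ c₂) (hc' : c ≤ 1 / ((m + k) * C₁)) : Bd H c ((m + k) * (C₁ + 1)) e j ξ := by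
  have hH := hA.H_pos
  have h1 := hA.two_le_k
  have h2 := hA.two_le_m
  have ha : 0 < (sA m k H ^ j)⁻¹ := inv_pos.mpr (pow_pos hA.sA_pos j)
  have hb : 0 < sB m k H ^ j := pow_pos hA.sB_pos j
  have hd : (0 : ℝ) < m + k := by exact_mod_cast (by omega : 0 < m + k)
  obtain ⟨-, h3, h4⟩ := h
  refine ⟨fun z hz => ?_, ?_⟩
  · by_cases hwz : w ⬝ᵥ z = 0
    · exact le_trans (by gcongr) (h4 z hz hwz)
    · have h5 : (1 : ℝ) ≤ |((w ⬝ᵥ z : ℤ) : ℝ)| := by exact_mod_cast Int.one_le_abs hwz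
      have h6 := h5.trans (abs_dotProduct_le ha hb ξ w z)
      change 1 ≤ (m + k) * (ldht H j ξ w * lvl H j ξ z) at h6
      have hl : 0 ≤ lvl H j ξ z := le_trans (by positivity) (le_max_left _ _)
      have h7 : 1 ≤ (m + k) * C₁ * ((H ^ (e * (m + k - 1)))⁻¹ * lvl H j ξ z) := by
        refine h6.trans ?_
        calc (m + k) * (ldht H j ξ w * lvl H j ξ z)
            ≤ (m + k) * (C₁ * (H ^ (e * (m + k - 1)))⁻¹ * lvl H j ξ z) := by gcongr
          _ = _ := by ring
      have h8 : (H ^ (e * (m + k - 1)))⁻¹ ≤ 1 := inv_le_one_of_one_le₀ (one_le_pow₀ hA.one_le_H)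
      have h9 : (H ^ e)⁻¹ ≤ 1 := inv_le_one_of_one_le₀ (one_le_pow₀ hA.one_le_H)
      calc c * (H ^ e)⁻¹ ≤ 1 / ((m + k) * C₁) * 1 := by gcongr
        _ ≤ (H ^ (e * (m + k - 1)))⁻¹ * lvl H j ξ z := by
          rw [mul_one, div_le_iff₀ (by positivity)]; linarith
        _ ≤ 1 * lvl H j ξ z := by gcongr
        _ = lvl H j ξ z := one_mul _
  · have hlt : ldht H j ξ w < ((C₁ + 1) * (H ^ e)⁻¹) ^ (m + k - 1) := by
      refine h3.trans_lt ?_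
      rw [mul_pow, inv_pow, ← pow_mul]
      gcongr
      exact (lt_add_one C₁).trans_le (le_self_pow₀ (by linarith) (by omega))
    obtain ⟨z, hz, -, hz'⟩ := exists_hgt_le_of_dht_lt ha hb (hA.vol j) ξ hw (by positivity) hlt
    exact ⟨z, hz, hz'.trans_eq (by ring)⟩

lemma RelState.lt_ldht (hA : Admissible m k H) {v C₁ c₂ : ℝ} {e j : ℕ}
    {ξ : Matrix (Fin k) (Fin m) ℝ} {w : Fin m ⊕ Fin k → ℤ} (h : RelState H v C₁ c₂ e j ξ w)
    (hv : 0 < v) (hv1 : v ≤ 1) :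
    (m + k).factorial * (v / ((m + k).factorial + 1) * (H ^ e)⁻¹) ^ (m + k - 1) < ldht H j ξ w := by
  have hH := hA.H_pos
  have h1 := hA.two_le_k
  refine lt_of_lt_of_le ?_ h.1
  rw [mul_pow, inv_pow, ← pow_mul, ← mul_assoc]
  have hf : (0 : ℝ) ≤ (m + k).factorial := Nat.cast_nonneg _
  gcongr
  calc ((m + k).factorial : ℝ) * (v / ((m + k).factorial + 1)) ^ (m + k - 1)
      ≤ (m + k).factorial * (v / ((m + k).factorial + 1)) := by
        gcongr
        refine pow_le_of_le_one (by positivity) ?_ (by omega)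
        rw [div_le_one (by positivity)]; linarith
    _ < v := by
        rw [mul_div_assoc', div_lt_iff₀ (by positivity)]; linarith

lemma ldht_eq_of_dualW_eq_zero (hA : Admissible m k H) {J i : ℕ}
    {ξ : Matrix (Fin k) (Fin m) ℝ} {w : Fin m ⊕ Fin k → ℤ} (h : dualW ξ w = 0) :
    ldht H (J + i) ξ w =
      (sB m k H ^ J)⁻¹ * ‖ypart w‖ * (H ^ (m * i * (m + k - 1)))⁻¹ := by
  have hb : 0 < sB m k H ^ (J + i) := pow_pos hA.sB_pos _
  rw [ldht, dht, h, norm_zero, mul_zero, max_eq_right (by positivity), pow_add, mul_inv]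
  have : sB m k H ^ i = H ^ (m * i * (m + k - 1)) := by
    rw [sB, ← pow_mul]; congr 1; ring
  rw [this]; ring

lemma sA_mul_mesh_mul (hA : Admissible m k H) {J p i : ℕ} (hi : i ≤ m * p) (y : ℝ) :
    sA m k H ^ (J + k * p + i) * (mesh m k H (J + k * p) * y) =
      (sB m k H ^ J)⁻¹ * y * (H ^ (k * (m * p - i) * (m + k - 1)))⁻¹ := by
  have hH := hA.H_pos
  have h1 := hA.sA_pos
  have h2 := hA.sB_pos
  have h3 : sB m k H ^ (k * p) = sA m k H ^ i * H ^ (k * (m * p - i) * (m + k - 1)) := by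
    rw [sB, sA, ← pow_mul, ← pow_mul, ← pow_add]; congr 1
    obtain ⟨t, ht⟩ := Nat.exists_eq_add_of_le hi
    have : m * p - i = t := by omega
    rw [this]
    calc m * (m + k - 1) * (k * p) = k * (m + k - 1) * (m * p) := by ring
      _ = _ := by rw [ht]; ring
  rw [mesh, pow_add _ _ i, pow_add (sB m k H), h3]
  field_simp

/-- During the second half of a block the size of the functional comes from its first part. -/
lemma relState_of_norm_dualW (hA : Admissible m k H) {J p i : ℕ} (hi : i ≤ m * p)
    {ξ : Matrix (Fin k) (Fin m) ℝ} {w : Fin m ⊕ Fin k → ℤ} {v V c : ℝ}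
    (hv : v ≤ (sB m k H ^ J)⁻¹ * ‖ypart w‖) (hV : (sB m k H ^ J)⁻¹ * ‖ypart w‖ ≤ V)
    (h1 : mesh m k H (J + k * p) * ‖ypart w‖ ≤ ‖dualW ξ w‖)
    (h2 : ‖dualW ξ w‖ ≤ 8 * k * (mesh m k H (J + k * p) * ‖ypart w‖))
    (h3 : KerLow H (c * (H ^ (k * (m * p - i)))⁻¹) (J + k * p + i) ξ w) :
    RelState H v (8 * k * V) c (k * (m * p - i)) (J + k * p + i) ξ w := by
  have hH := hA.H_pos
  have hsA := hA.sA_pos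
  have hsB := hA.sB_pos
  have hk : (1 : ℝ) ≤ k := by have := hA.two_le_k; exact_mod_cast (by omega : 1 ≤ k)
  have hkey := sA_mul_mesh_mul hA (J := J) hi ‖ypart w‖
  have hle : (sB m k H ^ (J + k * p + i))⁻¹ * ‖ypart w‖ ≤
      sA m k H ^ (J + k * p + i) * (mesh m k H (J + k * p) * ‖ypart w‖) := by
    rw [mesh, pow_add _ _ i, pow_add _ _ i]
    have e1 : sA m k H ^ (J + k * p) * sA m k H ^ i * ((sA m k H ^ (J + k * p))⁻¹ /
        sB m k H ^ (J + k * p) * ‖ypart w‖) =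
        sA m k H ^ i * ((sB m k H ^ (J + k * p))⁻¹ * ‖ypart w‖) := by field_simp
    rw [e1, mul_inv, mul_assoc, mul_left_comm]
    have e2 : (sB m k H ^ i)⁻¹ ≤ 1 := inv_le_one_of_one_le₀ (one_le_pow₀ hA.one_le_sB)
    have e3 : 1 ≤ sA m k H ^ i := one_le_pow₀ hA.one_le_sA
    gcongr
    exact e2.trans e3
  rw [RelState, ldht, dht, inv_inv]
  refine ⟨le_trans ?_ (le_max_left _ _), max_le ?_ (hle.trans ?_), h3⟩
  · calc v * (H ^ (k * (m * p - i) * (m + k - 1)))⁻¹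
        ≤ (sB m k H ^ J)⁻¹ * ‖ypart w‖ * (H ^ (k * (m * p - i) * (m + k - 1)))⁻¹ := by gcongr
      _ = _ := hkey.symm
      _ ≤ _ := by gcongr
  · calc sA m k H ^ (J + k * p + i) * ‖dualW ξ w‖
        ≤ sA m k H ^ (J + k * p + i) * (8 * k * (mesh m k H (J + k * p) * ‖ypart w‖)) := by gcongr
      _ = 8 * k * ((sB m k H ^ J)⁻¹ * ‖ypart w‖ * (H ^ (k * (m * p - i) * (m + k - 1)))⁻¹) := by
          rw [← hkey]; ring
      _ ≤ 8 * k * (V * (H ^ (k * (m * p - i) * (m + k - 1)))⁻¹) := by gcongr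
      _ = _ := by ring
  · rw [hkey]
    have hV0 : 0 ≤ V := le_trans (by positivity) hV
    calc (sB m k H ^ J)⁻¹ * ‖ypart w‖ * (H ^ (k * (m * p - i) * (m + k - 1)))⁻¹
        ≤ V * (H ^ (k * (m * p - i) * (m + k - 1)))⁻¹ := by gcongr
      _ ≤ (8 * k * V) * (H ^ (k * (m * p - i) * (m + k - 1)))⁻¹ := by
          gcongr; nlinarith

lemma norm_vecMul_le (y : Fin k → ℝ) (U : Matrix (Fin k) (Fin m) ℝ) {ε : ℝ} (hε : 0 ≤ ε)
    (hU : ∀ i l, |U i l| ≤ ε) : ‖y ᵥ* U‖ ≤ k * ε * ‖y‖ := by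
  rw [← Matrix.mulVec_transpose]
  refine (pi_norm_le_iff_of_nonneg (by positivity)).mpr fun l => ?_
  calc ‖(Uᵀ *ᵥ y) l‖ ≤ ∑ i, ‖U i l * y i‖ := norm_sum_le Finset.univ fun i => U i l * y i
    _ ≤ ∑ _i : Fin k, ε * ‖y‖ := by
        refine Finset.sum_le_sum fun i _ => ?_
        rw [norm_mul]
        exact mul_le_mul (hU i l) (norm_le_pi_norm y i) (norm_nonneg _) hε
    _ = _ := by simp; ring

lemma norm_dualW_sub_le {ξ ξ' : Matrix (Fin k) (Fin m) ℝ} (w : Fin m ⊕ Fin k → ℤ) {ε : ℝ}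
    (hε : 0 ≤ ε) (h : Close ε ξ ξ') : ‖dualW ξ' w - dualW ξ w‖ ≤ k * ε * ‖ypart w‖ := by
  have : dualW ξ' w = dualW ξ w + ypart w ᵥ* (ξ' - ξ) := by
    rw [← dualW_add]; simp
  rw [this, add_sub_cancel_left]
  exact norm_vecMul_le _ _ hε fun i l => by simpa using h i l

end Block

section Phases

variable {m k : ℕ} {H : ℝ}

lemma exists_descend_path (hA : Admissible m k H) {v C₁ c₂ c : ℝ} {J : ℕ} (l : ℕ)
    {w z₀ : Fin m ⊕ Fin k → ℤ} (hz₀ : w ⬝ᵥ z₀ = 1) {i₀ : Fin k}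
    (hi₀ : |ypart w i₀| = ‖ypart w‖) (hy : 0 < ‖ypart w‖) (hv : 0 < v) (hv1 : v ≤ 1)
    (hvy : v ≤ (sB m k H ^ J)⁻¹ * ‖ypart w‖) (hVy : (sB m k H ^ J)⁻¹ * ‖ypart w‖ ≤ C₁)
    (hc₂ : 0 < c₂) (hcρ : 2 * m * k * sA m k H * H ^ k * c₂ ≤ v / ((m + k).factorial + 1))
    (hc : c ≤ c₂) (hc' : c ≤ 1 / ((m + k) * C₁)) {ξ η : Matrix (Fin k) (Fin m) ℝ}
    (hη : Close (k * mesh m k H J) ξ η) (hW : dualW η w = 0) (hlow : KerLow H c₂ J η w) :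
    ∃ ξ' η' : Matrix (Fin k) (Fin m) ℝ,
      Path H c ((m + k) * (C₁ + 1)) (fun j => m * (j - J)) J (J + l) ξ ξ' ∧
      Close (k * mesh m k H (J + l)) ξ' η' ∧ dualW η' w = 0 ∧
      KerLow H (c₂ * (H ^ (m * l))⁻¹) (J + l) η' w := by
  have hH := hA.H_pos
  have hw : w ≠ 0 := by rintro rfl; simp at hz₀
  have hk : (0 : ℝ) ≤ k := Nat.cast_nonneg k
  have hrel : ∀ i η, dualW η w = 0 → KerLow H (c₂ * (H ^ (m * i))⁻¹) (J + i) η w →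
      RelState H v C₁ c₂ (m * i) (J + i) η w := fun i η h1 h2 => by
    refine ⟨?_, ?_, h2⟩
    · rw [ldht_eq_of_dualW_eq_zero hA h1]; gcongr
    · rw [ldht_eq_of_dualW_eq_zero hA h1]; gcongr
  obtain ⟨ξ', η', hp, hc1, ⟨hs1, hs2⟩, -⟩ := exists_path_of_step hA
    (c := c) (C := (m + k) * (C₁ + 1)) (E := fun j => m * (j - J)) (J := J) hk (by linarith)
    (fun i η => dualW η w = 0 ∧ KerLow H (c₂ * (H ^ (m * i))⁻¹) (J + i) η w) l
    (fun i _ η hη => by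
      have hr := hrel i η hη.1 hη.2
      have hC : 0 < C₁ := hv.trans_le (hvy.trans hVy)
      refine ⟨by simpa using hr.bd hA hC hw hc hc', ?_⟩
      obtain ⟨ξ', h1, h2, h3⟩ := exists_descend_step hA (lam := c₂ * (H ^ (m * i))⁻¹)
        (by positivity) (J + i) η w z₀ hz₀ i₀ hi₀ hy hη.2 (by
          have h4 : (H ^ m)⁻¹ ≤ H ^ k := (inv_le_one_of_one_le₀ (one_le_pow₀ hA.one_le_H)).trans
            (one_le_pow₀ hA.one_le_H)
          have h5 := hA.sA_pos
          calc 2 * m * k * sA m k H * (H ^ m)⁻¹ * (c₂ * (H ^ (m * i))⁻¹)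
              ≤ 2 * m * k * sA m k H * H ^ k * (c₂ * (H ^ (m * i))⁻¹) := by gcongr
            _ = 2 * m * k * sA m k H * H ^ k * c₂ * (H ^ (m * i))⁻¹ := by ring
            _ ≤ _ := by gcongr) (hr.lt_ldht hA hv hv1)
      refine ⟨ξ', h1, h2.trans hη.1, ?_⟩
      have h6 : c₂ * (H ^ (m * (i + 1)))⁻¹ = (H ^ m)⁻¹ * (c₂ * (H ^ (m * i))⁻¹) := by
        rw [mul_add, pow_add, mul_inv]; ring
      rw [h6]
      exact h3)
    hη ⟨hW, by simpa using hlow⟩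
  exact ⟨ξ', η', hp, hc1, hs1, hs2⟩

lemma exists_ascend_path (hA : Admissible m k H) {v V c₂ c : ℝ} {J p : ℕ}
    {w z₀ : Fin m ⊕ Fin k → ℤ} (hz₀ : w ⬝ᵥ z₀ = 1) {i₀ : Fin k}
    (hi₀ : |ypart w i₀| = ‖ypart w‖) (hv : 0 < v) (hv1 : v ≤ 1)
    (hvy : v ≤ (sB m k H ^ J)⁻¹ * ‖ypart w‖) (hVy : (sB m k H ^ J)⁻¹ * ‖ypart w‖ ≤ V)
    (hc₂ : 0 < c₂) (hcρ : 2 * m * k * sA m k H * H ^ k * c₂ ≤ v / ((m + k).factorial + 1))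
    (hc : c ≤ c₂ / (1 + m * (4 * k))) (hc' : c ≤ 1 / ((m + k) * (8 * k * V)))
    {ξ η : Matrix (Fin k) (Fin m) ℝ}
    (hη : Close (k * mesh m k H (J + k * p)) ξ η) (hW : dualW η w = 0)
    (hlow : KerLow H (c₂ * (H ^ (m * (k * p)))⁻¹) (J + k * p) η w) :
    ∃ ξ' η' : Matrix (Fin k) (Fin m) ℝ,
      Path H c ((m + k) * (8 * k * V + 1)) (fun j => k * (m * p - (j - (J + k * p))))
        (J + k * p) (J + k * p + m * p) ξ ξ' ∧
      Close (5 * k * mesh m k H (J + k * p + m * p)) ξ' η' ∧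
      ∀ z, z ≠ 0 → c ≤ lvl H (J + k * p + m * p) η' z := by
  have hH := hA.H_pos
  have hw : w ≠ 0 := by rintro rfl; simp at hz₀
  have hk1 : (1 : ℝ) ≤ k := by have := hA.two_le_k; exact_mod_cast (by omega : 1 ≤ k)
  have hk : (0 : ℝ) ≤ k := by linarith
  have hV : 0 < V := hv.trans_le (hvy.trans hVy)
  set β := ‖ypart w‖ with hβ
  have hβ0 : 0 ≤ β := norm_nonneg _
  set J₁ := J + k * p with hJ₁
  set μ := mesh m k H J₁ with hμ
  have hμ0 : 0 < μ := hA.mesh_pos J₁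
  set c₃ := c₂ / (1 + m * (4 * k)) with hc₃
  have hfac : (1 : ℝ) ≤ 1 + m * (4 * k) := by
    have : (0 : ℝ) ≤ m * (4 * k) := by positivity
    linarith
  have hc₃0 : 0 < c₃ := by positivity
  have hc₃2 : c₃ ≤ c₂ := div_le_self hc₂.le hfac
  have hmesh : ∀ i, mesh m k H (J₁ + i) ≤ μ := fun i => by
    induction i with
    | zero => exact le_rfl
    | succ i ih =>
      have := hA.mesh_succ (J₁ + i)
      have := hA.mesh_pos (J₁ + i + 1)
      rw [← add_assoc]; linarith
  set State : ℕ → Matrix (Fin k) (Fin m) ℝ → Prop := fun i η =>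
    KerLow H (c₃ * (H ^ (k * (m * p - i)))⁻¹) (J₁ + i) η w ∧
    2 * k * (μ * β) + 2 * k * (mesh m k H (J₁ + i) * β) ≤ ‖dualW η w‖ ∧
    ‖dualW η w‖ ≤ 8 * k * (μ * β) - 2 * k * (mesh m k H (J₁ + i) * β) with hState
  have hrel : ∀ i ≤ m * p, ∀ η, State i η →
      RelState H v (8 * k * V) c₃ (k * (m * p - i)) (J₁ + i) η w := by
    rintro i hi η ⟨h1, h2, h3⟩
    have h4 : 0 ≤ 2 * k * (mesh m k H (J₁ + i) * β) := by
      have := hA.mesh_pos (J₁ + i); positivity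
    have h5 : 0 ≤ μ * β := by positivity
    exact relState_of_norm_dualW hA hi hvy hVy (by nlinarith) (by linarith) h1
  have : Nonempty (Fin m) := ⟨⟨0, by have := hA.two_le_m; omega⟩⟩
  set l₀ : Fin m := Classical.arbitrary _
  set U : Matrix (Fin k) (Fin m) ℝ := Matrix.of fun i l => if i = i₀ ∧ l = l₀ then 4 * k else 0
    with hU
  have hUb : ∀ i l, |U i l| ≤ 4 * k := fun i l => by
    simp only [hU, Matrix.of_apply]
    split_ifs
    · rw [abs_of_nonneg (by positivity)]
    · simp
  have hclose : Close (4 * k * mesh m k H J₁) η (η + μ • U) := abs_mesh_smul_le hA J₁ η U hUb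
  have hnorm : ‖dualW (η + μ • U) w‖ = 4 * k * (μ * β) := by
    rw [dualW_add, hW, zero_add, Matrix.vecMul_smul]
    have : ypart w ᵥ* U = Pi.single l₀ (4 * k * ypart w i₀) := by
      ext l
      simp only [Matrix.vecMul, dotProduct, hU, Matrix.of_apply]
      rw [Finset.sum_eq_single i₀ (fun i _ hi => by simp [hi]) (by simp)]
      by_cases hl : l = l₀
      · subst hl; simp; ring
      · simp [hl]
    rw [this, norm_smul, Real.norm_of_nonneg hμ0.le, Pi.norm_single, norm_mul, Real.norm_eq_abs,
      Real.norm_eq_abs, hi₀, abs_of_nonneg (by positivity)]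
    ring
  have h0 : State 0 (η + μ • U) := by
    refine ⟨fun z hz hwz => ?_, ?_, ?_⟩
    · have h1 := hlow z hz hwz
      have h2 := hA.lvl_pos_le (by positivity) hclose.symm z
      have e : k * (m * p - 0) = m * (k * p) := by rw [Nat.sub_zero]; ring
      rw [e, hc₃, div_mul_eq_mul_div, div_le_iff₀ (by positivity)]
      rw [add_zero]
      linarith
    · rw [hnorm, add_zero]; linarith
    · rw [hnorm, add_zero]
      have : 0 ≤ k * (μ * β) := by positivity
      linarith
  obtain ⟨ξ', η', hp, hcl, hs, -⟩ := exists_path_of_step hA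
    (c := c) (C := (m + k) * (8 * k * V + 1)) (E := fun j => k * (m * p - (j - J₁))) (J := J₁)
    (R := 5 * k) (by positivity) (by linarith) State (m * p)
    (fun i hi η hη => by
      have hr := hrel i hi.le η hη
      refine ⟨by simpa using hr.bd hA (by positivity) hw hc hc', ?_⟩
      obtain ⟨ξ', h1, h2⟩ := exists_ascend_step hA
        (lam := c₃ * (H ^ (k * (m * p - i)))⁻¹)
        (by positivity) (J₁ + i) η w z₀ hz₀ hη.1 (by
          have h5 := hA.sA_pos
          calc 2 * m * k * sA m k H * H ^ k * (c₃ * (H ^ (k * (m * p - i)))⁻¹)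
              ≤ 2 * m * k * sA m k H * H ^ k * (c₂ * (H ^ (k * (m * p - i)))⁻¹) := by gcongr
            _ = 2 * m * k * sA m k H * H ^ k * c₂ * (H ^ (k * (m * p - i)))⁻¹ := by ring
            _ ≤ _ := by gcongr) (hr.lt_ldht hA hv hv1)
      have hmp := hA.mesh_pos (J₁ + i)
      refine ⟨ξ', h1.mono (by nlinarith), ?_, ?_⟩
      · have h6 : c₃ * (H ^ (k * (m * p - (i + 1))))⁻¹ =
            H ^ k * (c₃ * (H ^ (k * (m * p - i)))⁻¹) := by
          obtain ⟨t, ht⟩ := Nat.exists_eq_add_of_lt hi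
          have e1 : m * p - i = t + 1 := by omega
          have e2 : m * p - (i + 1) = t := by omega
          rw [e1, e2, mul_add, pow_add, mul_one]
          field_simp
        rw [h6]
        exact h2
      · have h3 := norm_dualW_sub_le w hmp.le h1
        have h4 := hA.mesh_succ (J₁ + i)
        have h5 := abs_le.mp ((abs_norm_sub_norm_le (dualW ξ' w) (dualW η w)).trans h3)
        have h6 := hη.2.1
        have h7 := hη.2.2
        have h8 : 2 * k * (2 * mesh m k H (J₁ + i + 1) * β) ≤
            2 * k * (mesh m k H (J₁ + i) * β) := by gcongr
        have h9 : k * mesh m k H (J₁ + i) * ‖ypart w‖ = k * (mesh m k H (J₁ + i) * β) := by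
          rw [← hβ]; ring
        rw [h9] at h5
        have h10 : 0 ≤ k * (mesh m k H (J₁ + i) * β) := by positivity
        rw [← add_assoc]
        constructor <;> nlinarith [h5.1, h5.2])
    ((hη.trans hclose).mono (by linarith)) h0
  refine ⟨ξ', η', hp, hcl, fun z hz => ?_⟩
  have := ((hrel _ le_rfl η' hs).bd hA (c := c) (by positivity) hw hc hc').1 z hz
  simpa using this

/-- No integer vector is short at level `j`. -/
def Generic (H : ℝ) (j : ℕ) (ξ : Matrix (Fin k) (Fin m) ℝ) : Prop :=
  ∀ z : Fin m ⊕ Fin k → ℤ, z ≠ 0 → genericLow m k H ≤ lvl H j ξ z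

lemma exists_generic_path (hA : Admissible m k H) {c C : ℝ} (hc : 0 < c)
    (hc' : c ≤ genericLow m k H) (hC : 2 ≤ C) {p₀ : ℕ} (hp₀ : genericLow m k H ≤ 2 ^ p₀ * c)
    (hp₀' : p₀ ≠ 0) {E : ℕ → ℕ} {J : ℕ} (hE : ∀ i < p₀, E (J + i) = 0)
    {ξ η : Matrix (Fin k) (Fin m) ℝ}
    (hη : Close (5 * k * mesh m k H J) ξ η) (hlow : ∀ z, z ≠ 0 → c ≤ lvl H J η z) :
    ∃ ξ' : Matrix (Fin k) (Fin m) ℝ, Path H c C E J (J + p₀) ξ ξ' ∧ Generic H (J + p₀) ξ' := by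
  have hk1 : (1 : ℝ) ≤ k := by have := hA.two_le_k; exact_mod_cast (by omega : 1 ≤ k)
  have hg := genericLow_pos hA
  obtain ⟨ξ', η', hp, -, hs, he⟩ := exists_path_of_step hA
    (c := c) (C := C) (E := E) (J := J) (R := 5 * k) (by positivity) (by linarith)
    (fun i η => ∀ z : Fin m ⊕ Fin k → ℤ, z ≠ 0 →
      min (2 ^ i * c) (genericLow m k H) ≤ lvl H (J + i) η z) p₀
    (fun i hi η hη => by
      have h1 : (1 : ℝ) ≤ 2 ^ i := one_le_pow₀ (by norm_num)
      refine ⟨?_, ?_⟩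
      · rw [hE i hi]
        refine ⟨fun z hz => le_trans ?_ (hη z hz), ?_⟩
        · rw [pow_zero, inv_one, mul_one]
          exact le_min (by nlinarith) hc'
        · obtain ⟨z, hz, hz'⟩ := hA.exists_lvl_lt_two (J + i) η
          exact ⟨z, hz, hz'.trans (by simpa using hC)⟩
      · obtain ⟨ξ', h2, h3⟩ := exists_generic_step hA (lam := min (2 ^ i * c) (genericLow m k H))
          (lt_min (by positivity) hg) (min_le_right _ _) (J + i) η hη
        have hmp := hA.mesh_pos (J + i)
        refine ⟨ξ', h2.mono (by nlinarith), fun z hz => le_trans ?_ (h3 z hz)⟩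
        rw [pow_succ, mul_min_of_nonneg _ _ (by norm_num)]
        exact min_le_min (by linarith) (by linarith))
    hη (fun z hz => by simpa using Or.inl (hlow z hz))
  refine ⟨ξ', hp, fun z hz => ?_⟩
  rw [he hp₀']
  have := hs z hz
  rwa [min_eq_right hp₀] at this

/-- The depth of the first minimum along one block. -/
def blockE (m k p i : ℕ) : ℕ := if i ≤ k * p then m * i else k * ((k + m) * p - i)

/-- The first minimum can be made small and can recover again. -/
theorem exists_block (hA : Admissible m k H) : ∃ c C : ℝ, ∃ p₀ : ℕ, 0 < c ∧ 0 < C ∧ 0 < p₀ ∧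
    ∀ (p J : ℕ) (ξ : Matrix (Fin k) (Fin m) ℝ), Generic H J ξ →
      ∃ ξ' : Matrix (Fin k) (Fin m) ℝ, Generic H (J + (k + m) * p + p₀) ξ' ∧
        Path H c C (fun j => blockE m k p (j - J)) J (J + (k + m) * p + p₀) ξ ξ' := by
  have hk2 := hA.two_le_k
  have hm2 := hA.two_le_m
  have hk1 : (1 : ℝ) ≤ k := by exact_mod_cast (by omega : 1 ≤ k)
  have hm1 : (1 : ℝ) ≤ m := by exact_mod_cast (by omega : 1 ≤ m)
  have hg := genericLow_pos hA
  have hg1 := genericLow_le_one hA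
  have hH := hA.H_pos
  have hsA := hA.sA_pos
  set v : ℝ := (genericLow m k H / (2 * (m + k))) ^ (m + k - 1) with hv
  have hv0 : 0 < v := by positivity
  have hv1 : v ≤ 1 := by
    refine pow_le_one₀ (by positivity) ?_
    rw [div_le_one (by positivity)]; linarith
  set V : ℝ := (v ^ m)⁻¹ with hV
  have hV0 : 0 < V := by positivity
  set c₂ : ℝ := min (genericLow m k H / (1 + m * 1))
    (v / ((m + k).factorial + 1) / (2 * m * k * sA m k H * H ^ k)) with hc₂
  have hf : (0 : ℝ) < (m + k).factorial + 1 := by positivity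
  have hc₂0 : 0 < c₂ := by
    refine lt_min (by positivity) (div_pos (div_pos hv0 hf) ?_)
    have : (0 : ℝ) < m := by linarith
    positivity
  have hcρ : 2 * m * k * sA m k H * H ^ k * c₂ ≤ v / ((m + k).factorial + 1) := by
    have h1 : c₂ ≤ v / ((m + k).factorial + 1) / (2 * m * k * sA m k H * H ^ k) := min_le_right _ _
    rw [le_div_iff₀ (by have : (0 : ℝ) < m := by linarith
                        positivity)] at h1
    linarith
  set c : ℝ := min (c₂ / (1 + m * (4 * k))) (1 / ((m + k) * (8 * k * V))) with hc
  have hc0 : 0 < c := lt_min (by positivity) (by positivity)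
  have hcc : c ≤ c₂ := (min_le_left _ _).trans (div_le_self hc₂0.le (by
    have : (0 : ℝ) ≤ m * (4 * k) := by positivity
    linarith))
  have hcg : c ≤ genericLow m k H := hcc.trans ((min_le_left _ _).trans (div_le_self hg.le (by
    linarith)))
  obtain ⟨p₀, hp₀⟩ := pow_unbounded_of_one_lt (genericLow m k H / c) (one_lt_two (α := ℝ))
  refine ⟨c, (m + k) * (8 * k * V + 1), p₀ + 1, hc0, by positivity, by omega,
    fun p J ξ hξ => ?_⟩
  have ha : 0 < (sA m k H ^ J)⁻¹ := inv_pos.mpr (pow_pos hsA J)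
  have hb : 0 < sB m k H ^ J := pow_pos hA.sB_pos J
  obtain ⟨w, z₀, i₀, U, hz₀, hi₀, hy, hW, hU, hvy, hVy⟩ := exists_relation (by omega) hk2 ha hb
    (hA.vol J) ξ hg hg1 hξ hv
  have hcl : Close (1 * mesh m k H J) ξ (ξ + U) := fun i l => by
    rw [one_mul, mesh]; simpa using hU i l
  have hlow : KerLow H c₂ J (ξ + U) w := fun z hz _ => by
    have h1 := hξ z hz
    have h2 := hA.lvl_pos_le (by norm_num) hcl.symm z
    refine (min_le_left _ _).trans ?_
    rw [div_le_iff₀ (by positivity)]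
    linarith
  obtain ⟨ξ₁, η₁, hp1, hcl1, hW1, hlow1⟩ := exists_descend_path hA (C₁ := 8 * k * V) (c := c)
    (k * p) hz₀ hi₀ hy hv0 hv1 hvy (hVy.trans (by nlinarith)) hc₂0 hcρ hcc (min_le_right _ _)
    (hcl.mono (by have := hA.mesh_pos J; nlinarith)) hW hlow
  obtain ⟨ξ₂, η₂, hp2, hcl2, hlow2⟩ := exists_ascend_path hA (c := c) hz₀ hi₀ hv0 hv1 hvy hVy hc₂0
    hcρ (min_le_left _ _) (min_le_right _ _) hcl1 hW1 hlow1
  have hC2 : (2 : ℝ) ≤ (m + k) * (8 * k * V + 1) := by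
    have : 0 ≤ 8 * k * V := by positivity
    nlinarith
  have hJ : J + k * p + m * p = J + (k + m) * p := by ring
  rw [hJ] at hp2 hcl2 hlow2
  obtain ⟨ξ₃, hp3, hgen⟩ := exists_generic_path hA (C := (m + k) * (8 * k * V + 1)) hc0 hcg hC2
    (p₀ := p₀ + 1) (by
      rw [div_lt_iff₀ hc0] at hp₀
      have h1 : (0 : ℝ) < 2 ^ p₀ * c := by positivity
      rw [pow_succ]
      linarith) (by omega) (E := fun j => blockE m k p (j - J)) (by
      intro i _
      have h1 : J + (k + m) * p + i - J = (k + m) * p + i := by omega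
      have h2 : (k + m) * p - ((k + m) * p + i) = 0 := by omega
      simp only [blockE, h1, h2, mul_zero]
      split_ifs with h
      · have h3 : (k + m) * p = k * p + m * p := by ring
        have h4 : m * p = 0 := by omega
        have h5 : p = 0 := by
          rcases Nat.mul_eq_zero.mp h4 with h | h
          · omega
          · exact h
        subst h5
        have : i = 0 := by simpa using h
        simp [this]
      · rfl) hcl2 hlow2
  refine ⟨ξ₃, hgen, (Path.congr hp1 ?_).trans ((Path.congr hp2 ?_).trans hp3)⟩
  · intro j hj hj'
    rw [blockE, if_pos (by omega)]
  · intro j hj hj'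
    have h3 : (k + m) * p = k * p + m * p := by ring
    have e : m * p - (j - (J + k * p)) = (k + m) * p - (j - J) := by omega
    rw [e, blockE]
    split_ifs with h
    · have e1 : j - J = k * p := by omega
      rw [e1]
      have : (k + m) * p - k * p = m * p := by omega
      rw [this]; ring
    · rfl

end Phases

section Schedule

lemma exists_schedule {m k p₀ : ℕ} (hm : 0 < m) (hk : 0 < k) {θ : ℝ} (hθ : 0 ≤ θ) (hθm : θ ≤ m) :
    ∃ J p : ℕ → ℕ, J 0 = 0 ∧ (∀ i, J (i + 1) = J i + (k + m) * p i + p₀) ∧ (∀ i, i + 1 ≤ p i) ∧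
      (∀ i : ℕ, θ * (i / (i + 1)) * (J i + k * p i) ≤ m * k * p i) ∧
      ∀ i : ℕ, (m * k * p i : ℝ) ≤ θ * (J i + k * p i) + k * m * (i + 2) := by
  have hm' : (0 : ℝ) < m := by exact_mod_cast hm
  have hk' : (0 : ℝ) < k := by exact_mod_cast hk
  set τ : ℕ → ℝ := fun i => θ * (i / (i + 1)) with hτ
  have hi1 : ∀ i : ℕ, (i : ℝ) / (i + 1) < 1 := fun i => by
    rw [div_lt_one (by positivity)]; linarith
  have hi0 : ∀ i : ℕ, 0 ≤ (i : ℝ) / (i + 1) := fun i => by positivity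
  have hτ0 : ∀ i, 0 ≤ τ i := fun i => mul_nonneg hθ (hi0 i)
  have hτθ : ∀ i, τ i ≤ θ := fun i => mul_le_of_le_one_right hθ (hi1 i).le
  have hτm : ∀ i, τ i < m := fun i => by
    rcases hθ.eq_or_lt with h | h
    · simp only [hτ, ← h, zero_mul]; exact hm'
    · exact (mul_lt_of_lt_one_right h (hi1 i)).trans_le hθm
  set pf : ℕ → ℕ → ℕ := fun i J => ⌈τ i * J / (k * (m - τ i))⌉₊ + i + 1 with hpf
  set J : ℕ → ℕ := fun i => Nat.rec 0 (fun i Ji => Ji + (k + m) * pf i Ji + p₀) i with hJ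
  refine ⟨J, fun i => pf i (J i), rfl, fun i => rfl, fun i => by simp only [hpf]; omega,
    fun i => ?_, fun i => ?_⟩
  · have hden : 0 < k * (m - τ i) := mul_pos hk' (sub_pos.mpr (hτm i))
    have h1 : τ i * J i / (k * (m - τ i)) ≤ pf i (J i) := by
      refine (Nat.le_ceil _).trans ?_
      simp only [hpf]
      exact_mod_cast (by omega)
    rw [div_le_iff₀ hden] at h1
    change τ i * _ ≤ _
    linarith
  · have hden : 0 < k * (m - τ i) := mul_pos hk' (sub_pos.mpr (hτm i))
    have h0 : 0 ≤ τ i * J i / (k * (m - τ i)) :=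
      div_nonneg (mul_nonneg (hτ0 i) (Nat.cast_nonneg _)) hden.le
    have h1 : (pf i (J i) : ℝ) ≤ τ i * J i / (k * (m - τ i)) + (i + 2) := by
      simp only [hpf]
      push_cast
      linarith [Nat.ceil_lt_add_one h0]
    have h2 : (pf i (J i) : ℝ) * (k * (m - τ i)) ≤ τ i * J i + (i + 2) * (k * (m - τ i)) := by
      calc (pf i (J i) : ℝ) * (k * (m - τ i))
          ≤ (τ i * J i / (k * (m - τ i)) + (i + 2)) * (k * (m - τ i)) := by gcongr
        _ = _ := by rw [add_mul, div_mul_cancel₀ _ hden.ne']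
    have h3 : ((i : ℝ) + 2) * (k * (m - τ i)) ≤ k * m * (i + 2) := by
      have h4 : k * (m - τ i) ≤ k * m := by
        have := hτ0 i
        gcongr; linarith
      have h5 : (0 : ℝ) ≤ i + 2 := by positivity
      nlinarith
    have h6 : τ i * (J i + k * pf i (J i)) ≤ θ * (J i + k * pf i (J i)) := by
      have := hτθ i
      gcongr
    linarith

lemma blockE_succ_le (m k p i : ℕ) : blockE m k p (i + 1) ≤ blockE m k p i + m := by
  have h3 : (k + m) * p = k * p + m * p := by ring
  rw [blockE, blockE]
  split_ifs with h1 h2 h2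
  · rw [mul_add, mul_one]
  · omega
  · have : i = k * p := by omega
    subst this
    have h4 : (k + m) * p - (k * p + 1) ≤ m * p := by omega
    calc k * ((k + m) * p - (k * p + 1)) ≤ k * (m * p) := Nat.mul_le_mul_left _ h4
      _ = m * (k * p) := by ring
      _ ≤ _ := Nat.le_add_right _ _
  · exact (Nat.mul_le_mul_left _ (by omega)).trans (Nat.le_add_right _ _)

lemma blockE_le_succ (m k p i : ℕ) : blockE m k p i ≤ blockE m k p (i + 1) + k := by
  have h3 : (k + m) * p = k * p + m * p := by ring
  rw [blockE, blockE]
  split_ifs with h1 h2 h2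
  · exact (Nat.mul_le_mul_left _ (by omega)).trans (Nat.le_add_right _ _)
  · have : i = k * p := by omega
    subst this
    have h4 : m * p ≤ (k + m) * p - (k * p + 1) + 1 := by omega
    calc m * (k * p) = k * (m * p) := by ring
      _ ≤ k * ((k + m) * p - (k * p + 1) + 1) := Nat.mul_le_mul_left _ h4
      _ = _ := by ring
  · omega
  · calc k * ((k + m) * p - i) ≤ k * ((k + m) * p - (i + 1) + 1) :=
        Nat.mul_le_mul_left _ (by omega)
      _ = _ := by ring

lemma blockE_zero (m k p : ℕ) : blockE m k p 0 = 0 := by simp [blockE]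

lemma blockE_end {m k p i : ℕ} (hm : 0 < m) (hp : 0 < p) (hi : (k + m) * p ≤ i) :
    blockE m k p i = 0 := by
  have h3 : (k + m) * p = k * p + m * p := by ring
  have h4 : 0 < m * p := Nat.mul_pos hm hp
  rw [blockE, if_neg (by omega)]
  simp; omega

lemma blockE_mul_le {m k p : ℕ} (J i : ℕ) :
    blockE m k p i * (J + k * p) ≤ m * k * p * (J + i) := by
  have h3 : (k + m) * p = k * p + m * p := by ring
  rw [blockE]
  split_ifs with h
  · calc m * i * (J + k * p) = m * (i * J + i * (k * p)) := by ring
      _ ≤ m * (k * p * J + i * (k * p)) := by gcongr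
      _ = _ := by ring
  · calc k * ((k + m) * p - i) * (J + k * p) ≤ k * (m * p) * (J + i) := by
          gcongr <;> omega
      _ = _ := by ring

/-- The profile of depths along all levels. -/
lemma exists_profile {m k p₀ : ℕ} (hm : 0 < m) (hk : 0 < k) {θ : ℝ} (hθ : 0 ≤ θ) (hθm : θ ≤ m) :
    ∃ (J p E : ℕ → ℕ), J 0 = 0 ∧ (∀ i, J (i + 1) = J i + (k + m) * p i + p₀) ∧ StrictMono J ∧
      (∀ i j, J i ≤ j → j < J (i + 1) → E j = blockE m k (p i) (j - J i)) ∧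
      (∀ j, E (j + 1) ≤ E j + m) ∧ (∀ j, E j ≤ E (j + 1) + k) ∧
      (∀ N, ∃ j, N ≤ E j) ∧
      (∀ ε > 0, ∀ᶠ j : ℕ in atTop, (E j : ℝ) ≤ (θ + ε) * j) ∧
      ∀ ε > 0, ∃ᶠ j : ℕ in atTop, (θ - ε) * j ≤ (E j : ℝ) := by
  obtain ⟨J, p, hJ0, hJ, hp, hlow, hup⟩ := exists_schedule (p₀ := p₀) hm hk hθ hθm
  have hm' : (0 : ℝ) < m := by exact_mod_cast hm
  have hk' : (0 : ℝ) < k := by exact_mod_cast hk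
  have hmono : StrictMono J := strictMono_nat_of_lt_succ fun i => by
    rw [hJ]
    have : 0 < (k + m) * p i := Nat.mul_pos (by omega) (by have := hp i; omega)
    omega
  set idx : ℕ → ℕ := fun j => Nat.findGreatest (fun i => J i ≤ j) j with hidx
  have hidx_le : ∀ j, J (idx j) ≤ j := fun j =>
    Nat.findGreatest_spec (P := fun i => J i ≤ j) (Nat.zero_le j) (by simp [hJ0])
  have hidx_lt : ∀ j, j < J (idx j + 1) := fun j => by
    by_contra h
    push Not at h
    have h1 : idx j + 1 ≤ j := (hmono.le_apply).trans h
    have := Nat.le_findGreatest (P := fun i => J i ≤ j) h1 h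
    simp only [hidx] at this
    omega
  have hidx_eq : ∀ i j, J i ≤ j → j < J (i + 1) → idx j = i := fun i j h1 h2 => by
    have h3 : idx j < i + 1 := hmono.lt_iff_lt.mp ((hidx_le j).trans_lt h2)
    have h4 : i < idx j + 1 := hmono.lt_iff_lt.mp (h1.trans_lt (hidx_lt j))
    omega
  set E : ℕ → ℕ := fun j => blockE m k (p (idx j)) (j - J (idx j)) with hE
  have hEeq : ∀ i j, J i ≤ j → j < J (i + 1) → E j = blockE m k (p i) (j - J i) :=
    fun i j h1 h2 => by simp only [hE]; rw [hidx_eq i j h1 h2]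
  have hEsucc : ∀ j, E (j + 1) = blockE m k (p (idx j)) (j + 1 - J (idx j)) := fun j => by
    rcases Nat.lt_or_ge (j + 1) (J (idx j + 1)) with h | h
    · exact hEeq _ _ ((hidx_le j).trans (by omega)) h
    · have h1 : j + 1 = J (idx j + 1) := le_antisymm (hidx_lt j) h
      rw [h1, hEeq (idx j + 1) _ le_rfl (hmono (by omega)), Nat.sub_self, blockE_zero,
        blockE_end hm (by have := hp (idx j); omega)]
      rw [hJ]; omega
  have hsub : ∀ j, j + 1 - J (idx j) = j - J (idx j) + 1 := fun j => by
    have := hidx_le j; omega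
  have hbot : ∀ i, E (J i + k * p i) = m * k * p i := fun i => by
    rw [hEeq i _ (by omega)]
    · rw [Nat.add_sub_cancel_left, blockE, if_pos le_rfl]; ring
    · rw [hJ]
      have h3 : (k + m) * p i = k * p i + m * p i := by ring
      have : 0 < m * p i := Nat.mul_pos hm (by have := hp i; omega)
      omega
  have hJlow : ∀ i, i * (i + 1) ≤ 2 * J i := fun i => by
    induction i with
    | zero => simp
    | succ i ih =>
      rw [hJ]
      have h1 : 1 * p i ≤ (k + m) * p i := Nat.mul_le_mul_right _ (by omega)
      have h2 := hp i
      nlinarith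
  refine ⟨J, p, E, hJ0, hJ, hmono, hEeq, fun j => ?_, fun j => ?_, fun N => ?_, fun ε hε => ?_,
    fun ε hε => ?_⟩
  · rw [hEsucc, hsub]; exact blockE_succ_le _ _ _ _
  · rw [hEsucc, hsub]; exact blockE_le_succ _ _ _ _
  · refine ⟨J N + k * p N, ?_⟩
    rw [hbot]
    calc N ≤ 1 * 1 * p N := by have := hp N; omega
      _ ≤ _ := by gcongr <;> omega
  · obtain ⟨i₀, hi₀⟩ := exists_nat_gt (6 * k * m / ε)
    filter_upwards [eventually_ge_atTop (J (i₀ + 1))] with j hj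
    set i := idx j with hi
    have hii : i₀ + 1 ≤ i := by
      have : i₀ + 1 < i + 1 := hmono.lt_iff_lt.mp (hj.trans_lt (hidx_lt j))
      omega
    have hi1 : (1 : ℝ) ≤ i := by exact_mod_cast (by omega : 1 ≤ i)
    have h1 : (E j : ℝ) * (J i + k * p i) ≤ m * k * p i * j := by
      have := blockE_mul_le (m := m) (k := k) (p := p i) (J i) (j - J i)
      rw [Nat.add_sub_cancel' (hidx_le j)] at this
      exact_mod_cast this
    have h2 : (i : ℝ) * (i + 1) ≤ 2 * J i := by exact_mod_cast hJlow i
    have h3 : (k * m * (i + 2) : ℝ) ≤ ε * (J i + k * p i) := by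
      have h4 : 6 * k * m / ε < i := hi₀.trans_le (by exact_mod_cast (by omega : i₀ ≤ i))
      rw [div_lt_iff₀ hε] at h4
      have h5 : (0 : ℝ) ≤ k * p i := by positivity
      have h6 : ε * (i * (i + 1)) ≤ ε * (2 * J i) := by gcongr
      have h7 : 6 * k * m * (i + 1 : ℝ) ≤ i * ε * (i + 1) := by gcongr
      have h8 : (0 : ℝ) ≤ k * m * (i - 1) := by
        have : (0 : ℝ) ≤ i - 1 := by linarith
        positivity
      have h9 : (0 : ℝ) ≤ ε * (k * p i) := by positivity
      have h10 : (0 : ℝ) ≤ k * m := by positivity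
      nlinarith
    have hpos : (0 : ℝ) < J i + k * p i := by
      have : (0 : ℝ) < J i := by nlinarith
      positivity
    have h4 := hup i
    have h5 : (E j : ℝ) * (J i + k * p i) ≤ (θ + ε) * j * (J i + k * p i) := by
      calc (E j : ℝ) * (J i + k * p i) ≤ m * k * p i * j := h1
        _ ≤ ((θ + ε) * (J i + k * p i)) * j :=
          mul_le_mul_of_nonneg_right (by rw [add_mul]; linarith) (Nat.cast_nonneg j)
        _ = _ := by ring
    exact le_of_mul_le_mul_right h5 hpos
  · rw [frequently_atTop]
    intro N
    obtain ⟨i₀, hi₀⟩ := exists_nat_gt (θ / ε)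
    refine ⟨J (max i₀ N) + k * p (max i₀ N), ?_, ?_⟩
    · exact (le_max_right i₀ N).trans (hmono.le_apply.trans (Nat.le_add_right _ _))
    · set i := max i₀ N with hi
      rw [hbot]
      push_cast
      refine le_trans ?_ (hlow i)
      have h1 : θ / ε < i := hi₀.trans_le (by exact_mod_cast le_max_left i₀ N)
      rw [div_lt_iff₀ hε] at h1
      have h2 : θ - ε ≤ θ * (i / (i + 1)) := by
        rw [mul_div_assoc', le_div_iff₀ (by positivity)]
        nlinarith
      gcongr

end Schedule

section Limit

variable {m k : ℕ} {H : ℝ}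

lemma generic_zero (hA : Admissible m k H) :
    Generic H 0 (0 : Matrix (Fin k) (Fin m) ℝ) := by
  intro z hz
  refine (genericLow_le_one hA).trans ?_
  obtain ⟨i, hi⟩ := Function.ne_iff.mp hz
  have h1 : (1 : ℝ) ≤ |(z i : ℝ)| := by exact_mod_cast Int.one_le_abs hi
  rw [lvl, hgt]
  simp only [pow_zero, inv_one, one_mul]
  rcases i with i | i
  · exact le_max_of_le_left (h1.trans (norm_le_pi_norm (xpart z) i))
  · refine le_max_of_le_right (h1.trans ?_)
    have := norm_le_pi_norm (rem 0 z) i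
    simpa [rem] using this

theorem exists_matrix_of_profile (hA : Admissible m k H) {c C : ℝ} {p₀ : ℕ}
    (hblock : ∀ (p J : ℕ) (ξ : Matrix (Fin k) (Fin m) ℝ), Generic H J ξ →
      ∃ ξ' : Matrix (Fin k) (Fin m) ℝ, Generic H (J + (k + m) * p + p₀) ξ' ∧
        Path H c C (fun j => blockE m k p (j - J)) J (J + (k + m) * p + p₀) ξ ξ')
    {J p : ℕ → ℕ} (hJ0 : J 0 = 0) (hJ : ∀ i, J (i + 1) = J i + (k + m) * p i + p₀)
    (hmono : StrictMono J) :
    ∃ ξ : Matrix (Fin k) (Fin m) ℝ, ∀ i j, J i ≤ j → j < J (i + 1) →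
      Bd H (c / loss m k) (C * loss m k) (blockE m k (p i) (j - J i)) j ξ := by
  have hblock' : ∀ (i : ℕ) (ξ : {ξ : Matrix (Fin k) (Fin m) ℝ // Generic H (J i) ξ}),
      ∃ ξ' : {ξ : Matrix (Fin k) (Fin m) ℝ // Generic H (J (i + 1)) ξ},
        Path H c C (fun j => blockE m k (p i) (j - J i)) (J i) (J (i + 1)) ξ.1 ξ'.1 := by
    rintro i ⟨ξ, hξ⟩
    obtain ⟨ξ', h1, h2⟩ := hblock (p i) (J i) ξ hξ
    rw [← hJ] at h1 h2
    exact ⟨⟨ξ', h1⟩, h2⟩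
  choose nxt hnxt using hblock'
  set X : ∀ i, {ξ : Matrix (Fin k) (Fin m) ℝ // Generic H (J i) ξ} := fun i =>
    Nat.rec (motive := fun i => {ξ : Matrix (Fin k) (Fin m) ℝ // Generic H (J i) ξ})
      ⟨0, by rw [hJ0]; exact generic_zero hA⟩ nxt i with hX
  have hpath : ∀ i, Path H c C (fun j => blockE m k (p i) (j - J i)) (J i) (J (i + 1))
      (X i).1 (X (i + 1)).1 := fun i => hnxt i (X i)
  have hk0 : (0 : ℝ) ≤ 40 * k := by positivity
  have hnear : ∀ i n ξ'', Close (40 * k * mesh m k H (J (i + n))) (X (i + n)).1 ξ'' →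
      Close (40 * k * mesh m k H (J i)) (X i).1 ξ'' := by
    intro i n
    induction n with
    | zero => exact fun _ h => h
    | succ n ih => exact fun ξ'' h => ih ξ'' (hpath (i + n) ξ'' h).1
  have hnear' : ∀ i i', i ≤ i' → Close (40 * k * mesh m k H (J i)) (X i).1 (X i').1 := by
    intro i i' h
    obtain ⟨n, rfl⟩ := Nat.exists_eq_add_of_le h
    exact hnear i n _ (Close.refl (mul_nonneg hk0 (hA.mesh_pos _).le) _)
  have hmesh : Tendsto (fun i => 40 * k * mesh m k H (J i)) atTop (nhds 0) := by
    rw [← mul_zero (40 * (k : ℝ))]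
    refine Tendsto.const_mul _ (squeeze_zero (fun i => (hA.mesh_pos _).le)
      (fun i => hA.mesh_le (J i)) ?_)
    exact (tendsto_pow_atTop_nhds_zero_of_lt_one (by norm_num) (by norm_num)).comp
      hmono.tendsto_atTop
  have hcauchy : ∀ a b, ∃ x : ℝ, Tendsto (fun i => (X i).1 a b) atTop (nhds x) := fun a b => by
    refine cauchySeq_tendsto_of_complete (cauchySeq_of_le_tendsto_0'
      (fun i => 40 * k * mesh m k H (J i)) (fun i i' h => ?_) hmesh)
    rw [dist_comm, Real.dist_eq]
    exact hnear' i i' h a b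
  choose ξ hξ using hcauchy
  refine ⟨ξ, fun i j h1 h2 => (hpath i ξ fun a b => ?_).2 j h1 h2⟩
  refine le_of_tendsto ((hξ a b).sub_const _).abs ?_
  filter_upwards [eventually_ge_atTop (i + 1)] with i' hi'
  exact hnear' _ _ hi' a b

end Limit

section LogScale

lemma le_sub_of_step {p : ℕ → ℝ} {η : ℝ} (h : ∀ j, η ≤ p (j + 1) - p j) (j s : ℕ) :
    η * s ≤ p (j + s) - p j := by
  induction s with
  | zero => simp
  | succ s ih => have := h (j + s); push_cast; rw [← add_assoc]; linarith

lemma sub_le_of_step {p : ℕ → ℝ} {κ : ℝ} (h : ∀ j, p (j + 1) - p j ≤ κ) (j s : ℕ) :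
    p (j + s) - p j ≤ κ * s := by
  induction s with
  | zero => simp
  | succ s ih => have := h (j + s); push_cast; rw [← add_assoc]; linarith

lemma exists_lt_of_step {p : ℕ → ℝ} {η : ℝ} (hη : 0 < η) (h : ∀ j, η ≤ p (j + 1) - p j) (t : ℝ) :
    ∃ j, t < p j := by
  obtain ⟨j, hj⟩ := exists_nat_gt ((t - p 0) / η)
  refine ⟨j, ?_⟩
  rw [div_lt_iff₀ hη] at hj
  have := le_sub_of_step h 0 j
  rw [zero_add] at this
  linarith

/-- Increasing sequences `x`, `l` that are squeezed, up to a bounded error, by the sequences `p`,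
`r` of bounded positive increments. -/
structure LogScale (p r x l : ℕ → ℝ) (η κ a : ℝ) : Prop where
  η_pos : 0 < η
  le_p : ∀ j, η ≤ p (j + 1) - p j
  p_le : ∀ j, p (j + 1) - p j ≤ κ
  le_r : ∀ j, η ≤ r (j + 1) - r j
  r_le : ∀ j, r (j + 1) - r j ≤ κ
  lower : ∀ i j, x i < p j → l i ≤ r j
  upper : ∀ i j, p j + a < x (i + 1) → r j - a ≤ l i
  x_zero : x 0 = 0
  x_mono : StrictMono x
  l_mono : StrictMono l
  x_top : Tendsto x atTop atTop

namespace LogScale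

variable {p r x l : ℕ → ℝ} {η κ a : ℝ}

lemma x_step (h : LogScale p r x l η κ a) : ∃ M, ∀ i, x (i + 1) - x i ≤ M := by
  obtain ⟨s, hs⟩ := exists_nat_gt (a / η)
  rw [div_lt_iff₀ h.η_pos] at hs
  have key : ∀ i j, x i < p j → x (i + 1) ≤ p (j + s) + a := fun i j hij => by
    by_contra hlt
    push Not at hlt
    have h1 := h.upper i _ hlt
    have h2 := h.lower i j hij
    have h3 := le_sub_of_step h.le_r j s
    linarith
  refine ⟨max (p s + a) (κ * (s + 1) + a), fun i => ?_⟩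
  classical
  have hex := exists_lt_of_step h.η_pos h.le_p (x i)
  have h0 : 0 ≤ x i := by
    have := h.x_mono.monotone (Nat.zero_le i); rwa [h.x_zero] at this
  have h1 := key i _ (Nat.find_spec hex)
  rcases hj : Nat.find hex with _ | j
  · rw [hj, zero_add] at h1
    exact le_max_of_le_left (by linarith)
  · rw [hj] at h1
    have h2 := not_lt.mp (Nat.find_min hex (by omega : j < Nat.find hex))
    have h3 := sub_le_of_step h.p_le j (1 + s)
    rw [← add_assoc] at h3
    push_cast at h3
    exact le_max_of_le_right (by linarith)

lemma l_step (h : LogScale p r x l η κ a) : ∃ M, ∀ i, l (i + 1) - l i ≤ M := by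
  obtain ⟨s, hs⟩ := exists_nat_gt (a / η)
  rw [div_lt_iff₀ h.η_pos] at hs
  have key : ∀ i j, x i ≤ p j + a → l i ≤ r (j + s) := fun i j hij =>
    h.lower _ _ (by have := le_sub_of_step h.le_p j s; linarith)
  refine ⟨max (r s - l 0) (κ * (s + 1) + a), fun i => ?_⟩
  classical
  have hex : ∃ j, x (i + 1) ≤ p j + a := by
    obtain ⟨j, hj⟩ := exists_lt_of_step h.η_pos h.le_p (x (i + 1) - a)
    exact ⟨j, by linarith⟩
  have h1 := key _ _ (Nat.find_spec hex)
  rcases hj : Nat.find hex with _ | j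
  · rw [hj, zero_add] at h1
    have := h.l_mono.monotone (Nat.zero_le i)
    exact le_max_of_le_left (by linarith)
  · rw [hj] at h1
    have h2 := not_le.mp (Nat.find_min hex (by omega : j < Nat.find hex))
    have h4 := h.upper _ _ h2
    have h3 := sub_le_of_step h.r_le j (1 + s)
    rw [← add_assoc] at h3
    push_cast at h3
    exact le_max_of_le_right (by linarith)

lemma eventually_le (h : LogScale p r x l η κ a) {w ε : ℝ} (hw : 0 < w) (hε : 0 < ε)
    (hr : ∀ᶠ j in atTop, r j ≤ (w + ε) * p j) :
    ∀ᶠ i in atTop, l i ≤ (w + 2 * ε) * x i := by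
  obtain ⟨j₀, hj₀⟩ := eventually_atTop.mp hr
  filter_upwards [h.x_top.eventually_ge_atTop (p j₀), h.x_top.eventually_ge_atTop (κ / ε)]
    with i h1 h2
  rw [div_le_iff₀ hε] at h2
  classical
  have hex := exists_lt_of_step h.η_pos h.le_p (x i)
  have hpm : StrictMono p := strictMono_nat_of_lt_succ fun j => by
    have := h.le_p j; have := h.η_pos; linarith
  have hlt : j₀ < Nat.find hex := hpm.lt_iff_lt.mp (h1.trans_lt (Nat.find_spec hex))
  have h3 := h.lower i _ (Nat.find_spec hex)
  obtain ⟨j, hj⟩ : ∃ j, Nat.find hex = j + 1 := ⟨Nat.find hex - 1, by omega⟩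
  have h4 := not_lt.mp (Nat.find_min hex (by omega : j < Nat.find hex))
  rw [hj] at h3
  have h5 := h.r_le j
  have h6 := hj₀ j (by omega)
  have h7 : (w + ε) * p j ≤ (w + ε) * x i := mul_le_mul_of_nonneg_left h4 (by linarith)
  linarith

lemma frequently_ge (h : LogScale p r x l η κ a) {w ε : ℝ} (hε : 0 < ε) (hw : ε ≤ w) (ha : 0 ≤ a)
    (hr : ∃ᶠ j in atTop, (w - ε) * p j ≤ r j) :
    ∃ᶠ i in atTop, (w - 2 * ε) * x i ≤ l i := by
  rw [frequently_atTop]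
  intro N
  obtain ⟨N', hN'⟩ := eventually_atTop.mp
    (h.x_top.eventually_ge_atTop (max (((w - ε) * a + a) / ε) 0))
  have hpm : StrictMono p := strictMono_nat_of_lt_succ fun j => by
    have := h.le_p j; have := h.η_pos; linarith
  obtain ⟨j₀, hj₀⟩ := exists_lt_of_step h.η_pos h.le_p (x (max N N'))
  obtain ⟨j, hj, hjr⟩ := frequently_atTop.mp hr j₀
  have hpj : x (max N N') < p j := hj₀.trans_le (hpm.monotone hj)
  classical
  have hex : ∃ i, p j + a < x (i + 1) := by
    obtain ⟨i, hi⟩ := (h.x_top.eventually_gt_atTop (p j + a)).exists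
    exact ⟨i, hi.trans (h.x_mono (Nat.lt_succ_self i))⟩
  have h1 := Nat.find_spec hex
  have h2 : x (Nat.find hex) ≤ p j + a := by
    rcases hi : Nat.find hex with _ | i
    · have := h.x_mono.monotone (Nat.zero_le (max N N'))
      linarith
    · exact not_lt.mp (Nat.find_min hex (by omega : i < Nat.find hex))
  have h3 : max N N' < Nat.find hex + 1 := h.x_mono.lt_iff_lt.mp (by linarith)
  refine ⟨Nat.find hex, by omega, ?_⟩
  have h4 := h.upper _ _ h1
  have h5 := hN' (Nat.find hex) (by omega)
  have h6 := (le_max_left _ _).trans h5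
  rw [div_le_iff₀ hε] at h6
  have h7 : (w - ε) * x (Nat.find hex) ≤ (w - ε) * (p j + a) :=
    mul_le_mul_of_nonneg_left h2 (by linarith)
  linarith

lemma limsup_eq (h : LogScale p r x l η κ a) {w : ℝ} (hw : 0 < w) (ha : 0 ≤ a)
    (hr : ∀ ε > 0, ∀ᶠ j in atTop, r j ≤ (w + ε) * p j)
    (hr' : ∀ ε > 0, ε ≤ w → ∃ᶠ j in atTop, (w - ε) * p j ≤ r j) :
    limsup (fun i => ((l i / x i : ℝ) : EReal)) atTop = (w : EReal) := by
  apply le_antisymm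
  · rw [← EReal.le_of_forall_lt_iff_le]
    intro b hb
    have hb' : w < b := EReal.coe_lt_coe_iff.mp hb
    refine limsup_le_of_le (by isBoundedDefault) ?_
    filter_upwards [h.eventually_le hw (ε := (b - w) / 2) (by linarith) (hr _ (by linarith)),
      h.x_top.eventually_gt_atTop 0] with i h1 h2
    rw [EReal.coe_le_coe_iff, div_le_iff₀ h2]
    calc _ ≤ _ := h1
      _ = _ := by ring
  · rw [← EReal.ge_of_forall_gt_iff_ge]
    intro b hb
    have hb' : b < w := EReal.coe_lt_coe_iff.mp hb
    set ε := min ((w - b) / 2) w with hε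
    have hε0 : 0 < ε := lt_min (by linarith) hw
    refine le_limsup_of_frequently_le ?_ (by isBoundedDefault)
    have hεw : ε ≤ w := min_le_right _ _
    refine ((h.frequently_ge hε0 hεw ha (hr' ε hε0 hεw)).and_eventually
      (h.x_top.eventually_gt_atTop 0)).mono fun i hi => ?_
    rw [EReal.coe_le_coe_iff, le_div_iff₀ hi.2]
    refine le_trans (mul_le_mul_of_nonneg_right ?_ hi.2.le) hi.1
    have := min_le_left ((w - b) / 2) w
    linarith

end LogScale

end LogScale

section BestApprox

variable {m n : ℕ}

/-- The norm of an integer vector. -/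
def nrm (u : Fin m → ℤ) : ℝ := ‖fun j => (u j : ℝ)‖

/-- The quality `‖ξ u - v‖` of an integral approximation. -/
def err (ξ : Matrix (Fin n) (Fin m) ℝ) (u : Fin m → ℤ) (v : Fin n → ℤ) : ℝ :=
  ‖(ξ.mulVec (fun j => (u j : ℝ)) - (fun k => (v k : ℝ)))‖

lemma abs_le_nrm (u : Fin m → ℤ) (j : Fin m) : |(u j : ℝ)| ≤ nrm u :=
  norm_le_pi_norm (fun j => (u j : ℝ)) j

lemma exists_nrm_eq (hm : 0 < m) (u : Fin m → ℤ) : ∃ N : ℕ, nrm u = N := by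
  obtain ⟨j, hj⟩ := exists_abs_eq_norm hm (fun j => (u j : ℝ))
  refine ⟨(u j).natAbs, ?_⟩
  rw [nrm, ← hj, Nat.cast_natAbs, Int.cast_abs]

lemma one_le_nrm {u : Fin m → ℤ} (hu : u ≠ 0) : 1 ≤ nrm u := by
  obtain ⟨j, hj⟩ := Function.ne_iff.mp hu
  have h1 : (1 : ℝ) ≤ |(u j : ℝ)| := by exact_mod_cast Int.one_le_abs hj
  exact h1.trans (abs_le_nrm u j)

/-- Rounding gives the best integral approximation to a given multiple. -/
lemma err_round_le (ξ : Matrix (Fin n) (Fin m) ℝ) (u : Fin m → ℤ) (v : Fin n → ℤ) :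
    err ξ u (fun i => round (ξ.mulVec (fun j => (u j : ℝ)) i)) ≤ err ξ u v := by
  refine (pi_norm_le_iff_of_nonneg (norm_nonneg _)).mpr fun i => ?_
  refine le_trans ?_ (norm_le_pi_norm _ i)
  simpa [Real.norm_eq_abs] using round_le (ξ.mulVec (fun j => (u j : ℝ)) i) (v i)

lemma err_round_le_half (ξ : Matrix (Fin n) (Fin m) ℝ) (u : Fin m → ℤ) :
    err ξ u (fun i => round (ξ.mulVec (fun j => (u j : ℝ)) i)) ≤ 1 / 2 := by
  refine (pi_norm_le_iff_of_nonneg (by norm_num)).mpr fun i => ?_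
  simpa [Real.norm_eq_abs] using abs_sub_round (ξ.mulVec (fun j => (u j : ℝ)) i)

lemma exists_minimal_err (ξ : Matrix (Fin n) (Fin m) ℝ) {N : ℝ} {u₀ : Fin m → ℤ} (hu₀ : u₀ ≠ 0)
    (hN : nrm u₀ ≤ N) :
    ∃ u v, u ≠ 0 ∧ nrm u ≤ N ∧ ∀ u' v', u' ≠ 0 → nrm u' ≤ N → err ξ u v ≤ err ξ u' v' := by
  set S : Set (Fin m → ℤ) := {u | u ≠ 0 ∧ nrm u ≤ N}
  have hS : S.Finite := by
    refine (Set.finite_Icc (fun _ => -⌈N⌉ : Fin m → ℤ) (fun _ => ⌈N⌉)).subset ?_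
    rintro u ⟨-, hu⟩
    have h1 : ∀ j, |u j| ≤ ⌈N⌉ := fun j => by
      have := ((abs_le_nrm u j).trans hu).trans (Int.le_ceil N)
      exact_mod_cast this
    exact ⟨fun j => (abs_le.mp (h1 j)).1, fun j => (abs_le.mp (h1 j)).2⟩
  obtain ⟨u, hu, hmin⟩ := Set.exists_min_image S
    (fun u => err ξ u (fun i => round (ξ.mulVec (fun j => (u j : ℝ)) i))) hS ⟨u₀, hu₀, hN⟩
  exact ⟨u, _, hu.1, hu.2, fun u' v' h1 h2 => (hmin u' ⟨h1, h2⟩).trans (err_round_le ξ u' v')⟩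

lemma exists_next (hm : 0 < m) {ξ : Matrix (Fin n) (Fin m) ℝ} {u : Fin m → ℤ} {v : Fin n → ℤ}
    (hbest : ∀ u' v', u' ≠ 0 → nrm u' ≤ nrm u → err ξ u v ≤ err ξ u' v')
    (hex : ∃ u' v', u' ≠ 0 ∧ err ξ u' v' < err ξ u v) :
    ∃ u₁ v₁, (u₁ ≠ 0 ∧ ∀ u' v', u' ≠ 0 → nrm u' ≤ nrm u₁ → err ξ u₁ v₁ ≤ err ξ u' v') ∧
      nrm u < nrm u₁ ∧ err ξ u₁ v₁ < err ξ u v ∧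
      ∀ u' v', u' ≠ 0 → nrm u' < nrm u₁ → err ξ u v ≤ err ξ u' v' := by
  classical
  have hex' : ∃ N : ℕ, ∃ u' v', u' ≠ 0 ∧ nrm u' ≤ N ∧ err ξ u' v' < err ξ u v := by
    obtain ⟨u', v', h1, h2⟩ := hex
    obtain ⟨N, hN⟩ := exists_nrm_eq hm u'
    exact ⟨N, u', v', h1, hN.le, h2⟩
  obtain ⟨w, w', hw, hwN, hwe⟩ := Nat.find_spec hex'
  set N := Nat.find hex'
  have hmin : ∀ u' v', u' ≠ 0 → nrm u' < N → err ξ u v ≤ err ξ u' v' := fun u' v' h1 h2 => by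
    obtain ⟨M, hM⟩ := exists_nrm_eq hm u'
    by_contra h
    rw [hM] at h2
    exact Nat.find_min hex' (by exact_mod_cast h2) ⟨u', v', h1, hM.le, not_le.mp h⟩
  obtain ⟨u₁, v₁, h1, h2, h3⟩ := exists_minimal_err ξ hw hwN
  have h4 : err ξ u₁ v₁ < err ξ u v := (h3 w w' hw hwN).trans_lt hwe
  have h5 : nrm u₁ = N := le_antisymm h2 (not_lt.mp fun h => (hmin u₁ v₁ h1 h).not_gt h4)
  rw [← h5] at h3 hmin
  refine ⟨u₁, v₁, ⟨h1, h3⟩, not_le.mp fun h => (hbest u₁ v₁ h1 h).not_gt h4, h4, hmin⟩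

lemma exists_isBestApproxSeq (hm : 0 < m) {ξ : Matrix (Fin n) (Fin m) ℝ}
    (hpos : TotallyIrrational ξ) (hsmall : ∀ ε > 0, ∃ u v, u ≠ 0 ∧ err ξ u v < ε) :
    ∃ x y, IsBestApproxSeq ξ x y := by
  set Z := {z : (Fin m → ℤ) × (Fin n → ℤ) //
    z.1 ≠ 0 ∧ ∀ u' v', u' ≠ 0 → nrm u' ≤ nrm z.1 → err ξ z.1 z.2 ≤ err ξ u' v'}
  have hnext : ∀ z : Z, ∃ z' : Z, nrm z.1.1 < nrm z'.1.1 ∧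
      err ξ z'.1.1 z'.1.2 < err ξ z.1.1 z.1.2 ∧
      ∀ u' v', u' ≠ 0 → nrm u' < nrm z'.1.1 → err ξ z.1.1 z.1.2 ≤ err ξ u' v' := by
    rintro ⟨⟨u, v⟩, hu, hz⟩
    obtain ⟨u₁, v₁, h1, h2⟩ := exists_next hm hz
      (hsmall _ (hpos u v fun h => hu (congrArg Prod.fst h)))
    exact ⟨⟨⟨u₁, v₁⟩, h1⟩, h2⟩
  choose nxt hnxt using hnext
  have hone : nrm (fun _ => 1 : Fin m → ℤ) = 1 := by
    have : Nonempty (Fin m) := ⟨⟨0, hm⟩⟩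
    simp [nrm]
  obtain ⟨u₀, v₀, h1, h2, h3⟩ := exists_minimal_err ξ (N := 1) (u₀ := fun _ => 1)
    (fun h => by simpa using congrFun h ⟨0, hm⟩) hone.le
  have h4 : nrm u₀ = 1 := le_antisymm h2 (one_le_nrm h1)
  rw [← h4] at h3
  set s : ℕ → Z := fun i => Nat.rec ⟨⟨u₀, v₀⟩, h1, h3⟩ (fun _ z => nxt z) i
  have hs : ∀ i, s (i + 1) = nxt (s i) := fun i => rfl
  refine ⟨fun i => (s i).1.1, fun i => (s i).1.2, fun i => (s i).2.1, h4,
    strictMono_nat_of_lt_succ fun i => ?_, strictAnti_nat_of_succ_lt fun i => ?_,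
    fun i u v hu hlt => ?_⟩
  · have := (hnxt (s i)).1
    rwa [← hs] at this
  · have := (hnxt (s i)).2.1
    rwa [← hs] at this
  · refine (hnxt (s i)).2.2 u v hu ?_
    rw [← hs]
    exact hlt

/-- Integer vectors realising a prescribed pair of logarithmic scales. -/
theorem exists_bestApprox_of_scales (hm : 0 < m) {ξ : Matrix (Fin n) (Fin m) ℝ}
    {p r : ℕ → ℝ} {η κ a w : ℝ} (hη : 0 < η) (ha : 0 ≤ a) (hw : 0 < w)
    (hp : ∀ j, η ≤ p (j + 1) - p j) (hp' : ∀ j, p (j + 1) - p j ≤ κ)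
    (hr : ∀ j, η ≤ r (j + 1) - r j) (hr' : ∀ j, r (j + 1) - r j ≤ κ)
    (hlow : ∀ j u v, u ≠ 0 → nrm u < Real.exp (p j) → Real.exp (-r j) ≤ err ξ u v)
    (hup : ∀ j, ∃ u v, u ≠ 0 ∧ nrm u ≤ Real.exp (p j + a) ∧ err ξ u v ≤ Real.exp (-(r j - a)))
    (hdeep : ∀ N : ℝ, ∃ j, m * p j + N ≤ n * r j)
    (hsup : ∀ ε > 0, ∀ᶠ j in atTop, r j ≤ (w + ε) * p j)
    (hsup' : ∀ ε > 0, ε ≤ w → ∃ᶠ j in atTop, (w - ε) * p j ≤ r j) :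
    ∃ x y, TotallyIrrational ξ ∧ IsBestApproxSeq ξ x y ∧ PropB x ∧ PropC ξ x y ∧
      ¬ PropA ξ ∧ ordExp ξ x y = (w : EReal) := by
  have hirr : TotallyIrrational ξ := fun u v huv => by
    by_cases hu : u = 0
    · subst hu
      have hv : v ≠ 0 := fun h => huv (by rw [h]; rfl)
      have h1 := one_le_nrm hv
      have h2 : ‖(ξ.mulVec (fun j => ((0 : Fin m → ℤ) j : ℝ)) - (fun k => (v k : ℝ)))‖ = nrm v := by
        have : (fun j => ((0 : Fin m → ℤ) j : ℝ)) = 0 := by ext; simp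
        rw [this, Matrix.mulVec_zero, zero_sub, norm_neg, nrm]
      linarith
    · obtain ⟨j, hj⟩ := exists_lt_of_step hη hp (Real.log (nrm u))
      have h1 := one_le_nrm hu
      exact (Real.exp_pos _).trans_le
        (hlow j u v hu ((Real.log_lt_iff_lt_exp (by linarith)).mp hj))
  have hsmall : ∀ ε > 0, ∃ u v, u ≠ 0 ∧ err ξ u v < ε := fun ε hε => by
    obtain ⟨j, hj⟩ := exists_lt_of_step hη hr (a - Real.log ε)
    obtain ⟨u, v, h1, -, h2⟩ := hup j
    exact ⟨u, v, h1, h2.trans_lt ((Real.lt_log_iff_exp_lt hε).mp (by linarith))⟩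
  obtain ⟨x, y, hxy⟩ := exists_isBestApproxSeq hm hirr hsmall
  have hX1 : ∀ i, 1 ≤ Xval x i := fun i => one_le_nrm (hxy.nonzero i)
  have hX0 : ∀ i, 0 < Xval x i := fun i => one_pos.trans_le (hX1 i)
  have hL0 : ∀ i, 0 < Lval ξ x y i := fun i =>
    hirr _ _ fun h => hxy.nonzero i (congrArg Prod.fst h)
  have hXi : ∀ i : ℕ, (i + 1 : ℝ) ≤ Xval x i := fun i => by
    induction i with
    | zero => simp [hxy.first]
    | succ i ih =>
      obtain ⟨M, hM⟩ := exists_nrm_eq hm (x i)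
      obtain ⟨N, hN⟩ := exists_nrm_eq hm (x (i + 1))
      have h1 : nrm (x i) < nrm (x (i + 1)) := hxy.xStrictMono (Nat.lt_succ_self i)
      have h2 : (i + 1 : ℝ) ≤ nrm (x i) := ih
      change _ ≤ nrm (x (i + 1))
      rw [hM] at h1 h2
      rw [hN] at h1 ⊢
      have h3 : M < N := by exact_mod_cast h1
      have h4 : i + 1 ≤ M := by exact_mod_cast h2
      exact_mod_cast (by omega : i + 1 + 1 ≤ N)
  have hsc : LogScale p r (fun i => Real.log (Xval x i)) (fun i => -Real.log (Lval ξ x y i))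
      η κ a :=
    { η_pos := hη
      le_p := hp
      p_le := hp'
      le_r := hr
      r_le := hr'
      lower := fun i j hij => by
        have h1 := hlow j (x i) (y i) (hxy.nonzero i) ((Real.log_lt_iff_lt_exp (hX0 i)).mp hij)
        have h2 := (Real.le_log_iff_exp_le (hL0 i)).mpr h1
        linarith
      upper := fun i j hij => by
        obtain ⟨u, v, h1, h2, h3⟩ := hup j
        have h4 := hxy.best i u v h1 (h2.trans_lt ((Real.lt_log_iff_exp_lt (hX0 _)).mp hij))
        have h5 := (Real.log_le_iff_le_exp (hL0 i)).mpr (h4.trans h3)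
        linarith
      x_zero := by simp [hxy.first]
      x_mono := fun i j hij => Real.log_lt_log (hX0 i) (hxy.xStrictMono hij)
      l_mono := fun i j hij => neg_lt_neg (Real.log_lt_log (hL0 j) (hxy.lStrictAnti hij))
      x_top := Real.tendsto_log_atTop.comp (tendsto_atTop_mono
        (fun i => (by linarith [hXi i] : (i : ℝ) ≤ Xval x i)) tendsto_natCast_atTop_atTop) }
  refine ⟨x, y, hirr, hxy, ?_, ?_, ?_, hsc.limsup_eq hw ha hsup hsup'⟩
  · obtain ⟨M, hM⟩ := hsc.x_step
    refine ⟨Real.exp M, fun i => ?_⟩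
    rw [← Real.log_le_iff_le_exp (div_pos (hX0 _) (hX0 _)),
      Real.log_div (hX0 _).ne' (hX0 _).ne']
    exact hM i
  · obtain ⟨M, hM⟩ := hsc.l_step
    refine ⟨Real.exp M, fun i => ?_⟩
    rw [← Real.log_le_iff_le_exp (div_pos (hL0 _) (hL0 _)),
      Real.log_div (hL0 _).ne' (hL0 _).ne']
    have := hM i
    linarith
  · rintro ⟨c, hc, hcA⟩
    obtain ⟨j, hj⟩ := hdeep (m * a + n * a + 1 - Real.log c)
    obtain ⟨u, v, h1, h2, h3⟩ := hup j
    have h4 : c ≤ nrm u ^ m * err ξ u v ^ n := hcA u v h1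
    have h5 : nrm u ^ m * err ξ u v ^ n ≤
        Real.exp (p j + a) ^ m * Real.exp (-(r j - a)) ^ n := by
      have h6 : 0 ≤ nrm u := norm_nonneg _
      have h7 : 0 ≤ err ξ u v := norm_nonneg _
      gcongr
    rw [← Real.exp_nat_mul, ← Real.exp_nat_mul, ← Real.exp_add] at h5
    have h8 := (Real.log_le_iff_le_exp hc).mpr (h4.trans h5)
    linarith

end BestApprox

section Profile

variable {m k n : ℕ} {H : ℝ}

/-- Extend a matrix by zero rows. -/
def padRows (n : ℕ) (ξ : Matrix (Fin k) (Fin m) ℝ) : Matrix (Fin n) (Fin m) ℝ :=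
  fun i l => if h : (i : ℕ) < k then ξ ⟨i, h⟩ l else 0

lemma padRows_mulVec (ξ : Matrix (Fin k) (Fin m) ℝ) (x : Fin m → ℝ) (i : Fin n) :
    (padRows n ξ).mulVec x i = if h : (i : ℕ) < k then ξ.mulVec x ⟨i, h⟩ else 0 := by
  split_ifs with h <;> simp [Matrix.mulVec, dotProduct, padRows, h]

lemma norm_rem_le_err (hkn : k ≤ n) (ξ : Matrix (Fin k) (Fin m) ℝ) (u : Fin m → ℤ)
    (v : Fin n → ℤ) :
    ‖rem ξ (Sum.elim u fun i => v (Fin.castLE hkn i))‖ ≤ err (padRows n ξ) u v := by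
  refine (pi_norm_le_iff_of_nonneg (norm_nonneg _)).mpr fun i => ?_
  refine le_of_eq_of_le ?_ (norm_le_pi_norm _ (Fin.castLE hkn i))
  simp [rem, padRows_mulVec]
  rfl

lemma err_padRows_le (ξ : Matrix (Fin k) (Fin m) ℝ) (z : Fin m ⊕ Fin k → ℤ) :
    err (padRows n ξ) (fun l => z (Sum.inl l))
      (fun i => if h : (i : ℕ) < k then z (Sum.inr ⟨i, h⟩) else 0) ≤ ‖rem ξ z‖ := by
  refine (pi_norm_le_iff_of_nonneg (norm_nonneg _)).mpr fun i => ?_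
  by_cases h : (i : ℕ) < k
  · refine le_of_eq_of_le ?_ (norm_le_pi_norm _ ⟨i, h⟩)
    simp [rem, padRows_mulVec, h]
    rfl
  · simp [padRows_mulVec, h]

theorem exists_bestApprox_of_profile (hA : Admissible m k H) (hkn : k ≤ n) {c C : ℝ} (hc : 0 < c)
    (hc1 : c ≤ 1) (hC : 1 ≤ C) {E : ℕ → ℕ} (hE0 : E 0 = 0) (hE : ∀ j, E (j + 1) ≤ E j + m)
    (hE' : ∀ j, E j ≤ E (j + 1) + k) (hEtop : ∀ N, ∃ j, N ≤ E j)
    {ξ : Matrix (Fin k) (Fin m) ℝ} (hξ : ∀ j, Bd H c C (E j) j ξ) {D : ℕ} (hD : D + 1 = m + k)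
    {θ w : ℝ} (hw : 0 < w) (hθ : θ < k * D) (hwθ : w * (k * D - θ) = m * D + θ)
    (hsup : ∀ ε > 0, ∀ᶠ j : ℕ in atTop, (E j : ℝ) ≤ (θ + ε) * j)
    (hsup' : ∀ ε > 0, ∃ᶠ j : ℕ in atTop, (θ - ε) * j ≤ (E j : ℝ)) :
    ∃ (ξ : Matrix (Fin n) (Fin m) ℝ) (x : ℕ → Fin m → ℤ) (y : ℕ → Fin n → ℤ),
      TotallyIrrational ξ ∧ IsBestApproxSeq ξ x y ∧ PropB x ∧ PropC ξ x y ∧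
      ¬ PropA ξ ∧ ordExp ξ x y = (w : EReal) := by
  have hm := hA.two_le_m
  have hk := hA.two_le_k
  have hH := hA.two_le_H
  have hH0 := hA.H_pos
  have hlH : 0 < Real.log H := Real.log_pos (by linarith)
  have hlc : Real.log c ≤ 0 := Real.log_nonpos hc.le hc1
  have hlC : 0 ≤ Real.log C := Real.log_nonneg hC
  have hC0 : 0 < C := by linarith
  have hkD : m + 1 ≤ k * D := by nlinarith
  have hmD : k + 1 ≤ m * D := by nlinarith
  have hsA : sA m k H = H ^ (k * D) := by rw [sA, ← hD, Nat.add_sub_cancel]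
  have hsB : sB m k H = H ^ (m * D) := by rw [sB, ← hD, Nat.add_sub_cancel]
  have hElin : ∀ j, E j ≤ k * D * j := fun j => by
    induction j with
    | zero => simp [hE0]
    | succ j ih => have := hE j; rw [mul_add]; omega
  have hexp : ∀ N : ℕ, Real.exp (Real.log H * N) = H ^ N := fun N => by
    rw [mul_comm, Real.exp_nat_mul, Real.exp_log hH0]
  have hP : ∀ (j : ℕ) (t : ℝ), 0 < t →
      Real.exp (Real.log H * (k * D * j) - Real.log H * E j + Real.log t) =
        sA m k H ^ j * (t * (H ^ E j)⁻¹) := fun j t ht => by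
    have := hexp (k * D * j)
    push_cast at this
    rw [Real.exp_add, Real.exp_sub, Real.exp_log ht, hexp, this, hsA, ← pow_mul]
    ring
  have hR : ∀ (j : ℕ) (t : ℝ), 0 < t →
      Real.exp (-(Real.log H * (m * D * j) + Real.log H * E j - Real.log t)) =
        (sB m k H ^ j)⁻¹ * (t * (H ^ E j)⁻¹) := fun j t ht => by
    have := hexp (m * D * j)
    push_cast at this
    rw [Real.exp_neg, Real.exp_sub, Real.exp_add, Real.exp_log ht, hexp, this, hsB, ← pow_mul]
    field_simp
  have hAj : ∀ j, 0 < sA m k H ^ j := fun j => pow_pos hA.sA_pos j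
  have hBj : ∀ j, 0 < sB m k H ^ j := fun j => pow_pos hA.sB_pos j
  have hEr : ∀ j, (E (j + 1) : ℝ) ≤ E j + m := fun j => by exact_mod_cast hE j
  have hEr' : ∀ j, (E j : ℝ) ≤ E (j + 1) + k := fun j => by exact_mod_cast hE' j
  have hkD' : (m + 1 : ℝ) ≤ k * D := by exact_mod_cast hkD
  have hmD' : (k + 1 : ℝ) ≤ m * D := by exact_mod_cast hmD
  have hm0 : (0 : ℝ) ≤ m := Nat.cast_nonneg m
  have hk0 : (0 : ℝ) ≤ k := Nat.cast_nonneg k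
  refine ⟨padRows n ξ, exists_bestApprox_of_scales (by omega)
    (p := fun j => Real.log H * (k * D * j) - Real.log H * E j + Real.log c)
    (r := fun j => Real.log H * (m * D * j) + Real.log H * E j - Real.log c)
    (η := Real.log H) (κ := Real.log H * (k * D + k + (m * D + m)))
    (a := Real.log C - Real.log c) hlH (by linarith) hw
    (fun j => ?_) (fun j => ?_) (fun j => ?_) (fun j => ?_)
    (fun j u v hu hlt => ?_) (fun j => ?_) (fun N => ?_) (fun ε hε => ?_) (fun ε hε hεw => ?_)⟩
  · have := mul_le_mul_of_nonneg_left (by linarith [hEr j] :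
      (1 : ℝ) ≤ k * D - (E (j + 1) - E j)) hlH.le
    push_cast
    linarith
  · have := mul_le_mul_of_nonneg_left (by linarith [hEr' j] :
      k * D - ((E (j + 1) : ℝ) - E j) ≤ k * D + k + (m * D + m)) hlH.le
    push_cast
    linarith
  · have := mul_le_mul_of_nonneg_left (by linarith [hEr' j] :
      (1 : ℝ) ≤ m * D + (E (j + 1) - E j)) hlH.le
    push_cast
    linarith
  · have := mul_le_mul_of_nonneg_left (by linarith [hEr j] :
      m * D + ((E (j + 1) : ℝ) - E j) ≤ k * D + k + (m * D + m)) hlH.le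
    push_cast
    linarith
  · rw [hP j c hc] at hlt
    rw [hR j c hc]
    refine le_trans ?_ (norm_rem_le_err hkn ξ u v)
    set z : Fin m ⊕ Fin k → ℤ := Sum.elim u fun i => v (Fin.castLE hkn i)
    have hz : z ≠ 0 := fun h => hu (funext fun l => congrFun h (Sum.inl l))
    have h1 := (hξ j).1 z hz
    rw [lvl, hgt, le_max_iff] at h1
    rw [inv_mul_le_iff₀ (hBj j)]
    refine h1.resolve_left fun h => hlt.not_ge ?_
    rwa [← div_eq_inv_mul, le_div_iff₀' (hAj j)] at h
  · have e1 : Real.log H * (k * D * j) - Real.log H * E j + Real.log c +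
        (Real.log C - Real.log c) =
        Real.log H * (k * D * j) - Real.log H * E j + Real.log C := by ring
    have e2 : Real.log H * (m * D * j) + Real.log H * E j - Real.log c -
        (Real.log C - Real.log c) =
        Real.log H * (m * D * j) + Real.log H * E j - Real.log C := by ring
    rw [e1, e2, hP j C hC0, hR j C hC0]
    rcases le_or_gt 1 ((sB m k H ^ j)⁻¹ * (C * (H ^ E j)⁻¹)) with h | h
    · refine ⟨fun _ => 1, _, fun h => by simpa using congrFun h ⟨0, by omega⟩, ?_,
        (err_round_le_half _ _).trans (by linarith)⟩
      have : Nonempty (Fin m) := ⟨⟨0, by omega⟩⟩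
      have h1 : nrm (fun _ => 1 : Fin m → ℤ) = 1 := by simp [nrm]
      rw [h1]
      have h2 : H ^ E j ≤ sA m k H ^ j := by
        rw [hsA, ← pow_mul]
        exact pow_le_pow_right₀ (by linarith) (hElin j)
      have h3 : 1 ≤ sA m k H ^ j * (H ^ E j)⁻¹ := by
        rw [← div_eq_mul_inv, le_div_iff₀ (pow_pos hH0 _)]; linarith
      calc (1 : ℝ) ≤ C * (sA m k H ^ j * (H ^ E j)⁻¹) := one_le_mul_of_one_le_of_one_le hC h3
        _ = _ := by ring
    · obtain ⟨z, hz, hzl⟩ := (hξ j).2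
      rw [lvl, hgt, max_le_iff, inv_mul_le_iff₀ (hAj j), ← le_inv_mul_iff₀ (hBj j)] at hzl
      refine ⟨fun l => z (Sum.inl l), _, fun h0 => ?_, hzl.1, (err_padRows_le ξ z).trans hzl.2⟩
      refine (hzl.2.trans_lt h).not_ge ?_
      obtain ⟨i, hi⟩ := Function.ne_iff.mp hz
      have h1 : (1 : ℝ) ≤ |(z i : ℝ)| := by exact_mod_cast Int.one_le_abs hi
      have h2 : xpart z = 0 := funext fun l => by
        have := congrFun h0 l
        simp only [Pi.zero_apply] at this
        simp [xpart, this]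
      rcases i with i | i
      · exact absurd (congrFun h0 i) hi
      · refine h1.trans ?_
        have := norm_le_pi_norm (rem ξ z) i
        simpa [rem, h2] using this
  · obtain ⟨N', hN'⟩ := exists_nat_gt (N / Real.log H)
    obtain ⟨j, hj⟩ := hEtop N'
    refine ⟨j, ?_⟩
    rw [div_lt_iff₀ hlH] at hN'
    have h1 : (N' : ℝ) * Real.log H ≤ E j * Real.log H :=
      mul_le_mul_of_nonneg_right (by exact_mod_cast hj) hlH.le
    have h2 : (0 : ℝ) ≤ Real.log H * (m * D * j) + Real.log H * E j - Real.log c := by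
      have : 0 ≤ Real.log H * (m * D * j) := by positivity
      have : 0 ≤ Real.log H * E j := by positivity
      linarith
    have h3 := mul_le_mul_of_nonneg_right (by exact_mod_cast hkn : (k : ℝ) ≤ n) h2
    refine le_trans ?_ h3
    have h4 : (0 : ℝ) ≤ (m + k - 1) * (E j * Real.log H) := by
      have : (0 : ℝ) ≤ m + k - 1 := by
        have : (2 : ℝ) ≤ m := by exact_mod_cast hm
        linarith
      positivity
    have h5 : 0 ≤ (m + k) * (-Real.log c) := mul_nonneg (by linarith) (by linarith)
    linarith
  · set δ := ε * (k * D - θ) / (2 * (1 + w + ε)) with hδ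
    have hpos : 0 < 1 + w + ε := by linarith
    have hθ' : 0 < k * D - θ := by linarith
    have hδ0 : 0 < δ := by positivity
    have hδe : δ * (1 + w + ε) = ε * (k * D - θ) / 2 := by rw [hδ]; field_simp
    obtain ⟨j₀, hj₀⟩ := exists_nat_gt
      (-Real.log c * (1 + w + ε) / (Real.log H * (ε * (k * D - θ) / 2)))
    filter_upwards [hsup δ hδ0, eventually_ge_atTop j₀] with j h1 h2
    have h3 : (j₀ : ℝ) ≤ j := by exact_mod_cast h2
    have h4 := hj₀.trans_le h3
    rw [div_lt_iff₀ (by positivity)] at h4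
    have h5 := mul_le_mul_of_nonneg_left h1 (by positivity : 0 ≤ Real.log H * (1 + w + ε))
    have h6 : Real.log H * (1 + w + ε) * ((θ + δ) * j) =
        Real.log H * j * (θ * (1 + w + ε) + ε * (k * D - θ) / 2) := by rw [← hδe]; ring
    have h7 : Real.log H * j * (w * (k * D - θ)) = Real.log H * j * (m * D + θ) := by rw [hwθ]
    linarith
  · set δ := ε * (k * D - θ) / (1 + w) with hδ
    have hθ' : 0 < k * D - θ := by linarith
    have hδ0 : 0 < δ := by positivity
    have hδe : δ * (1 + w) = ε * (k * D - θ) := by rw [hδ]; field_simp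
    refine (hsup' δ hδ0).mono fun j h1 => ?_
    have h5 := mul_le_mul_of_nonneg_left h1
      (mul_nonneg hlH.le (by linarith) : 0 ≤ Real.log H * (1 + w - ε))
    have h6 : Real.log H * (1 + w - ε) * ((θ - δ) * j) =
        Real.log H * j * (θ * (1 + w - ε) - ε * (k * D - θ) + δ * ε) := by rw [← hδe]; ring
    have h7 : Real.log H * j * (w * (k * D - θ)) = Real.log H * j * (m * D + θ) := by rw [hwθ]
    have h8 : 0 ≤ Real.log H * j * (δ * ε) := by positivity
    have h9 : 0 ≤ -Real.log c * (1 + w - ε) := mul_nonneg (by linarith) (by linarith)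
    linarith

end Profile

/-- The ordinary exponents attained by matrices with `k` effective rows. -/
theorem exists_bestApprox_of_rows {m k n : ℕ} (hm : 2 ≤ m) (hk : 2 ≤ k) (hkn : k ≤ n) {w : ℝ}
    (hw : (m : ℝ) ≤ k * w) (hw' : (k - 1) * w ≤ m) :
    ∃ (ξ : Matrix (Fin n) (Fin m) ℝ) (x : ℕ → Fin m → ℤ) (y : ℕ → Fin n → ℤ),
      TotallyIrrational ξ ∧ IsBestApproxSeq ξ x y ∧ PropB x ∧ PropC ξ x y ∧
      ¬ PropA ξ ∧ ordExp ξ x y = (w : EReal) := by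
  obtain ⟨H, hA⟩ := exists_admissible hm hk
  obtain ⟨D, hD⟩ : ∃ D, D + 1 = m + k := ⟨m + k - 1, by omega⟩
  have hDr : (D : ℝ) = m + k - 1 := by
    have : (D + 1 : ℝ) = m + k := by exact_mod_cast hD
    linarith
  have hm2 : (2 : ℝ) ≤ m := by exact_mod_cast hm
  have hk2 : (2 : ℝ) ≤ k := by exact_mod_cast hk
  have hw0 : 0 < w := by
    by_contra h
    have : (k : ℝ) * w ≤ 0 := mul_nonpos_of_nonneg_of_nonpos (by linarith) (by linarith)
    linarith
  set θ : ℝ := D * (k * w - m) / (1 + w) with hθ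
  have h1w : 0 < 1 + w := by linarith
  have hθe : θ * (1 + w) = D * (k * w - m) := by rw [hθ]; field_simp
  have hθ0 : 0 ≤ θ := div_nonneg (mul_nonneg (Nat.cast_nonneg _) (by linarith)) h1w.le
  have hθm : θ ≤ m := by
    rw [hθ, div_le_iff₀ h1w, hDr]
    have := mul_le_mul_of_nonneg_left hw' (by linarith : (0 : ℝ) ≤ m + k)
    linarith
  obtain ⟨c, C, p₀, hc, hC, -, hblock⟩ := exists_block hA
  obtain ⟨J, p, E, hJ0, hJ, hmono, hEJ, hE, hE', hEtop, hsup, hsup'⟩ :=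
    exists_profile (m := m) (k := k) (p₀ := p₀) (by omega) (by omega) hθ0 hθm
  obtain ⟨ξ, hξ⟩ := exists_matrix_of_profile hA hblock hJ0 hJ hmono
  have hloss := loss_pos (m := m) (k := k)
  refine exists_bestApprox_of_profile hA hkn (c := min (c / loss m k) 1)
    (C := max (C * loss m k) 1) (lt_min (div_pos hc hloss) one_pos) (min_le_right _ _)
    (le_max_right _ _) (E := E) ?_ hE hE' hEtop (ξ := ξ) (fun j => ?_) hD hw0 (θ := θ) ?_ ?_
    hsup hsup'
  · rw [hEJ 0 0 (by rw [hJ0]) (lt_of_eq_of_lt hJ0.symm (hmono one_pos)), hJ0, Nat.sub_self,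
      blockE_zero]
  · have hlt : ∃ i, j < J (i + 1) := ⟨j, (Nat.lt_succ_self j).trans_le hmono.le_apply⟩
    classical
    have h1 : J (Nat.find hlt) ≤ j := by
      rcases hi : Nat.find hlt with _ | i
      · omega
      · exact not_lt.mp (Nat.find_min hlt (by omega : i < Nat.find hlt))
    rw [hEJ _ j h1 (Nat.find_spec hlt)]
    exact (hξ _ j h1 (Nat.find_spec hlt)).mono hA.H_pos (min_le_left _ _) (le_max_left _ _)
  · rw [hDr]; nlinarith
  · linarith

end LatticePath

/-- For `m, n ≥ 2` and any real `ω ∈ [m/n, m]`, there is a totally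
irrational `ξ` satisfying (B) and (C), not (A), with ordinary exponent `ω`. -/
theorem stmt_11 (m n : ℕ) (hm : 2 ≤ m) (hn : 2 ≤ n)
    (ω : ℝ) (hω₁ : (m : ℝ) / (n : ℝ) ≤ ω) (hω₂ : ω ≤ (m : ℝ)) :
    ∃ (ξ : Matrix (Fin n) (Fin m) ℝ) (x : ℕ → Fin m → ℤ) (y : ℕ → Fin n → ℤ),
      TotallyIrrational ξ ∧ IsBestApproxSeq ξ x y ∧ PropB x ∧ PropC ξ x y ∧
      ¬ PropA ξ ∧ ordExp ξ x y = (ω : EReal) := by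
  classical
  have hex : ∃ k : ℕ, 2 ≤ k ∧ (m : ℝ) ≤ k * ω := by
    refine ⟨n, hn, ?_⟩
    rwa [div_le_iff₀' (by exact_mod_cast (by omega : 0 < n))] at hω₁
  obtain ⟨hk, hkω⟩ := Nat.find_spec hex
  have hkn : Nat.find hex ≤ n := Nat.find_min' hex ⟨hn, by
    rwa [div_le_iff₀' (by exact_mod_cast (by omega : 0 < n))] at hω₁⟩
  refine LatticePath.exists_bestApprox_of_rows hm hk hkn hkω ?_
  rcases hk.eq_or_lt with h | h
  · rw [← h]
    push_cast
    linarith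
  · have h1 := Nat.find_min hex (Nat.sub_lt (by omega : 0 < Nat.find hex) one_pos)
    push Not at h1
    have h2 := h1 (by omega)
    rw [Nat.cast_sub (by omega), Nat.cast_one] at h2
    exact h2.le
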